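/- Let G be a finite group with character χ of a unitary representation and Δ_G := min_{g≠1} Re(χ(1) − χ(g)); let β ≥ (1/Δ_G)(114 + 4 log|G|), L ≥ 0, and let B₁, B₂ ⊆ Λ be rectangles at ℓ∞ distance at least L from each other. There exists a set E(B₁,B₂) ⊆ Ω² such that for Ψ₁, Ψ₂ independent with law ν_{Λ,β}, P((Ψ₁,Ψ₂) ∉ E(B₁,B₂)) ≤ 2 (4·10²⁴ |G|²)^{|B₁|+|B₂|} e^{−(β/2) Δ_G (L−1)}, and there exists a bijection T : E(B₁,B₂) → E(B₁,B₂) that is a swapping map with respect to (E(B₁,B₂), h₁, h₂, ν_{Λ,β}) for every pair of functions h₁, h₂ : Ω → ℂ of the following form: for i = 1, 2, h_i(ψ) = f_i(ψ(ξ_{γ₁^{(i)}}), …, ψ(ξ_{γ_{k_i}^{(i)}})) where k_i ≥ 1, f_i : G^{k_i} → ℂ is conjugacy invariant, and γ₁^{(i)}, …, γ_{k_i}^{(i)} are closed loops contained in B_i. -/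

import Mathlib

open Classical SimpleGraph
open scoped BigOperators

noncomputable section

namespace LGT

/-- A site of `ℤ⁴`. -/
abbrev Site : Type := Fin 4 → ℤ

/-- The `i`-th coordinate unit vector. -/
def unit (i : Fin 4) : Site := fun j => if j = i then 1 else 0

lemma unit_apply_self (i : Fin 4) : unit i i = 1 := by simp [unit]

lemma unit_apply_nonneg (i j : Fin 4) : 0 ≤ unit i j := by
  by_cases h : j = i <;> simp [unit, h]

lemma unit_ne_zero (i : Fin 4) : unit i ≠ 0 := by
  intro h
  have h1 := congrFun h i
  rw [unit_apply_self] at h1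
  exact one_ne_zero h1

/-- The lattice `Λ = ([a₁,b₁] × ⋯ × [a₄,b₄]) ∩ ℤ⁴`, with all side lengths equal. -/
structure Box where
  a : Fin 4 → ℤ
  b : Fin 4 → ℤ
  side_eq : ∀ i j : Fin 4, b i - a i = b j - a j

/-- Membership of a site in the lattice `Λ`. -/
def Box.mem (Λ : Box) (x : Site) : Prop := ∀ i, Λ.a i ≤ x i ∧ x i ≤ Λ.b i

/-- The set of vertices `Λ₀` of the lattice. -/
abbrev VSite (Λ : Box) : Type := {x : Site // Λ.mem x}

lemma not_both {x y : Site} {i j : Fin 4} (h1 : y = x + unit i) (h2 : x = y + unit j) :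
    False := by
  subst h1
  rw [add_assoc] at h2
  have h3 : unit i + unit j = 0 := left_eq_add.mp h2
  have h4 := congrFun h3 i
  rw [Pi.add_apply, Pi.zero_apply, unit_apply_self] at h4
  have h5 : (0:ℤ) ≤ unit j i := unit_apply_nonneg j i
  omega

/-- The 1-skeleton `S₁(Λ)` of the lattice, as a graph on the vertices of `Λ`:
two vertices are adjacent iff they differ by a coordinate unit vector. -/
def latticeGraph (Λ : Box) : SimpleGraph (VSite Λ) where
  Adj u v := ∃ i : Fin 4, (v : Site) = (u : Site) + unit i ∨ (u : Site) = (v : Site) + unit i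
  symm := by
    constructor
    rintro u v ⟨i, h | h⟩
    · exact ⟨i, Or.inr h⟩
    · exact ⟨i, Or.inl h⟩
  loopless := by
    constructor
    rintro u ⟨i, h | h⟩ <;> exact unit_ne_zero i (left_eq_add.mp h)

/-- The set `Λ₁` of positively oriented nearest-neighbour edges of `Λ`:
an edge is a pair (base site, direction) whose endpoints both lie in `Λ`. -/
abbrev PEdge (Λ : Box) : Type :=
  {e : Site × Fin 4 // Λ.mem e.1 ∧ Λ.mem (e.1 + unit e.2)}

/-- The initial vertex of a positively oriented edge. -/
def PEdge.v0 {Λ : Box} (e : PEdge Λ) : VSite Λ := ⟨e.1.1, e.2.1⟩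

/-- The final vertex of a positively oriented edge. -/
def PEdge.v1 {Λ : Box} (e : PEdge Λ) : VSite Λ := ⟨e.1.1 + unit e.1.2, e.2.2⟩

/-- Edge configurations `σ ∈ G^{Λ₁}`. -/
abbrev EdgeConf (Λ : Box) (G : Type*) : Type _ := PEdge Λ → G

variable {G : Type*} [Group G]

/-- The value of an edge configuration on an oriented edge `(u, v)`:
`σ_e` on positively oriented edges, `σ_e⁻¹` on negatively oriented ones. -/
def oval {Λ : Box} (σ : EdgeConf Λ G) (u v : VSite Λ) : G :=
  if h : ∃ i : Fin 4, (v : Site) = (u : Site) + unit i then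
    σ ⟨((u : Site), h.choose), u.2, by rw [← h.choose_spec]; exact v.2⟩
  else if h' : ∃ i : Fin 4, (u : Site) = (v : Site) + unit i then
    (σ ⟨((v : Site), h'.choose), v.2, by rw [← h'.choose_spec]; exact u.2⟩)⁻¹
  else 1

/-- The holonomy `σ_γ = σ_{e₁} ⋯ σ_{eₙ}` of an edge configuration along a walk. -/
def hol {Λ : Box} (σ : EdgeConf Λ G) {u v : VSite Λ}
    (w : (latticeGraph Λ).Walk u v) : G :=
  (w.darts.map fun d => oval σ d.toProd.1 d.toProd.2).prod

@[simp] lemma hol_nil {Λ : Box} (σ : EdgeConf Λ G) {u : VSite Λ} :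
    hol σ (SimpleGraph.Walk.nil : (latticeGraph Λ).Walk u u) = 1 := by simp [hol]

lemma hol_cons {Λ : Box} (σ : EdgeConf Λ G) {u m v : VSite Λ}
    (h : (latticeGraph Λ).Adj u m) (q : (latticeGraph Λ).Walk m v) :
    hol σ (SimpleGraph.Walk.cons h q) = oval σ u m * hol σ q := by
  simp [hol]

lemma hol_append {Λ : Box} (σ : EdgeConf Λ G) {u v w : VSite Λ}
    (p : (latticeGraph Λ).Walk u v) (q : (latticeGraph Λ).Walk v w) :
    hol σ (p.append q) = hol σ p * hol σ q := by
  simp [hol, SimpleGraph.Walk.darts_append]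

lemma oval_mul_oval {Λ : Box} (σ : EdgeConf Λ G) {u v : VSite Λ}
    (h : (latticeGraph Λ).Adj u v) : oval σ u v * oval σ v u = 1 := by
  obtain ⟨i, hi | hi⟩ := h
  · have h1 : ∃ k : Fin 4, (v : Site) = (u : Site) + unit k := ⟨i, hi⟩
    have h2 : ¬ ∃ k : Fin 4, (u : Site) = (v : Site) + unit k := by
      rintro ⟨k, hk⟩; exact not_both hi hk
    simp only [oval]
    rw [dif_pos h1, dif_neg h2, dif_pos h1]
    exact mul_inv_cancel _
  · have h1 : ∃ k : Fin 4, (u : Site) = (v : Site) + unit k := ⟨i, hi⟩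
    have h2 : ¬ ∃ k : Fin 4, (v : Site) = (u : Site) + unit k := by
      rintro ⟨k, hk⟩; exact not_both hk hi
    simp only [oval]
    rw [dif_neg h2, dif_pos h1, dif_pos h1]
    exact inv_mul_cancel _

/-- One step of combinatorial homotopy of walks in the 1-skeleton:
inserting or removing a backtracking `e e⁻¹`. -/
inductive HStep {Λ : Box} :
    {u v : VSite Λ} → (latticeGraph Λ).Walk u v → (latticeGraph Λ).Walk u v → Prop
  | mk {u x y v : VSite Λ} (p : (latticeGraph Λ).Walk u x) (h : (latticeGraph Λ).Adj x y)
      (q : (latticeGraph Λ).Walk x v) :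
      HStep (p.append (SimpleGraph.Walk.cons h (SimpleGraph.Walk.cons h.symm q)))
        (p.append q)

/-- Two walks in the 1-skeleton are homotopic if they differ by finitely many
insertions/removals of backtrackings.  The equivalence classes of closed walks based
at `x₀` are exactly the elements of the fundamental group `π₁(S₁(Λ), x₀)`. -/
def Homotopic {Λ : Box} {u v : VSite Λ}
    (w₁ w₂ : (latticeGraph Λ).Walk u v) : Prop :=
  Relation.EqvGen (@HStep Λ u v) w₁ w₂

lemma hol_of_hstep {Λ : Box} (σ : EdgeConf Λ G) {u v : VSite Λ}
    {w₁ w₂ : (latticeGraph Λ).Walk u v} (h : HStep w₁ w₂) : hol σ w₁ = hol σ w₂ := by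
  cases h with
  | mk p had q =>
    simp only [hol_append, hol_cons, ← mul_assoc]
    rw [mul_assoc (hol σ p), oval_mul_oval σ had, mul_one]

lemma hol_homotopic {Λ : Box} (σ : EdgeConf Λ G) {u v : VSite Λ}
    {w₁ w₂ : (latticeGraph Λ).Walk u v} (h : Homotopic w₁ w₂) : hol σ w₁ = hol σ w₂ := by
  induction h with
  | rel _ _ hs => exact hol_of_hstep σ hs
  | refl _ => rfl
  | symm _ _ _ ih => exact ih.symm
  | trans _ _ _ _ _ ih₁ ih₂ => exact ih₁.trans ih₂

/-- The set `Ω = Hom(π₁(S₁(Λ), x₀), G)` of homomorphisms from the fundamental group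
of the 1-skeleton based at `x₀` to `G`, modelled as functions on closed walks at `x₀`
that are homotopy invariant and multiplicative under concatenation. -/
structure Hom (Λ : Box) (x₀ : VSite Λ) (G : Type*) [Group G] where
  toFun : (latticeGraph Λ).Walk x₀ x₀ → G
  invariant : ∀ w₁ w₂ : (latticeGraph Λ).Walk x₀ x₀, Homotopic w₁ w₂ → toFun w₁ = toFun w₂
  map_mul : ∀ w₁ w₂ : (latticeGraph Λ).Walk x₀ x₀, toFun (w₁.append w₂) = toFun w₁ * toFun w₂

/-- The map `ψ_{x₀} : G^{Λ₁} → Ω` sending an edge configuration to the induced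
homomorphism of the fundamental group, given by holonomy along loops. -/
def psi (Λ : Box) (x₀ : VSite Λ) (σ : EdgeConf Λ G) : Hom Λ x₀ G where
  toFun := hol σ
  invariant := fun _ _ h => hol_homotopic σ h
  map_mul := fun w₁ w₂ => hol_append σ w₁ w₂


/-- The set `Λ₂` of plaquettes of `Λ`: unit squares, given by a base site and two
distinct directions, all four of whose corners (hence all four boundary edges) lie in `Λ`. -/
abbrev Plaq (Λ : Box) : Type :=
  {q : Site × Fin 4 × Fin 4 //
    q.2.1 < q.2.2 ∧ Λ.mem q.1 ∧ Λ.mem (q.1 + unit q.2.1) ∧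
    Λ.mem (q.1 + unit q.2.1 + unit q.2.2) ∧ Λ.mem (q.1 + unit q.2.2)}

namespace Plaq

variable {Λ : Box}

/-- First corner `x₁` of a plaquette. -/
def c0 (p : Plaq Λ) : VSite Λ := ⟨p.1.1, p.2.2.1⟩
/-- Second corner `x₂` of a plaquette. -/
def c1 (p : Plaq Λ) : VSite Λ := ⟨p.1.1 + unit p.1.2.1, p.2.2.2.1⟩
/-- Third corner `x₃` of a plaquette. -/
def c2 (p : Plaq Λ) : VSite Λ := ⟨p.1.1 + unit p.1.2.1 + unit p.1.2.2, p.2.2.2.2.1⟩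
/-- Fourth corner `x₄` of a plaquette. -/
def c3 (p : Plaq Λ) : VSite Λ := ⟨p.1.1 + unit p.1.2.2, p.2.2.2.2.2⟩

/-- A site is a corner (vertex) of the plaquette. -/
def isCorner (p : Plaq Λ) (x : Site) : Prop :=
  x = (p.c0 : Site) ∨ x = (p.c1 : Site) ∨ x = (p.c2 : Site) ∨ x = (p.c3 : Site)

lemma adj01 (p : Plaq Λ) : (latticeGraph Λ).Adj p.c0 p.c1 := ⟨p.1.2.1, Or.inl rfl⟩
lemma adj12 (p : Plaq Λ) : (latticeGraph Λ).Adj p.c1 p.c2 := ⟨p.1.2.2, Or.inl rfl⟩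
lemma adj23 (p : Plaq Λ) : (latticeGraph Λ).Adj p.c2 p.c3 :=
  ⟨p.1.2.1, Or.inr (add_right_comm p.1.1 (unit p.1.2.1) (unit p.1.2.2))⟩
lemma adj30 (p : Plaq Λ) : (latticeGraph Λ).Adj p.c3 p.c0 := ⟨p.1.2.2, Or.inr rfl⟩

end Plaq

/-- The counter-clockwise boundary loop `γ_p : x₁ → x₂ → x₃ → x₄ → x₁` of a plaquette. -/
def plaqWalk {Λ : Box} (p : Plaq Λ) : (latticeGraph Λ).Walk p.c0 p.c0 :=
  SimpleGraph.Walk.cons p.adj01 (SimpleGraph.Walk.cons p.adj12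
    (SimpleGraph.Walk.cons p.adj23 (SimpleGraph.Walk.cons p.adj30 SimpleGraph.Walk.nil)))

variable {G : Type*} [Group G]

/-- The plaquette variable `σ_p`: the holonomy of `σ` around the boundary of `p`. -/
def holP {Λ : Box} (σ : EdgeConf Λ G) (p : Plaq Λ) : G := hol σ (plaqWalk p)

/-- The support of an edge configuration: the plaquettes `p` with `σ_p ≠ 1`. -/
def esupp {Λ : Box} (σ : EdgeConf Λ G) : Set (Plaq Λ) := {p | holP σ p ≠ 1}

/-- The character `χ = Tr ρ` of a unitary representation `ρ` of `G` of dimension `d`. -/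
def chi {G : Type*} [Group G] {d : ℕ} (ρ : G →* Matrix.unitaryGroup (Fin d) ℂ) (g : G) : ℂ :=
  Matrix.trace ((ρ g : Matrix (Fin d) (Fin d) ℂ))

/-- `Δ_G := min_{g ≠ 1} Re (χ(1) - χ(g))`. -/
def DeltaG (G : Type*) [Group G] (χ : G → ℂ) : ℝ :=
  sInf ((fun g => (χ 1 - χ g).re) '' {g : G | g ≠ 1})

/-- `φ_β(g) = exp(-β Re(χ(1) - χ(g)))`. -/
def phiB {G : Type*} [Group G] (χ : G → ℂ) (β : ℝ) (g : G) : ℝ :=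
  Real.exp (-(β * (χ 1 - χ g).re))

/-- The Wilson action `S_Λ(σ) = Σ_{p ∈ Λ₂} Re (χ(1) - χ(σ_p))`. -/
def action (Λ : Box) (χ : G → ℂ) (σ : EdgeConf Λ G) : ℝ :=
  ∑ᶠ p : Plaq Λ, (χ 1 - χ (holP σ p)).re

/-- The partition function `Z_{Λ,β}` of the lattice gauge theory. -/
def muZ (Λ : Box) (G : Type*) [Group G] (χ : G → ℂ) (β : ℝ) : ℝ :=
  ∑ᶠ σ : EdgeConf Λ G, Real.exp (-(β * action Λ χ σ))

/-- The probability `μ_{Λ,β}(σ) = Z⁻¹ e^{-β S_Λ(σ)}` of an edge configuration. -/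
def muP (Λ : Box) (χ : G → ℂ) (β : ℝ) (σ : EdgeConf Λ G) : ℝ :=
  Real.exp (-(β * action Λ χ σ)) / muZ Λ G χ β

/-- Expectation `E[f(Σ)]` for `Σ ∼ μ_{Λ,β}`. -/
def muE (Λ : Box) (χ : G → ℂ) (β : ℝ) (f : EdgeConf Λ G → ℂ) : ℂ :=
  ∑ᶠ σ : EdgeConf Λ G, (muP Λ χ β σ : ℂ) * f σ

/-- Covariance `Cov(f(Σ), g(Σ))` for `Σ ∼ μ_{Λ,β}`. -/
def muCov (Λ : Box) (χ : G → ℂ) (β : ℝ) (f g : EdgeConf Λ G → ℂ) : ℂ :=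
  muE Λ χ β (fun σ => f σ * g σ) - muE Λ χ β f * muE Λ χ β g

section HomSide

variable (Λ : Box) (x₀ : VSite Λ)

/-- Given fixed paths `ℓ(x₀,x)` and a closed loop `γ` based at `u`, the loop
`ξ_γ = ℓ(x₀,u) γ ℓ(x₀,u)⁻¹ ∈ π₁(S₁(Λ), x₀)` (as a based closed walk). -/
def xiLoop (ℓb : ∀ x : VSite Λ, (latticeGraph Λ).Walk x₀ x) {u : VSite Λ}
    (γ : (latticeGraph Λ).Walk u u) : (latticeGraph Λ).Walk x₀ x₀ :=
  (ℓb u).append (γ.append (ℓb u).reverse)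

variable {Λ x₀}

/-- `ψ(ξ_γ)` for a homomorphism `ψ ∈ Ω` and a closed loop `γ`. -/
def evalLoop (ψ : Hom Λ x₀ G) (ℓb : ∀ x : VSite Λ, (latticeGraph Λ).Walk x₀ x)
    {u : VSite Λ} (γ : (latticeGraph Λ).Walk u u) : G :=
  ψ.toFun (xiLoop Λ x₀ ℓb γ)

/-- `ψ(ξ_p)` for a plaquette `p`. -/
def evalP (ψ : Hom Λ x₀ G) (ℓb : ∀ x : VSite Λ, (latticeGraph Λ).Walk x₀ x)
    (p : Plaq Λ) : G :=
  evalLoop ψ ℓb (plaqWalk p)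

/-- The support `supp(ψ) = {p ∈ Λ₂ : ψ(ξ_p) ≠ 1}` of a homomorphism. -/
def hsupp (ψ : Hom Λ x₀ G) (ℓb : ∀ x : VSite Λ, (latticeGraph Λ).Walk x₀ x) :
    Set (Plaq Λ) :=
  {p | evalP ψ ℓb p ≠ 1}

variable (Λ x₀)

/-- The (unnormalized) weight `∏_{p ∈ Λ₂} φ_β(ψ(ξ_p))` of a homomorphism. -/
def nuW (χ : G → ℂ) (β : ℝ) (ℓb : ∀ x : VSite Λ, (latticeGraph Λ).Walk x₀ x)
    (ψ : Hom Λ x₀ G) : ℝ :=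
  ∏ᶠ p : Plaq Λ, phiB χ β (evalP ψ ℓb p)

/-- The normalizing constant `Z^ν_{Λ,β}`. -/
def nuZ (G : Type*) [Group G] (χ : G → ℂ) (β : ℝ)
    (ℓb : ∀ x : VSite Λ, (latticeGraph Λ).Walk x₀ x) : ℝ :=
  ∑ᶠ ψ : Hom Λ x₀ G, nuW Λ x₀ χ β ℓb ψ

/-- The probability `ν_{Λ,β}(ψ)` of a homomorphism. -/
def nuP (χ : G → ℂ) (β : ℝ) (ℓb : ∀ x : VSite Λ, (latticeGraph Λ).Walk x₀ x)
    (ψ : Hom Λ x₀ G) : ℝ :=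
  nuW Λ x₀ χ β ℓb ψ / nuZ Λ x₀ G χ β ℓb

/-- Expectation `E[h(Ψ)]` for `Ψ ∼ ν_{Λ,β}`. -/
def nuE (χ : G → ℂ) (β : ℝ) (ℓb : ∀ x : VSite Λ, (latticeGraph Λ).Walk x₀ x)
    (h : Hom Λ x₀ G → ℂ) : ℂ :=
  ∑ᶠ ψ : Hom Λ x₀ G, (nuP Λ x₀ χ β ℓb ψ : ℂ) * h ψ

/-- Covariance `Cov(h₁(Ψ), h₂(Ψ))` for `Ψ ∼ ν_{Λ,β}`. -/
def nuCov (χ : G → ℂ) (β : ℝ) (ℓb : ∀ x : VSite Λ, (latticeGraph Λ).Walk x₀ x)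
    (h₁ h₂ : Hom Λ x₀ G → ℂ) : ℂ :=
  nuE Λ x₀ χ β ℓb (fun ψ => h₁ ψ * h₂ ψ) - nuE Λ x₀ χ β ℓb h₁ * nuE Λ x₀ χ β ℓb h₂

/-- For `Ψ₁, Ψ₂` i.i.d. `∼ ν_{Λ,β}`, the probability `P((Ψ₁,Ψ₂) ∈ S)`. -/
def nuP2 (χ : G → ℂ) (β : ℝ) (ℓb : ∀ x : VSite Λ, (latticeGraph Λ).Walk x₀ x)
    (S : Set (Hom Λ x₀ G × Hom Λ x₀ G)) : ℝ :=
  ∑ᶠ pr ∈ S, nuP Λ x₀ χ β ℓb pr.1 * nuP Λ x₀ χ β ℓb pr.2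

end HomSide

/-- Conjugacy invariance: `f(h₁⁻¹g₁h₁, …, h_k⁻¹g_kh_k) = f(g₁, …, g_k)`. -/
def ConjInvariant {G : Type*} [Group G] {k : ℕ} (f : (Fin k → G) → ℂ) : Prop :=
  ∀ g h : Fin k → G, f (fun i => (h i)⁻¹ * g i * h i) = f g

/-- The sup norm `‖f‖_∞` of a complex-valued function. -/
def supNorm {α : Type*} (f : α → ℂ) : ℝ := ⨆ x, ‖f x‖


/-- A rectangle `B = [x₁,y₁] × ⋯ × [x₄,y₄]` contained in `Λ` (degenerate sides allowed). -/
structure Rect (Λ : Box) where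
  lo : Fin 4 → ℤ
  hi : Fin 4 → ℤ
  lo_le_hi : ∀ i, lo i ≤ hi i
  a_le_lo : ∀ i, Λ.a i ≤ lo i
  hi_le_b : ∀ i, hi i ≤ Λ.b i

namespace Rect

variable {Λ : Box}

/-- A site is a vertex of the rectangle. -/
def memV (B : Rect Λ) (x : Site) : Prop := ∀ i, B.lo i ≤ x i ∧ x i ≤ B.hi i

/-- A plaquette is contained in the rectangle (all four corners are vertices of it). -/
def plaqIn (B : Rect Λ) (p : Plaq Λ) : Prop :=
  B.memV (p.c0 : Site) ∧ B.memV (p.c1 : Site) ∧ B.memV (p.c2 : Site) ∧ B.memV (p.c3 : Site)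

/-- The set of plaquettes contained in the rectangle. -/
def plaqSet (B : Rect Λ) : Set (Plaq Λ) := {p | B.plaqIn p}

/-- `|B|`: the number of plaquettes contained in the rectangle. -/
def plaqCard (B : Rect Λ) : ℕ := Nat.card B.plaqSet

end Rect

/-- A walk is contained in a rectangle if all its vertices are vertices of the rectangle. -/
def WalkInRect {Λ : Box} (B : Rect Λ) {u v : VSite Λ}
    (w : (latticeGraph Λ).Walk u v) : Prop :=
  ∀ x ∈ w.support, B.memV (x : Site)

/-- The four boundary edges of a plaquette (as ordered pairs of vertices). -/
def plaqEdges {Λ : Box} (p : Plaq Λ) : List (VSite Λ × VSite Λ) :=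
  [(p.c0, p.c1), (p.c1, p.c2), (p.c3, p.c2), (p.c0, p.c3)]

/-- `(u,v)` is an (unoriented) edge of the 2-complex generated by the plaquette set `Q`. -/
def edgeInComplex {Λ : Box} (Q : Set (Plaq Λ)) (u v : VSite Λ) : Prop :=
  ∃ p ∈ Q, (u, v) ∈ plaqEdges p ∨ (v, u) ∈ plaqEdges p

/-- `u` is a vertex of the 2-complex generated by the plaquette set `Q`. -/
def vertexInComplex {Λ : Box} (Q : Set (Plaq Λ)) (u : VSite Λ) : Prop :=
  ∃ p ∈ Q, u = p.c0 ∨ u = p.c1 ∨ u = p.c2 ∨ u = p.c3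

/-- A walk lies in the 2-complex generated by `Q` if all its vertices and edges do. -/
def WalkInComplex {Λ : Box} (Q : Set (Plaq Λ)) {u v : VSite Λ}
    (w : (latticeGraph Λ).Walk u v) : Prop :=
  (∀ x ∈ w.support, vertexInComplex Q x) ∧
  (∀ d ∈ w.darts, edgeInComplex Q d.toProd.1 d.toProd.2)

/-- One step of combinatorial homotopy of walks within the 2-complex generated by `Q`:
inserting/removing a backtracking along an edge of the complex, or inserting/removing the
boundary loop of a plaquette of the complex. -/
inductive CHStep {Λ : Box} (Q : Set (Plaq Λ)) :
    {u v : VSite Λ} → (latticeGraph Λ).Walk u v → (latticeGraph Λ).Walk u v → Prop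
  | back {u x y v : VSite Λ} (p : (latticeGraph Λ).Walk u x) (h : (latticeGraph Λ).Adj x y)
      (he : edgeInComplex Q x y) (q : (latticeGraph Λ).Walk x v) :
      CHStep Q (p.append (SimpleGraph.Walk.cons h (SimpleGraph.Walk.cons h.symm q)))
        (p.append q)
  | plaq {u v : VSite Λ} (pl : Plaq Λ) (hpl : pl ∈ Q)
      (w₁ : (latticeGraph Λ).Walk u pl.c0) (w₂ : (latticeGraph Λ).Walk pl.c0 v) :
      CHStep Q (w₁.append ((plaqWalk pl).append w₂)) (w₁.append w₂)

/-- Homotopy of walks within the 2-complex generated by `Q`. -/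
def CHomotopic {Λ : Box} (Q : Set (Plaq Λ)) {u v : VSite Λ}
    (w₁ w₂ : (latticeGraph Λ).Walk u v) : Prop :=
  Relation.EqvGen (@CHStep Λ Q u v) w₁ w₂

/-- A 2-complex (given by a plaquette set `Q`, together with all its edges and vertices)
is simply connected: it is path connected and every closed walk in it is null-homotopic
within it. -/
def SimplyConnectedC {Λ : Box} (Q : Set (Plaq Λ)) : Prop :=
  (∀ u v : VSite Λ, vertexInComplex Q u → vertexInComplex Q v →
     ∃ w : (latticeGraph Λ).Walk u v, WalkInComplex Q w) ∧
  (∀ u : VSite Λ, ∀ w : (latticeGraph Λ).Walk u u, WalkInComplex Q w →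
     CHomotopic Q w SimpleGraph.Walk.nil)

/-- The 2-complex `S₂(B)`: all plaquettes of the rectangle `B`. -/
def S2 {Λ : Box} (B : Rect Λ) : Set (Plaq Λ) := B.plaqSet

/-- A plaquette lies on the (topological) boundary of a rectangle. -/
def Plaq.onRectBoundary {Λ : Box} (B : Rect Λ) (p : Plaq Λ) : Prop :=
  B.plaqIn p ∧ ∃ k : Fin 4, k ≠ p.1.2.1 ∧ k ≠ p.1.2.2 ∧
    (p.1.1 k = B.lo k ∨ p.1.1 k = B.hi k)

/-- A plaquette lies on the boundary of the lattice `Λ`. -/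
def Plaq.onBoxBoundary {Λ : Box} (p : Plaq Λ) : Prop :=
  ∃ k : Fin 4, k ≠ p.1.2.1 ∧ k ≠ p.1.2.2 ∧ (p.1.1 k = Λ.a k ∨ p.1.1 k = Λ.b k)

/-- The 2-complex `∂S₂(B)`: plaquettes on the boundary of `B` but not on the boundary of `Λ`. -/
def bS2 {Λ : Box} (B : Rect Λ) : Set (Plaq Λ) :=
  {p | p.onRectBoundary B ∧ ¬ p.onBoxBoundary}

/-- The 2-complex `S₂ᶜ(B)`: all plaquettes of `Λ` not contained in `B`, together with `∂S₂(B)`. -/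
def S2c {Λ : Box} (B : Rect Λ) : Set (Plaq Λ) :=
  {p | ¬ B.plaqIn p} ∪ bS2 B

/-- `P₁, P₂` are well separated by the rectangle `B`. -/
def WellSeparated {Λ : Box} (B : Rect Λ) (P₁ P₂ : Set (Plaq Λ)) : Prop :=
  P₁ ⊆ S2 B ∧ P₂ ⊆ S2c B ∧ ∀ p ∈ P₁ ∪ P₂, p ∉ bS2 B

/-- A good rectangle: `S₂(B)`, `S₂ᶜ(B)` and `∂S₂(B)` are all simply connected. -/
def GoodRect {Λ : Box} (B : Rect Λ) : Prop :=
  SimplyConnectedC (S2 B) ∧ SimplyConnectedC (S2c B) ∧ SimplyConnectedC (bS2 B)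

/-- `P₁` is well separated from `P₂` by some good rectangle. -/
def WellSepGood {Λ : Box} (P₁ P₂ : Set (Plaq Λ)) : Prop :=
  ∃ B : Rect Λ, GoodRect B ∧ WellSeparated B P₁ P₂

/-- Union of a list of sets. -/
def unionList {α : Type*} (Ks : List (Set α)) : Set α := {x | ∃ K ∈ Ks, x ∈ K}

/-- `Ks` is a knot decomposition of the plaquette set `P`: a maximal partition
`P = K₁ ∪ ⋯ ∪ K_m` such that each `K_i` is well separated from `K_{i+1} ∪ ⋯ ∪ K_m`
by a good rectangle. -/
structure IsKnotDecomp {Λ : Box} (P : Set (Plaq Λ)) (Ks : List (Set (Plaq Λ))) : Prop where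
  union_eq : unionList Ks = P
  nonempty : ∀ K ∈ Ks, K.Nonempty
  pairwise_disjoint : Ks.Pairwise Disjoint
  sep : ∀ (n : ℕ) (hn : n + 1 < Ks.length),
    WellSepGood (Ks.get ⟨n, Nat.lt_of_succ_lt hn⟩) (unionList (Ks.drop (n + 1)))
  maximal : ∀ K ∈ Ks, ¬ ∃ K₁ K₂ : Set (Plaq Λ), K₁.Nonempty ∧ K₂.Nonempty ∧
    Disjoint K₁ K₂ ∧ K₁ ∪ K₂ = K ∧ WellSepGood K₁ K₂

/-- The collection `𝒦` of knots: all sets appearing in the (fixed) knot decomposition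
`KD P` of some plaquette set `P`. -/
def Knots {Λ : Box} (KD : Set (Plaq Λ) → List (Set (Plaq Λ))) : Set (Set (Plaq Λ)) :=
  {K | ∃ P : Set (Plaq Λ), K ∈ KD P}

/-- `GF(T)`: edge configurations equal to `1` on every edge of the graph `T`. -/
def GF {Λ : Box} (G : Type*) [Group G] (T : SimpleGraph (VSite Λ)) :
    Set (EdgeConf Λ G) :=
  {σ | ∀ e : PEdge Λ, T.Adj e.v0 e.v1 → σ e = 1}

/-- The 1-skeleton of the 2-complex generated by the plaquette set `Q`, as a graph. -/
def skel {Λ : Box} (Q : Set (Plaq Λ)) : SimpleGraph (VSite Λ) :=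
  SimpleGraph.fromRel (edgeInComplex Q)

/-- `T` is a spanning tree of the 1-skeleton `S₁(Λ)`. -/
def IsSpanningTree {Λ : Box} (T : SimpleGraph (VSite Λ)) : Prop :=
  T ≤ latticeGraph Λ ∧ T.IsTree

/-- `T` contains a spanning tree of the 2-complex generated by `Q`: any two vertices of the
complex are joined by a path using only edges lying both in `T` and in the complex. -/
def ContainsSpanningTreeOf {Λ : Box} (T : SimpleGraph (VSite Λ)) (Q : Set (Plaq Λ)) : Prop :=
  ∀ u v : VSite Λ, vertexInComplex Q u → vertexInComplex Q v → (T ⊓ skel Q).Reachable u v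

section Phi

variable (Λ : Box) (x₀ : VSite Λ) {G : Type*} [Group G]

/-- `supp_{P₀}(ψ₁, ψ₂) = supp(ψ₁) ∪ supp(ψ₂) ∪ P₀`. -/
def supp2 (ℓb : ∀ x : VSite Λ, (latticeGraph Λ).Walk x₀ x) (P₀ : Set (Plaq Λ))
    (ψ₁ ψ₂ : Hom Λ x₀ G) : Set (Plaq Λ) :=
  hsupp ψ₁ ℓb ∪ hsupp ψ₂ ℓb ∪ P₀

/-- The polymer counting function
`Φ²_{P₀}(P) = Σ_{ψ₁,ψ₂ : supp_{P₀}(ψ₁,ψ₂) = P} ∏_{p∈Λ₂} φ_β(ψ₁(ξ_p)) φ_β(ψ₂(ξ_p))`. -/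
def Phi2 (χ : G → ℂ) (β : ℝ) (ℓb : ∀ x : VSite Λ, (latticeGraph Λ).Walk x₀ x)
    (P₀ P : Set (Plaq Λ)) : ℝ :=
  ∑ᶠ pr : Hom Λ x₀ G × Hom Λ x₀ G,
    if supp2 Λ x₀ ℓb P₀ pr.1 pr.2 = P then
      ∏ᶠ p : Plaq Λ, phiB χ β (evalP pr.1 ℓb p) * phiB χ β (evalP pr.2 ℓb p)
    else 0

end Phi


section Swap

variable (Λ : Box) (x₀ : VSite Λ) (G : Type*) [Group G]

/-- Tuples of homomorphisms subordinate to the members of a list of plaquette sets. -/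
def TupleSpace (ℓb : ∀ x : VSite Λ, (latticeGraph Λ).Walk x₀ x)
    (Ks : List (Set (Plaq Λ))) : Type _ :=
  {t : Fin Ks.length → Hom Λ x₀ G // ∀ i, hsupp (t i) ℓb ⊆ Ks.get i}

/-- `P := supp(ψ₁) ∪ supp(ψ₂) ∪ B₁ ∪ B₂` for a pair of homomorphisms. -/
def bigP (ℓb : ∀ x : VSite Λ, (latticeGraph Λ).Walk x₀ x) (B₁ B₂ : Rect Λ)
    (pr : Hom Λ x₀ G × Hom Λ x₀ G) : Set (Plaq Λ) :=
  hsupp pr.1 ℓb ∪ hsupp pr.2 ℓb ∪ S2 B₁ ∪ S2 B₂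

/-- `B₁` and `B₂` lie in different knots of the knot decomposition of
`supp(ψ₁) ∪ supp(ψ₂) ∪ B₁ ∪ B₂`. -/
def inDiffKnots (KD : Set (Plaq Λ) → List (Set (Plaq Λ)))
    (ℓb : ∀ x : VSite Λ, (latticeGraph Λ).Walk x₀ x) (B₁ B₂ : Rect Λ)
    (pr : Hom Λ x₀ G × Hom Λ x₀ G) : Prop :=
  ∃ j₁ j₂ : Fin (KD (bigP Λ x₀ G ℓb B₁ B₂ pr)).length, j₁ ≠ j₂ ∧
    S2 B₁ ⊆ (KD (bigP Λ x₀ G ℓb B₁ B₂ pr)).get j₁ ∧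
    S2 B₂ ⊆ (KD (bigP Λ x₀ G ℓb B₁ B₂ pr)).get j₂

/-- The event `E(B₁,B₂) ⊆ Ω²`. -/
def Eset (KD : Set (Plaq Λ) → List (Set (Plaq Λ)))
    (ℓb : ∀ x : VSite Λ, (latticeGraph Λ).Walk x₀ x) (B₁ B₂ : Rect Λ) :
    Set (Hom Λ x₀ G × Hom Λ x₀ G) :=
  {pr | inDiffKnots Λ x₀ G KD ℓb B₁ B₂ pr}

/-- The swapping map `T : E(B₁,B₂) → E(B₁,B₂)` (extended by the identity off `E(B₁,B₂)`):
identify `ψ₁, ψ₂` with tuples via `Θ(P)`, exchange the coordinates of the knot containing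
`B₂`, and come back via `Θ(P)⁻¹`. -/
def swapT (KD : Set (Plaq Λ) → List (Set (Plaq Λ)))
    (ℓb : ∀ x : VSite Λ, (latticeGraph Λ).Walk x₀ x)
    (Θ : ∀ P : Set (Plaq Λ),
      {ψ : Hom Λ x₀ G // hsupp ψ ℓb ⊆ P} ≃ TupleSpace Λ x₀ G ℓb (KD P))
    (B₁ B₂ : Rect Λ) (pr : Hom Λ x₀ G × Hom Λ x₀ G) : Hom Λ x₀ G × Hom Λ x₀ G :=
  if h : inDiffKnots Λ x₀ G KD ℓb B₁ B₂ pr then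
    let P := bigP Λ x₀ G ℓb B₁ B₂ pr
    let j₂ : Fin (KD P).length := h.choose_spec.choose
    let t₁ := Θ P ⟨pr.1, fun p hp =>
      Set.mem_union_left _ (Set.mem_union_left _ (Set.mem_union_left _ hp))⟩
    let t₂ := Θ P ⟨pr.2, fun p hp =>
      Set.mem_union_left _ (Set.mem_union_left _ (Set.mem_union_right _ hp))⟩
    (((Θ P).symm ⟨Function.update t₁.1 j₂ (t₂.1 j₂), by
        intro i
        rcases eq_or_ne i j₂ with hi | hi
        · subst hi; rw [Function.update_self]; exact t₂.2 j₂
        · rw [Function.update_of_ne hi]; exact t₁.2 i⟩).1,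
     ((Θ P).symm ⟨Function.update t₂.1 j₂ (t₁.1 j₂), by
        intro i
        rcases eq_or_ne i j₂ with hi | hi
        · subst hi; rw [Function.update_self]; exact t₁.2 j₂
        · rw [Function.update_of_ne hi]; exact t₂.2 i⟩).1)
  else pr

end Swap

lemma unit_apply_ne {i j : Fin 4} (h : j ≠ i) : unit i j = 0 := by simp [unit, h]

section Topology

lemma icc_lo {lo hi x : Site} (h : x ∈ Set.Icc lo hi) (i : Fin 4) : lo i ≤ x i := h.1 i

lemma icc_hi {lo hi x : Site} (h : x ∈ Set.Icc lo hi) (i : Fin 4) : x i ≤ hi i := h.2 i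

/-- A site-level gauge field is flat on `S` if it has trivial curvature on all unit squares
with corners in `S`. -/
def FlatOn {G : Type*} [Group G] (a : Site → Fin 4 → G) (S : Set Site) : Prop :=
  ∀ x k l, k ≠ l → x ∈ S → x + unit k ∈ S → x + unit l ∈ S → x + unit k + unit l ∈ S →
    a x k * a (x + unit k) l = a x l * a (x + unit l) k

/-- A site-level gauge field is pure gauge on `S` if it is a coboundary there. -/
def PureGaugeOn {G : Type*} [Group G] (a : Site → Fin 4 → G) (S : Set Site) : Prop :=
  ∃ g : Site → G, ∀ x k, x ∈ S → x + unit k ∈ S → a x k = (g x)⁻¹ * g (x + unit k)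

/-- Every flat field on `S` is pure gauge. -/
def FlatTrivial (G : Type*) [Group G] (S : Set Site) : Prop :=
  ∀ a : Site → Fin 4 → G, FlatOn a S → PureGaugeOn a S

/-- Nearest-neighbour connectedness of a set of sites. -/
def Linked (S : Set Site) : Prop :=
  ∀ T : Set Site, (∀ x k, x ∈ S → x + unit k ∈ S → (x ∈ T ↔ x + unit k ∈ T)) →
    ∀ x ∈ S, ∀ y ∈ S, (x ∈ T ↔ y ∈ T)

lemma Linked.eq_of_step {S : Set Site} (hS : Linked S) {α : Type*} (f : Site → α)
    (h : ∀ x k, x ∈ S → x + unit k ∈ S → f x = f (x + unit k)) {x y : Site}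
    (hx : x ∈ S) (hy : y ∈ S) : f x = f y :=
  ((hS {z | f x = f z} (fun u k hu hk => by
    simp only [Set.mem_ofPred_eq, h u k hu hk]) x hx y hy).1 rfl)

lemma flatTrivial_Icc (G : Type*) [Group G] (lo hi : Site) : FlatTrivial G (Set.Icc lo hi) := by
  obtain ⟨n, hn⟩ : ∃ n : ℕ, ∑ i, (hi i - lo i).toNat = n := ⟨_, rfl⟩
  induction n generalizing hi with
  | zero =>
    intro a _
    refine ⟨1, fun x k hx hk => False.elim ?_⟩
    have h0 : (hi k - lo k).toNat = 0 := by
      have := (Finset.sum_eq_zero_iff.1 hn) k (Finset.mem_univ k); exact this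
    have h1 := icc_lo hx k
    have h2 := icc_hi hk k
    simp only [Pi.add_apply, unit_apply_self] at h2
    omega
  | succ n ih =>
    intro a ha
    obtain ⟨j, hj⟩ : ∃ j, lo j < hi j := by
      by_contra! h
      have : ∑ i, (hi i - lo i).toNat = 0 :=
        Finset.sum_eq_zero fun i _ => by have := h i; omega
      omega
    have hmem : ∀ x, x ∈ Set.Icc lo hi → x j < hi j → x ∈ Set.Icc lo (hi - unit j) := by
      intro x hx hxj
      refine ⟨hx.1, fun i => ?_⟩
      have := icc_hi hx i
      by_cases hij : i = j
      · subst hij; simp only [Pi.sub_apply, unit_apply_self]; omega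
      · simpa [unit_apply_ne hij] using this
    have hsub : Set.Icc lo (hi - unit j) ⊆ Set.Icc lo hi := fun x hx =>
      ⟨hx.1, fun i => by
        have := icc_hi hx i; have h2 := unit_apply_nonneg j i
        simp only [Pi.sub_apply] at this
        change x i ≤ hi i
        omega⟩
    have hpred : ∀ x, x ∈ Set.Icc lo hi → x j = hi j → x - unit j ∈ Set.Icc lo (hi - unit j) := by
      intro x hx hxj
      refine ⟨fun i => ?_, fun i => sub_le_sub_right (hx.2 i) _⟩
      have := icc_lo hx i
      by_cases hij : i = j
      · subst hij; simp only [Pi.sub_apply, unit_apply_self]; omega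
      · simpa [unit_apply_ne hij] using this
    obtain ⟨g, hg⟩ := ih (hi - unit j) (by
      rw [← Finset.add_sum_erase _ _ (Finset.mem_univ j)] at hn ⊢
      have : ∑ i ∈ Finset.univ.erase j, ((hi - unit j) i - lo i).toNat
          = ∑ i ∈ Finset.univ.erase j, (hi i - lo i).toNat :=
        Finset.sum_congr rfl fun i hi' => by simp [unit_apply_ne (Finset.ne_of_mem_erase hi')]
      rw [this]
      simp only [Pi.sub_apply, unit_apply_self]
      omega) a (fun x k l hkl h1 h2 h3 h4 => ha x k l hkl (hsub h1) (hsub h2) (hsub h3) (hsub h4))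
    refine ⟨fun x => if x j = hi j then g (x - unit j) * a (x - unit j) j else g x, ?_⟩
    intro x k hx hk
    by_cases hkj : k = j
    · subst hkj
      have h2 := icc_hi hk k
      simp only [Pi.add_apply, unit_apply_self] at h2
      simp only [Pi.add_apply, unit_apply_self]
      rw [if_neg (by omega)]
      split_ifs with h3
      · rw [add_sub_cancel_right]; group
      · exact hg x k (hmem x hx (by omega)) (hmem _ hk (by
          simp only [Pi.add_apply, unit_apply_self]; omega))
    · have h1 : (x + unit k) j = x j := by simp [unit_apply_ne (Ne.symm hkj)]
      simp only [h1]
      split_ifs with h3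
      · have hy := hpred x hx h3
        have hyk := hpred _ hk (h1.trans h3)
        have e1 : x + unit k - unit j = x - unit j + unit k := by abel
        rw [e1] at hyk ⊢
        have f := ha (x - unit j) j k (Ne.symm hkj) (hsub hy) (by simpa using hx) (hsub hyk)
          (by simpa using hk)
        rw [sub_add_cancel] at f
        have hh := hg _ k hy hyk
        rw [hh] at f
        have : a x k = (a (x - unit j) j)⁻¹ * (a (x - unit j) j * a x k) := by group
        rw [this, f]; group
      · have := icc_hi hx j
        exact hg x k (hmem x hx (by omega)) (hmem _ hk (by omega))

lemma linked_Icc (lo hi : Site) : Linked (Set.Icc lo hi) := by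
  intro T hT
  suffices h : ∀ n : ℕ, ∀ x ∈ Set.Icc lo hi, ∑ i, (x i - lo i).toNat = n → (x ∈ T ↔ lo ∈ T) by
    intro x hx y hy
    rw [h _ x hx rfl, h _ y hy rfl]
  intro n
  induction n with
  | zero =>
    intro x hx h0
    have : x = lo := funext fun i => by
      have h1 := (Finset.sum_eq_zero_iff.1 h0) i (Finset.mem_univ i)
      have h2 := icc_lo hx i
      omega
    rw [this]
  | succ n ih =>
    intro x hx hn
    obtain ⟨j, hj⟩ : ∃ j, lo j < x j := by
      by_contra! h
      have : ∑ i, (x i - lo i).toNat = 0 :=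
        Finset.sum_eq_zero fun i _ => by have := h i; omega
      omega
    have hy : x - unit j ∈ Set.Icc lo hi := by
      refine ⟨fun i => ?_, fun i => ?_⟩
      · have := icc_lo hx i
        by_cases hij : i = j
        · subst hij; simp only [Pi.sub_apply, unit_apply_self]; omega
        · simpa [unit_apply_ne hij] using this
      · have := icc_hi hx i; have h2 := unit_apply_nonneg j i
        simp only [Pi.sub_apply]; omega
    have h1 := hT (x - unit j) j hy (by simpa using hx)
    rw [sub_add_cancel] at h1
    rw [← h1]
    apply ih _ hy
    rw [← Finset.add_sum_erase _ _ (Finset.mem_univ j)] at hn ⊢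
    have : ∑ i ∈ Finset.univ.erase j, ((x - unit j) i - lo i).toNat
        = ∑ i ∈ Finset.univ.erase j, (x i - lo i).toNat :=
      Finset.sum_congr rfl fun i hi' => by simp [unit_apply_ne (Finset.ne_of_mem_erase hi')]
    rw [this]
    simp only [Pi.sub_apply, unit_apply_self]
    omega

/-- Van Kampen's theorem for flat fields. -/
lemma FlatTrivial.union {G : Type*} [Group G] {S₁ S₂ : Set Site} (h₁ : FlatTrivial G S₁)
    (h₂ : FlatTrivial G S₂) (hl : Linked (S₁ ∩ S₂))
    (hadj : ∀ x k, x ∈ S₁ ∪ S₂ → x + unit k ∈ S₁ ∪ S₂ →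
      (x ∈ S₁ ∧ x + unit k ∈ S₁) ∨ (x ∈ S₂ ∧ x + unit k ∈ S₂)) :
    FlatTrivial G (S₁ ∪ S₂) := by
  intro a ha
  obtain ⟨g₁, hg₁⟩ := h₁ a fun x k l hkl a1 a2 a3 a4 =>
    ha x k l hkl (Or.inl a1) (Or.inl a2) (Or.inl a3) (Or.inl a4)
  obtain ⟨g₂, hg₂⟩ := h₂ a fun x k l hkl a1 a2 a3 a4 =>
    ha x k l hkl (Or.inr a1) (Or.inr a2) (Or.inr a3) (Or.inr a4)
  obtain ⟨c, hc⟩ : ∃ c : G, ∀ x ∈ S₁ ∩ S₂, g₂ x * (g₁ x)⁻¹ = c := by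
    by_cases hne : (S₁ ∩ S₂).Nonempty
    · obtain ⟨y, hy⟩ := hne
      refine ⟨g₂ y * (g₁ y)⁻¹, fun x hx => hl.eq_of_step (fun z => g₂ z * (g₁ z)⁻¹) ?_ hx hy⟩
      intro z k hz hzk
      have e1 := hg₁ z k hz.1 hzk.1
      have e2 := hg₂ z k hz.2 hzk.2
      have e3 : g₂ (z + unit k) = g₂ z * a z k := by rw [e2]; group
      have e4 : g₁ (z + unit k) = g₁ z * a z k := by rw [e1]; group
      simp only [e3, e4]; group
    · exact ⟨1, fun x hx => absurd ⟨x, hx⟩ hne⟩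
  have key : ∀ x ∈ S₂, (if x ∈ S₁ then c * g₁ x else g₂ x) = g₂ x := by
    intro x hx
    split_ifs with h
    · rw [← hc x ⟨h, hx⟩]; group
    · rfl
  refine ⟨fun x => if x ∈ S₁ then c * g₁ x else g₂ x, fun x k hx hk => ?_⟩
  rcases hadj x k hx hk with ⟨b1, b2⟩ | ⟨b1, b2⟩
  · simp only [if_pos b1, if_pos b2]; rw [hg₁ x k b1 b2]; group
  · simp only [key _ b1, key _ b2]; exact hg₂ x k b1 b2

/-- The slice of the box `[lo, hi]` on which the coordinate `f.1` equals `f.2`. -/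
def slice (lo hi : Site) (f : Fin 4 × ℤ) : Set Site := {x | x ∈ Set.Icc lo hi ∧ x f.1 = f.2}

lemma slice_eq_Icc {lo hi : Site} {f : Fin 4 × ℤ} (h1 : lo f.1 ≤ f.2) (h2 : f.2 ≤ hi f.1) :
    slice lo hi f = Set.Icc (Function.update lo f.1 f.2) (Function.update hi f.1 f.2) := by
  ext x
  simp only [slice, Set.mem_ofPred_eq, Set.mem_Icc, Pi.le_def, Function.update_apply]
  constructor
  · rintro ⟨⟨h3, h4⟩, h5⟩
    refine ⟨fun i => ?_, fun i => ?_⟩ <;> split_ifs with h <;> first | (subst h; omega) | skip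
    · exact h3 i
    · exact h4 i
  · rintro ⟨h3, h4⟩
    have e : x f.1 = f.2 := le_antisymm (by simpa using h4 f.1) (by simpa using h3 f.1)
    refine ⟨⟨fun i => ?_, fun i => ?_⟩, e⟩
    · by_cases h : i = f.1
      · subst h; omega
      · simpa [h] using h3 i
    · by_cases h : i = f.1
      · subst h; omega
      · simpa [h] using h4 i

lemma slice_inter_linked {lo hi : Site} {f g : Fin 4 × ℤ} (hf1 : lo f.1 ≤ f.2) (hf2 : f.2 ≤ hi f.1)
    (hg1 : lo g.1 ≤ g.2) (hg2 : g.2 ≤ hi g.1) (hfg : f.1 ≠ g.1) :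
    Linked (slice lo hi f ∩ slice lo hi g) := by
  have : slice lo hi f ∩ slice lo hi g
      = slice (Function.update lo f.1 f.2) (Function.update hi f.1 f.2) g := by
    rw [slice_eq_Icc hf1 hf2]
    ext x
    constructor
    · rintro ⟨h1, h2⟩; exact ⟨h1, h2.2⟩
    · rintro ⟨h1, h2⟩
      rw [← slice_eq_Icc hf1 hf2] at h1
      exact ⟨by rw [← slice_eq_Icc hf1 hf2]; exact h1, h1.1, h2⟩
  rw [this, slice_eq_Icc]
  · exact linked_Icc _ _
  · rwa [Function.update_of_ne hfg.symm]
  · rwa [Function.update_of_ne hfg.symm]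

/-- The union of a finite family of slices. -/
def slices (lo hi : Site) (F : Finset (Fin 4 × ℤ)) : Set Site := {x | ∃ f ∈ F, x ∈ slice lo hi f}

lemma flatTrivial_slices_insert {G : Type*} [Group G] {lo hi t : Site}
    (ht : t ∈ Set.Icc lo hi) {F : Finset (Fin 4 × ℤ)} {f : Fin 4 × ℤ}
    (hF : ∀ g ∈ F, lo g.1 ≤ g.2 ∧ g.2 ≤ hi g.1) (hf : lo f.1 ≤ f.2 ∧ f.2 ≤ hi f.1)
    (hfar : ∀ g ∈ F, g.1 = f.1 → 2 ≤ |g.2 - f.2|)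
    (hhub : ∀ g ∈ F, g.1 ≠ f.1 → g.2 = t g.1 ∨ ∃ k, k ≠ f.1 ∧ k ≠ g.1 ∧ (k, t k) ∈ F)
    (h : FlatTrivial G (slices lo hi F)) : FlatTrivial G (slices lo hi (insert f F)) := by
  have e : slices lo hi (insert f F) = slices lo hi F ∪ slice lo hi f := by
    ext x
    simp only [slices, Finset.mem_insert, Set.mem_ofPred_eq, Set.mem_union]
    constructor
    · rintro ⟨g, rfl | hg, hx⟩
      · exact Or.inr hx
      · exact Or.inl ⟨g, hg, hx⟩
    · rintro (⟨g, hg, hx⟩ | hx)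
      · exact ⟨g, Or.inr hg, hx⟩
      · exact ⟨f, Or.inl rfl, hx⟩
  rw [e]
  refine h.union ?_ ?_ ?_
  · rw [slice_eq_Icc hf.1 hf.2]; exact flatTrivial_Icc G _ _
  · intro T hT
    have hstep : ∀ g ∈ F, g.1 ≠ f.1 → ∀ x ∈ slice lo hi f ∩ slice lo hi g,
        ∀ y ∈ slice lo hi f ∩ slice lo hi g, (x ∈ T ↔ y ∈ T) := by
      intro g hg hgf
      exact slice_inter_linked hf.1 hf.2 (hF g hg).1 (hF g hg).2 hgf.symm T
        fun x k hx hk => hT x k ⟨⟨g, hg, hx.2⟩, hx.1⟩ ⟨⟨g, hg, hk.2⟩, hk.1⟩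
    have hy : Function.update t f.1 f.2 ∈ slice lo hi f := by
      refine ⟨⟨fun i => ?_, fun i => ?_⟩, by simp⟩
      · by_cases h : i = f.1
        · subst h; simpa using hf.1
        · simpa [h] using ht.1 i
      · by_cases h : i = f.1
        · subst h; simpa using hf.2
        · simpa [h] using ht.2 i
    suffices hs : ∀ x ∈ slices lo hi F ∩ slice lo hi f,
        (x ∈ T ↔ Function.update t f.1 f.2 ∈ T) by
      intro x hx y hy
      rw [hs x hx, hs y hy]
    rintro x ⟨⟨g, hg, hxg⟩, hxf⟩
    have hgf : g.1 ≠ f.1 := by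
      intro h0
      have h1 := hfar g hg h0
      have h2 := hxg.2
      have h3 := hxf.2
      rw [h0] at h2
      rw [← h2, ← h3] at h1
      simp at h1
    have hz : Function.update (Function.update t f.1 f.2) g.1 g.2 ∈
        slice lo hi f ∩ slice lo hi g := by
      refine ⟨⟨⟨fun i => ?_, fun i => ?_⟩, ?_⟩, ⟨fun i => ?_, fun i => ?_⟩, by simp⟩
      all_goals try
        by_cases h : i = g.1
        · subst h; simpa using (by have := hF g hg; first | exact this.1 | exact this.2)
        · have := hy.1.1 i
          have := hy.1.2 i
          rw [Function.update_of_ne h]; assumption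
      rw [Function.update_of_ne hgf.symm]; simp
    rw [hstep g hg hgf x ⟨hxf, hxg⟩ _ hz]
    rcases hhub g hg hgf with h1 | ⟨k, hk1, hk2, hk3⟩
    · rw [h1, ← Function.update_of_ne hgf f.2 t, Function.update_eq_self]
    · refine hstep _ hk3 hk1 _ ⟨hz.1, hz.1.1, ?_⟩ _ ⟨hy, hy.1, ?_⟩
      · simp [hk1, hk2]
      · simp [hk1]
  · rintro x k (⟨g, hg, hx⟩ | hx) (⟨g', hg', hk⟩ | hk)
    · exact Or.inl ⟨⟨g, hg, hx⟩, ⟨g', hg', hk⟩⟩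
    · by_cases h1 : k = f.1
      · by_cases h2 : k = g.1
        · have := hfar g hg (h2.symm.trans h1)
          have a1 := hx.2
          have a2 := hk.2
          rw [← h1, Pi.add_apply, unit_apply_self] at a2
          rw [← h2] at a1
          rw [← a1, ← a2] at this
          simp at this
        · refine Or.inl ⟨⟨g, hg, hx⟩, g, hg, hk.1, ?_⟩
          rw [Pi.add_apply, unit_apply_ne (Ne.symm h2), add_zero]; exact hx.2
      · refine Or.inr ⟨⟨hx.1, ?_⟩, hk⟩
        have := hk.2
        rwa [Pi.add_apply, unit_apply_ne (Ne.symm h1), add_zero] at this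
    · by_cases h1 : k = f.1
      · by_cases h2 : k = g'.1
        · have := hfar g' hg' (h2.symm.trans h1)
          have a1 := hk.2
          have a2 := hx.2
          rw [← h1] at a2
          rw [← h2, Pi.add_apply, unit_apply_self] at a1
          rw [← a1, ← a2] at this
          simp at this
        · refine Or.inl ⟨⟨g', hg', hx.1, ?_⟩, g', hg', hk⟩
          have := hk.2
          rwa [Pi.add_apply, unit_apply_ne (Ne.symm h2), add_zero] at this
      · refine Or.inr ⟨hx, hk.1, ?_⟩
        rw [Pi.add_apply, unit_apply_ne (Ne.symm h1), add_zero]; exact hx.2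
    · exact Or.inr ⟨hx, hk⟩

end Topology

section Shell

variable {Λ : Box}

/-- The sites of the box `[lo, hi]` lying on a face which is not on the boundary of `Λ`. -/
def shell (Λ : Box) (lo hi : Site) : Set Site :=
  {x | x ∈ Set.Icc lo hi ∧ ∃ i, (x i = lo i ∧ Λ.a i < lo i) ∨ (x i = hi i ∧ hi i < Λ.b i)}

/-- A box inside `Λ` whose shell is nonempty, connected and carries no nontrivial flat field. -/
structure GoodBox (G : Type*) [Group G] (Λ : Box) (lo hi : Site) : Prop where
  a_le : Λ.a ≤ lo
  le_b : hi ≤ Λ.b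
  flat : FlatTrivial G (shell Λ lo hi)
  linked : Linked (shell Λ lo hi)
  nonempty : (shell Λ lo hi).Nonempty

lemma goodBox_of_faces (G : Type*) [Group G] {lo hi : Site} (ha : Λ.a ≤ lo) (hb : hi ≤ Λ.b)
    (hlh : lo ≤ hi) (hface : ∀ i, Λ.a i < lo i ∨ hi i < Λ.b i)
    (hthick : ∀ i, Λ.a i < lo i → hi i < Λ.b i → lo i + 2 ≤ hi i) : GoodBox G Λ lo hi := by
  set t : Site := fun i => if Λ.a i < lo i then lo i else hi i with ht
  have htm : t ∈ Set.Icc lo hi := by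
    refine ⟨fun i => ?_, fun i => ?_⟩ <;> simp only [ht] <;> split_ifs <;>
      first | exact le_rfl | exact hlh i
  set P : Finset (Fin 4) → Finset (Fin 4 × ℤ) := fun D => D.image fun i => (i, t i) with hP
  set Q : Finset (Fin 4) → Finset (Fin 4 × ℤ) := fun D => D.image fun i => (i, hi i) with hQ
  set D₀ : Finset (Fin 4) := Finset.univ.filter fun i => Λ.a i < lo i ∧ hi i < Λ.b i with hD₀
  have hPb : ∀ g ∈ P Finset.univ, lo g.1 ≤ g.2 ∧ g.2 ≤ hi g.1 := by
    intro g hg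
    obtain ⟨i, -, rfl⟩ := Finset.mem_image.1 hg
    exact ⟨icc_lo htm i, icc_hi htm i⟩
  have hQb : ∀ D, ∀ g ∈ Q D, lo g.1 ≤ g.2 ∧ g.2 ≤ hi g.1 := by
    intro D g hg
    obtain ⟨i, -, rfl⟩ := Finset.mem_image.1 hg
    exact ⟨hlh i, le_rfl⟩
  have h1 : ∀ D, FlatTrivial G (slices lo hi (P D)) := by
    intro D
    induction D using Finset.induction_on with
    | empty =>
      intro a _
      refine ⟨1, fun x k hx _ => ?_⟩
      obtain ⟨f, hf, -⟩ := hx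
      simp [hP] at hf
    | insert i D hi' ih =>
      have : P (insert i D) = insert (i, t i) (P D) := by simp [hP, Finset.image_insert]
      rw [this]
      refine flatTrivial_slices_insert htm ?_ ⟨icc_lo htm i, icc_hi htm i⟩ ?_ ?_ ih
      · intro g hg
        obtain ⟨j, -, rfl⟩ := Finset.mem_image.1 hg
        exact ⟨icc_lo htm j, icc_hi htm j⟩
      · intro g hg hgi
        obtain ⟨j, hj, rfl⟩ := Finset.mem_image.1 hg
        simp only at hgi
        subst hgi
        exact absurd hj hi'
      · intro g hg _
        obtain ⟨j, hj, rfl⟩ := Finset.mem_image.1 hg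
        exact Or.inl rfl
  have hother : ∀ i j : Fin 4, ∃ k, k ≠ i ∧ k ≠ j := by decide
  have h2 : ∀ D, D ⊆ D₀ → FlatTrivial G (slices lo hi (Q D ∪ P Finset.univ)) := by
    intro D
    induction D using Finset.induction_on with
    | empty => intro _; simpa [hQ] using h1 Finset.univ
    | insert i D hi' ih =>
      intro hD
      have hiD : Λ.a i < lo i ∧ hi i < Λ.b i :=
        (Finset.mem_filter.1 (hD (Finset.mem_insert_self i D))).2
      have : Q (insert i D) ∪ P Finset.univ = insert (i, hi i) (Q D ∪ P Finset.univ) := by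
        simp [hQ, Finset.image_insert, Finset.insert_union]
      rw [this]
      refine flatTrivial_slices_insert htm ?_ ⟨hlh i, le_rfl⟩ ?_ ?_
        (ih fun x hx => hD (Finset.mem_insert_of_mem hx))
      · intro g hg
        rcases Finset.mem_union.1 hg with hg | hg
        · exact hQb D g hg
        · exact hPb g hg
      · intro g hg hgi
        rcases Finset.mem_union.1 hg with hg | hg
        · obtain ⟨j, hj, rfl⟩ := Finset.mem_image.1 hg
          simp only at hgi
          subst hgi
          exact absurd hj hi'
        · obtain ⟨j, hj, rfl⟩ := Finset.mem_image.1 hg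
          simp only at hgi
          subst hgi
          have := hthick j hiD.1 hiD.2
          simp only [ht, if_pos hiD.1]
          rw [abs_sub_comm, abs_of_nonneg] <;> omega
      · intro g _ _
        right
        obtain ⟨k, hk1, hk2⟩ := hother i g.1
        exact ⟨k, hk1, hk2, Finset.mem_union_right _
          (Finset.mem_image.2 ⟨k, Finset.mem_univ k, rfl⟩)⟩
  have e : shell Λ lo hi = slices lo hi (Q D₀ ∪ P Finset.univ) := by
    ext x
    constructor
    · rintro ⟨hx, i, ⟨h3, h4⟩ | ⟨h3, h4⟩⟩
      · refine ⟨(i, t i), Finset.mem_union_right _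
          (Finset.mem_image.2 ⟨i, Finset.mem_univ i, rfl⟩), hx, ?_⟩
        simp only [ht, if_pos h4, h3]
      · by_cases h5 : Λ.a i < lo i
        · exact ⟨(i, hi i), Finset.mem_union_left _ (Finset.mem_image.2
            ⟨i, Finset.mem_filter.2 ⟨Finset.mem_univ i, h5, h4⟩, rfl⟩), hx, h3⟩
        · refine ⟨(i, t i), Finset.mem_union_right _
            (Finset.mem_image.2 ⟨i, Finset.mem_univ i, rfl⟩), hx, ?_⟩
          simp only [ht, if_neg h5, h3]
    · rintro ⟨f, hf, hx, hxf⟩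
      refine ⟨hx, ?_⟩
      rcases Finset.mem_union.1 hf with hf | hf
      · obtain ⟨i, hi', rfl⟩ := Finset.mem_image.1 hf
        exact ⟨i, Or.inr ⟨hxf, (Finset.mem_filter.1 hi').2.2⟩⟩
      · obtain ⟨i, -, rfl⟩ := Finset.mem_image.1 hf
        by_cases h5 : Λ.a i < lo i
        · simp only [ht, if_pos h5] at hxf
          exact ⟨i, Or.inl ⟨hxf, h5⟩⟩
        · simp only [ht, if_neg h5] at hxf
          exact ⟨i, Or.inr ⟨hxf, (hface i).resolve_left h5⟩⟩
  have htS : ∀ i, t ∈ slice lo hi (i, t i) := fun i => ⟨htm, rfl⟩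
  have hmemP : ∀ k, (k, t k) ∈ Q D₀ ∪ P Finset.univ := fun k =>
    Finset.mem_union_right _ (Finset.mem_image.2 ⟨k, Finset.mem_univ k, rfl⟩)
  refine ⟨ha, hb, e ▸ h2 D₀ subset_rfl, ?_, ⟨t, e ▸ ⟨(0, t 0), hmemP 0, htS 0⟩⟩⟩
  rw [e]
  intro T hT
  have hstep : ∀ g ∈ Q D₀ ∪ P Finset.univ, ∀ x ∈ slice lo hi g, ∀ y ∈ slice lo hi g,
      (x ∈ T ↔ y ∈ T) := by
    intro g hg
    have hg' : lo g.1 ≤ g.2 ∧ g.2 ≤ hi g.1 := by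
      rcases Finset.mem_union.1 hg with hg | hg
      · exact hQb _ g hg
      · exact hPb g hg
    have hl : Linked (slice lo hi g) := by
      rw [slice_eq_Icc hg'.1 hg'.2]; exact linked_Icc _ _
    exact hl T fun x k hx hk => hT x k ⟨g, hg, hx⟩ ⟨g, hg, hk⟩
  suffices hs : ∀ x ∈ slices lo hi (Q D₀ ∪ P Finset.univ), (x ∈ T ↔ t ∈ T) by
    intro x hx y hy
    rw [hs x hx, hs y hy]
  rintro x ⟨g, hg, hx⟩
  obtain ⟨k, hk, -⟩ := hother g.1 g.1
  have hz : Function.update t g.1 g.2 ∈ slice lo hi g := by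
    refine ⟨⟨fun i => ?_, fun i => ?_⟩, by simp⟩
    · by_cases h : i = g.1
      · subst h; simpa [hx.2] using icc_lo hx.1 g.1
      · simpa [h] using icc_lo htm i
    · by_cases h : i = g.1
      · subst h; simpa [hx.2] using icc_hi hx.1 g.1
      · simpa [h] using icc_hi htm i
  rw [hstep g hg x hx _ hz]
  exact hstep _ (hmemP k) _ ⟨hz.1, by simp [hk]⟩ _ (htS k)

lemma goodBox_halfspace (G : Type*) [Group G] (i : Fin 4) {s : ℤ} (hab : Λ.a ≤ Λ.b)
    (h1 : Λ.a i ≤ s) (h2 : s < Λ.b i) : GoodBox G Λ Λ.a (Function.update Λ.b i s) := by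
  have e : shell Λ Λ.a (Function.update Λ.b i s)
      = slice Λ.a (Function.update Λ.b i s) (i, s) := by
    ext x
    constructor
    · rintro ⟨hx, j, ⟨h3, h4⟩ | ⟨h3, h4⟩⟩
      · exact absurd h4 (lt_irrefl _)
      · by_cases hj : j = i
        · subst hj
          exact ⟨hx, by simpa using h3⟩
        · rw [Function.update_of_ne hj] at h4
          exact absurd h4 (lt_irrefl _)
    · rintro ⟨hx, h3⟩
      exact ⟨hx, i, Or.inr ⟨by simpa using h3, by simpa using h2⟩⟩
  have e2 := e
  rw [slice_eq_Icc (f := (i, s)) h1 (by simp)] at e2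
  refine ⟨le_rfl, fun j => ?_, ?_, ?_, ?_⟩
  · by_cases hj : j = i
    · subst hj; simpa using h2.le
    · simp [hj]
  · rw [e2]; exact flatTrivial_Icc G _ _
  · rw [e2]; exact linked_Icc _ _
  · rw [e2]
    refine ⟨Function.update Λ.a i s, le_rfl, fun j => ?_⟩
    by_cases hj : j = i
    · subst hj; simp
    · simpa [hj] using hab j

end Shell

section Gauge

variable {Λ : Box} {x₀ : VSite Λ} {G : Type*} [Group G]

lemma unit_injective : Function.Injective unit := by
  intro i j h
  by_contra hij
  have := congrFun h i
  rw [unit_apply_self, unit_apply_ne hij] at this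
  exact one_ne_zero this

/-- The site-level field of an edge configuration, extended by `1` off `Λ`. -/
def siteField (σ : EdgeConf Λ G) (x : Site) (k : Fin 4) : G :=
  if h : Λ.mem x ∧ Λ.mem (x + unit k) then σ ⟨(x, k), h⟩ else 1

lemma siteField_edge (σ : EdgeConf Λ G) (e : PEdge Λ) : siteField σ e.1.1 e.1.2 = σ e := by
  simp only [siteField]
  rw [dif_pos e.2]

lemma oval_pos (σ : EdgeConf Λ G) {u v : VSite Λ} {i : Fin 4}
    (h : (v : Site) = (u : Site) + unit i) : oval σ u v = siteField σ u i := by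
  have h1 : ∃ k : Fin 4, (v : Site) = (u : Site) + unit k := ⟨i, h⟩
  have h2 : h1.choose = i := unit_injective (add_left_cancel (h1.choose_spec.symm.trans h))
  simp only [oval, siteField]
  rw [dif_pos h1, dif_pos ⟨u.2, h ▸ v.2⟩]
  congr 1
  exact Subtype.ext (by simp only [h2])

lemma oval_neg (σ : EdgeConf Λ G) {u v : VSite Λ} {i : Fin 4}
    (h : (u : Site) = (v : Site) + unit i) : oval σ u v = (siteField σ v i)⁻¹ := by
  rw [← oval_pos σ h]
  exact eq_inv_of_mul_eq_one_left (oval_mul_oval σ ⟨i, Or.inr h⟩)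

lemma oval_swap (σ : EdgeConf Λ G) {u v : VSite Λ} (h : (latticeGraph Λ).Adj u v) :
    oval σ v u = (oval σ u v)⁻¹ := by
  rw [eq_inv_iff_mul_eq_one]
  exact oval_mul_oval σ h.symm

lemma oval_edge (σ : EdgeConf Λ G) (e : PEdge Λ) : oval σ e.v0 e.v1 = σ e := by
  rw [oval_pos σ (i := e.1.2) rfl]
  exact siteField_edge σ e

lemma PEdge.adj (e : PEdge Λ) : (latticeGraph Λ).Adj e.v0 e.v1 := ⟨e.1.2, Or.inl rfl⟩

/-- Adjacent vertices are the endpoints of a positive edge, in one of the two orders. -/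
lemma adj_edge {u v : VSite Λ} (h : (latticeGraph Λ).Adj u v) :
    ∃ e : PEdge Λ, (u = e.v0 ∧ v = e.v1) ∨ (v = e.v0 ∧ u = e.v1) := by
  obtain ⟨i, h | h⟩ := h
  · exact ⟨⟨(u, i), u.2, h ▸ v.2⟩, Or.inl ⟨rfl, Subtype.ext h⟩⟩
  · exact ⟨⟨(v, i), v.2, h ▸ u.2⟩, Or.inr ⟨rfl, Subtype.ext h⟩⟩

lemma hol_congr {σ τ : EdgeConf Λ G} {u v : VSite Λ} (w : (latticeGraph Λ).Walk u v)
    (h : ∀ d ∈ w.darts, oval σ d.fst d.snd = oval τ d.fst d.snd) : hol σ w = hol τ w := by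
  unfold hol
  congr 1
  exact List.map_congr_left h

lemma hol_reverse (σ : EdgeConf Λ G) {u v : VSite Λ} (w : (latticeGraph Λ).Walk u v) :
    hol σ w.reverse = (hol σ w)⁻¹ := by
  induction w with
  | nil => simp
  | cons h p ih =>
    rw [SimpleGraph.Walk.reverse_cons, hol_append, ih, hol_cons, hol_cons, hol_nil, mul_one,
      mul_inv_rev, oval_swap σ h]

/-- The gauge transform of an edge configuration. -/
def gaugeT (g : VSite Λ → G) (σ : EdgeConf Λ G) : EdgeConf Λ G :=
  fun e => g e.v0 * σ e * (g e.v1)⁻¹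

lemma oval_gaugeT (g : VSite Λ → G) (σ : EdgeConf Λ G) {u v : VSite Λ}
    (h : (latticeGraph Λ).Adj u v) :
    oval (gaugeT g σ) u v = g u * oval σ u v * (g v)⁻¹ := by
  obtain ⟨e, ⟨rfl, rfl⟩ | ⟨rfl, rfl⟩⟩ := adj_edge h
  · rw [oval_edge, oval_edge]; rfl
  · rw [oval_swap _ h.symm, oval_swap _ h.symm, oval_edge, oval_edge]
    simp only [gaugeT]; group

lemma hol_gaugeT (g : VSite Λ → G) (σ : EdgeConf Λ G) {u v : VSite Λ}
    (w : (latticeGraph Λ).Walk u v) :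
    hol (gaugeT g σ) w = g u * hol σ w * (g v)⁻¹ := by
  induction w with
  | nil => simp
  | cons h p ih => rw [hol_cons, hol_cons, ih, oval_gaugeT g σ h]; group

lemma holP_eq (σ : EdgeConf Λ G) (p : Plaq Λ) :
    holP σ p = oval σ p.c0 p.c1 * oval σ p.c1 p.c2 * oval σ p.c2 p.c3 * oval σ p.c3 p.c0 := by
  simp only [holP, plaqWalk, hol_cons, hol_nil, mul_one, mul_assoc]

lemma holP_eq_site (σ : EdgeConf Λ G) (p : Plaq Λ) :
    holP σ p = siteField σ p.1.1 p.1.2.1 * siteField σ (p.1.1 + unit p.1.2.1) p.1.2.2 *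
      (siteField σ (p.1.1 + unit p.1.2.2) p.1.2.1)⁻¹ * (siteField σ p.1.1 p.1.2.2)⁻¹ := by
  rw [holP_eq, oval_pos σ (i := p.1.2.1) rfl, oval_pos σ (i := p.1.2.2) rfl,
    oval_neg σ (i := p.1.2.1), oval_neg σ (i := p.1.2.2)]
  · rfl
  · rfl
  · exact add_right_comm p.1.1 (unit p.1.2.1) (unit p.1.2.2)

lemma Hom.ext' {ψ φ : Hom Λ x₀ G} (h : ∀ w, ψ.toFun w = φ.toFun w) : ψ = φ := by
  cases ψ; cases φ
  congr
  exact funext h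

lemma evalLoop_psi (σ : EdgeConf Λ G) (ℓb : ∀ x : VSite Λ, (latticeGraph Λ).Walk x₀ x)
    {u : VSite Λ} (γ : (latticeGraph Λ).Walk u u) :
    evalLoop (psi Λ x₀ σ) ℓb γ = hol σ (ℓb u) * hol σ γ * (hol σ (ℓb u))⁻¹ := by
  simp only [evalLoop, xiLoop, psi, hol_append, hol_reverse, mul_assoc]

lemma isConj_evalLoop_psi (σ : EdgeConf Λ G) (ℓb : ∀ x : VSite Λ, (latticeGraph Λ).Walk x₀ x)
    {u : VSite Λ} (γ : (latticeGraph Λ).Walk u u) :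
    IsConj (evalLoop (psi Λ x₀ σ) ℓb γ) (hol σ γ) := by
  rw [evalLoop_psi]
  exact IsConj.symm (isConj_iff.2 ⟨_, rfl⟩)

lemma isConj_evalP_psi (σ : EdgeConf Λ G) (ℓb : ∀ x : VSite Λ, (latticeGraph Λ).Walk x₀ x)
    (p : Plaq Λ) : IsConj (evalP (psi Λ x₀ σ) ℓb p) (holP σ p) :=
  isConj_evalLoop_psi σ ℓb _

lemma isConj_eq_one_iff {a b : G} (h : IsConj a b) : a = 1 ↔ b = 1 := by
  constructor
  · rintro rfl; exact isConj_one_right.1 h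
  · rintro rfl; exact isConj_one_left.1 h

lemma mem_hsupp_psi (σ : EdgeConf Λ G) (ℓb : ∀ x : VSite Λ, (latticeGraph Λ).Walk x₀ x)
    (p : Plaq Λ) : p ∈ hsupp (psi Λ x₀ σ) ℓb ↔ holP σ p ≠ 1 :=
  not_congr (isConj_eq_one_iff (isConj_evalP_psi σ ℓb p))

lemma psi_gaugeT {g : VSite Λ → G} (hg : g x₀ = 1) (σ : EdgeConf Λ G) :
    psi Λ x₀ (gaugeT g σ) = psi Λ x₀ σ :=
  Hom.ext' fun w => by simp [psi, hol_gaugeT, hg]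

/-- The fixed paths, modified to be trivial at the base point. -/
def basedPath (ℓb : ∀ x : VSite Λ, (latticeGraph Λ).Walk x₀ x) (x : VSite Λ) :
    (latticeGraph Λ).Walk x₀ x :=
  if h : x₀ = x then (SimpleGraph.Walk.nil : (latticeGraph Λ).Walk x₀ x₀).copy rfl h else ℓb x

lemma basedPath_self (ℓb : ∀ x : VSite Λ, (latticeGraph Λ).Walk x₀ x) :
    basedPath ℓb x₀ = SimpleGraph.Walk.nil := by
  simp [basedPath]

lemma exists_gaugeT_of_psi_eq (ℓb : ∀ x : VSite Λ, (latticeGraph Λ).Walk x₀ x)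
    {σ τ : EdgeConf Λ G} (h : psi Λ x₀ σ = psi Λ x₀ τ) :
    ∃ g : VSite Λ → G, g x₀ = 1 ∧ τ = gaugeT g σ := by
  refine ⟨fun x => (hol τ (basedPath ℓb x))⁻¹ * hol σ (basedPath ℓb x), by
    simp [basedPath_self], funext fun e => ?_⟩
  have h1 : hol σ ((basedPath ℓb e.v0).append
        (SimpleGraph.Walk.cons e.adj (basedPath ℓb e.v1).reverse))
      = hol τ ((basedPath ℓb e.v0).append
        (SimpleGraph.Walk.cons e.adj (basedPath ℓb e.v1).reverse)) :=
    congrFun (congrArg Hom.toFun h) _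
  simp only [hol_append, hol_cons, hol_reverse, oval_edge] at h1
  simp only [gaugeT]
  have h2 : τ e = (hol τ (basedPath ℓb e.v0))⁻¹ * (hol τ (basedPath ℓb e.v0) *
      (τ e * (hol τ (basedPath ℓb e.v1))⁻¹)) * hol τ (basedPath ℓb e.v1) := by group
  rw [h2, ← h1]
  group

lemma homotopic_cancel {a b u v : VSite Λ} (r : (latticeGraph Λ).Walk a b)
    (p : (latticeGraph Λ).Walk u b) (q : (latticeGraph Λ).Walk b v) :
    Homotopic (p.append (r.reverse.append (r.append q))) (p.append q) := by
  induction r with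
  | nil => exact Relation.EqvGen.refl _
  | cons h r ih =>
    refine Relation.EqvGen.trans _ _ _ (Relation.EqvGen.rel _ _ ?_) (ih p q)
    have := HStep.mk (p.append r.reverse) h.symm (r.append q)
    simpa [SimpleGraph.Walk.reverse_cons, ← SimpleGraph.Walk.append_assoc] using this

lemma Hom.cancel (ψ : Hom Λ x₀ G) {a b : VSite Λ} (r : (latticeGraph Λ).Walk a b)
    (p : (latticeGraph Λ).Walk x₀ b) (q : (latticeGraph Λ).Walk b x₀) :
    ψ.toFun (p.append (r.reverse.append (r.append q))) = ψ.toFun (p.append q) :=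
  ψ.invariant _ _ (homotopic_cancel r p q)

lemma Hom.map_nil (ψ : Hom Λ x₀ G) : ψ.toFun SimpleGraph.Walk.nil = 1 := by
  have := ψ.map_mul SimpleGraph.Walk.nil SimpleGraph.Walk.nil
  simpa using this

lemma Hom.map_reverse (ψ : Hom Λ x₀ G) (w : (latticeGraph Λ).Walk x₀ x₀) :
    ψ.toFun w.reverse = (ψ.toFun w)⁻¹ := by
  rw [eq_inv_iff_mul_eq_one, ← ψ.map_mul]
  have := ψ.cancel w SimpleGraph.Walk.nil SimpleGraph.Walk.nil
  simpa [ψ.map_nil] using this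

/-- An edge configuration inducing a given homomorphism. -/
def liftConf (ℓb : ∀ x : VSite Λ, (latticeGraph Λ).Walk x₀ x) (ψ : Hom Λ x₀ G) :
    EdgeConf Λ G := fun e =>
  ψ.toFun ((basedPath ℓb e.v0).append (SimpleGraph.Walk.cons e.adj (basedPath ℓb e.v1).reverse))

lemma oval_liftConf (ℓb : ∀ x : VSite Λ, (latticeGraph Λ).Walk x₀ x) (ψ : Hom Λ x₀ G)
    {u v : VSite Λ} (h : (latticeGraph Λ).Adj u v) :
    oval (liftConf ℓb ψ) u v =
      ψ.toFun ((basedPath ℓb u).append (SimpleGraph.Walk.cons h (basedPath ℓb v).reverse)) := by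
  obtain ⟨e, ⟨rfl, rfl⟩ | ⟨rfl, rfl⟩⟩ := adj_edge h
  · rw [oval_edge]; rfl
  · rw [oval_swap _ h.symm, oval_edge, liftConf, ← ψ.map_reverse]
    simp [SimpleGraph.Walk.reverse_append, ← SimpleGraph.Walk.append_assoc]

lemma hol_liftConf (ℓb : ∀ x : VSite Λ, (latticeGraph Λ).Walk x₀ x) (ψ : Hom Λ x₀ G)
    {u v : VSite Λ} (w : (latticeGraph Λ).Walk u v) :
    hol (liftConf ℓb ψ) w =
      ψ.toFun ((basedPath ℓb u).append (w.append (basedPath ℓb v).reverse)) := by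
  induction w with
  | @nil u =>
    have := ψ.cancel (basedPath ℓb u).reverse SimpleGraph.Walk.nil SimpleGraph.Walk.nil
    simpa [ψ.map_nil] using this.symm
  | @cons u m v h q ih =>
    rw [hol_cons, ih, oval_liftConf ℓb ψ h, ← ψ.map_mul]
    have := ψ.cancel (basedPath ℓb m)
      ((basedPath ℓb u).append (SimpleGraph.Walk.cons h SimpleGraph.Walk.nil))
      (q.append (basedPath ℓb v).reverse)
    simpa [← SimpleGraph.Walk.append_assoc] using this

lemma psi_liftConf (ℓb : ∀ x : VSite Λ, (latticeGraph Λ).Walk x₀ x) (ψ : Hom Λ x₀ G) :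
    psi Λ x₀ (liftConf ℓb ψ) = ψ :=
  Hom.ext' fun w => by
    change hol (liftConf ℓb ψ) w = _
    rw [hol_liftConf, basedPath_self]
    simp

lemma psi_surjective (ℓb : ∀ x : VSite Λ, (latticeGraph Λ).Walk x₀ x) (ψ : Hom Λ x₀ G) :
    ∃ σ : EdgeConf Λ G, psi Λ x₀ σ = ψ := ⟨_, psi_liftConf ℓb ψ⟩

lemma mem_iff_mem_Icc {x : Site} : Λ.mem x ↔ x ∈ Set.Icc Λ.a Λ.b :=
  ⟨fun h => ⟨fun i => (h i).1, fun i => (h i).2⟩, fun h i => ⟨h.1 i, h.2 i⟩⟩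

instance : Finite (VSite Λ) :=
  ((Set.finite_Icc Λ.a Λ.b).subset fun _ hx => mem_iff_mem_Icc.1 hx).to_subtype

instance : Finite (PEdge Λ) :=
  Finite.of_injective (fun e : PEdge Λ => ((⟨e.1.1, e.2.1⟩, e.1.2) : VSite Λ × Fin 4))
    fun e f h => by
      simp only [Prod.mk.injEq, Subtype.mk.injEq] at h
      exact Subtype.ext (Prod.ext h.1 h.2)

instance : Finite (Plaq Λ) :=
  Finite.of_injective (fun p : Plaq Λ => ((⟨p.1.1, p.2.2.1⟩, p.1.2) : VSite Λ × Fin 4 × Fin 4))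
    fun e f h => by
      simp only [Prod.mk.injEq, Subtype.mk.injEq] at h
      exact Subtype.ext (Prod.ext h.1 h.2)

lemma finite_hom [Finite G] (ℓb : ∀ x : VSite Λ, (latticeGraph Λ).Walk x₀ x) :
    Finite (Hom Λ x₀ G) :=
  Finite.of_surjective (psi Λ x₀) (psi_surjective ℓb)

end Gauge

section Comb

variable {Λ : Box} {x₀ : VSite Λ} {G : Type*} [Group G]

/-- The `ℓ¹` height of a site above the lower corner of `Λ`. -/
def height (Λ : Box) (x : Site) : ℕ := ∑ i, (x i - Λ.a i).toNat

lemma height_sub_unit {x : Site} {j : Fin 4} (h : Λ.a j < x j) :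
    height Λ (x - unit j) + 1 = height Λ x := by
  unfold height
  rw [← Finset.add_sum_erase _ _ (Finset.mem_univ j),
    ← Finset.add_sum_erase _ _ (Finset.mem_univ j)]
  have : ∑ i ∈ Finset.univ.erase j, ((x - unit j) i - Λ.a i).toNat
      = ∑ i ∈ Finset.univ.erase j, (x i - Λ.a i).toNat :=
    Finset.sum_congr rfl fun i hi' => by simp [unit_apply_ne (Finset.ne_of_mem_erase hi')]
  rw [this]
  simp only [Pi.sub_apply, unit_apply_self]
  omega

/-- The axial gauge: the product of a field along the comb path from the lower corner. -/
def combGauge (Λ : Box) (s : Site → Fin 4 → G) (x : Site) : G :=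
  if h : ∃ j, Λ.a j < x j ∧ ∀ k, j < k → x k = Λ.a k then
    combGauge Λ s (x - unit h.choose) * s (x - unit h.choose) h.choose
  else 1
termination_by height Λ x
decreasing_by
  have := height_sub_unit (Λ := Λ) h.choose_spec.1
  omega

lemma combGauge_step (s : Site → Fin 4 → G) {x : Site} {i : Fin 4} (hx : Λ.mem x)
    (hc : ∀ k, i < k → x k = Λ.a k) :
    combGauge Λ s (x + unit i) = combGauge Λ s x * s x i := by
  have h : ∃ j, Λ.a j < (x + unit i) j ∧ ∀ k, j < k → (x + unit i) k = Λ.a k := by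
    refine ⟨i, ?_, fun k hk => ?_⟩
    · have := (hx i).1
      simp only [Pi.add_apply, unit_apply_self]; omega
    · simp [unit_apply_ne hk.ne', hc k hk]
  have hj : h.choose = i := by
    obtain ⟨h1, h2⟩ := h.choose_spec
    rcases lt_trichotomy h.choose i with h3 | h3 | h3
    · have h4 := h2 i h3
      have := (hx i).1
      simp only [Pi.add_apply, unit_apply_self] at h4; omega
    · exact h3
    · have := hc _ h3
      simp only [Pi.add_apply, unit_apply_ne h3.ne'] at h1; omega
  rw [combGauge, dif_pos h, hj, add_sub_cancel_right]

/-- Axial gauge condition. -/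
def CombTrivial (σ : EdgeConf Λ G) : Prop :=
  ∀ e : PEdge Λ, (∀ k, e.1.2 < k → e.1.1 k = Λ.a k) → σ e = 1

lemma exists_combTrivial (σ : EdgeConf Λ G) :
    ∃ τ : EdgeConf Λ G, psi Λ x₀ τ = psi Λ x₀ σ ∧ CombTrivial τ := by
  set g : VSite Λ → G := fun x => (combGauge Λ (siteField σ) x₀)⁻¹ * combGauge Λ (siteField σ) x
  refine ⟨gaugeT g σ, psi_gaugeT (by simp [g]) σ, fun e he => ?_⟩
  have := combGauge_step (siteField σ) e.2.1 he
  simp only [gaugeT, g, PEdge.v0, PEdge.v1, this, siteField_edge]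
  group

lemma combTrivial_ext {σ τ : EdgeConf Λ G} (hσ : CombTrivial σ) (hτ : CombTrivial τ)
    (h : ∀ p, holP σ p = holP τ p) : σ = τ := by
  suffices H : ∀ n : ℕ, ∀ e : PEdge Λ, height Λ e.1.1 = n → σ e = τ e from
    funext fun e => H _ e rfl
  intro n
  induction n with
  | zero =>
    intro e he
    have h0 : ∀ k, e.1.1 k = Λ.a k := fun k => by
      have h1 := (Finset.sum_eq_zero_iff.1 he) k (Finset.mem_univ k)
      have := (e.2.1 k).1
      omega
    rw [hσ e fun k _ => h0 k, hτ e fun k _ => h0 k]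
  | succ n ih =>
    intro e he
    by_cases hc : ∀ k, e.1.2 < k → e.1.1 k = Λ.a k
    · rw [hσ e hc, hτ e hc]
    obtain ⟨⟨x, i⟩, hx, hxi⟩ := e
    simp only at he hc hx hxi
    set J : Finset (Fin 4) := Finset.univ.filter fun k => i < k ∧ x k ≠ Λ.a k with hJ
    have hJn : J.Nonempty := by
      push Not at hc
      obtain ⟨k, hk⟩ := hc
      exact ⟨k, by simp [hJ, hk]⟩
    obtain ⟨j, hjJ, hjmax⟩ := J.exists_max_image id hJn
    simp only [hJ, Finset.mem_filter, Finset.mem_univ, true_and, id] at hjJ hjmax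
    obtain ⟨hij, hxj⟩ := hjJ
    have htop : ∀ k, j < k → x k = Λ.a k := fun k hk => by
      by_contra h'
      exact absurd (hjmax k ⟨hij.trans hk, h'⟩) (not_le.2 hk)
    have hlt : Λ.a j < x j := lt_of_le_of_ne (hx j).1 (Ne.symm hxj)
    have m1 : ∀ y : Site, Λ.mem y → Λ.a j < y j → Λ.mem (y - unit j) := by
      intro y hy hyj k
      have := hy k
      by_cases hk : k = j
      · subst hk; simp only [Pi.sub_apply, unit_apply_self]; omega
      · simpa [unit_apply_ne hk] using this
    have m0 : Λ.mem (x - unit j) := m1 x hx hlt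
    have e1 : x - unit j + unit i = x + unit i - unit j := by abel
    have e2 : x - unit j + unit i + unit j = x + unit i := by abel
    have m2 : Λ.mem (x - unit j + unit i) := by
      rw [e1]; exact m1 _ hxi (by simpa [unit_apply_ne hij.ne'] using hlt)
    have hp := h ⟨(x - unit j, i, j), hij, m0, m2, by simpa only [e2] using hxi, by
      simpa using hx⟩
    rw [holP_eq_site, holP_eq_site] at hp
    simp only [sub_add_cancel] at hp
    have c1 : ∀ ρ : EdgeConf Λ G, CombTrivial ρ → siteField ρ (x - unit j + unit i) j = 1 := by
      intro ρ hρ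
      have hm : Λ.mem (x - unit j + unit i) ∧ Λ.mem (x - unit j + unit i + unit j) :=
        ⟨m2, by rw [e2]; exact hxi⟩
      rw [siteField, dif_pos hm]
      exact hρ _ fun k hk => by
        have hk' : j < k := hk
        simp [unit_apply_ne hk'.ne', unit_apply_ne (hij.trans hk').ne', htop k hk']
    have c2 : ∀ ρ : EdgeConf Λ G, CombTrivial ρ → siteField ρ (x - unit j) j = 1 := by
      intro ρ hρ
      have hm : Λ.mem (x - unit j) ∧ Λ.mem (x - unit j + unit j) := ⟨m0, by simpa using hx⟩
      rw [siteField, dif_pos hm]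
      exact hρ _ fun k hk => by
        have hk' : j < k := hk
        simp [unit_apply_ne hk'.ne', htop k hk']
    have c3 : siteField σ (x - unit j) i = siteField τ (x - unit j) i := by
      have hm : Λ.mem (x - unit j) ∧ Λ.mem (x - unit j + unit i) := ⟨m0, m2⟩
      rw [siteField, siteField, dif_pos hm, dif_pos hm]
      refine ih _ ?_
      have := height_sub_unit (Λ := Λ) hlt
      simp only
      omega
    rw [c1 σ hσ, c1 τ hτ, c2 σ hσ, c2 τ hτ, c3] at hp
    have := siteField_edge σ ⟨(x, i), hx, hxi⟩
    rw [← this, ← siteField_edge τ ⟨(x, i), hx, hxi⟩]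
    simpa using hp

lemma exists_injective_hsupp (ℓb : ∀ x : VSite Λ, (latticeGraph Λ).Walk x₀ x) (K : Set (Plaq Λ)) :
    ∃ f : {ψ : Hom Λ x₀ G // hsupp ψ ℓb ⊆ K} → (K → G), Function.Injective f := by
  have : ∀ ψ : Hom Λ x₀ G, ∃ σ : EdgeConf Λ G, psi Λ x₀ σ = ψ ∧ CombTrivial σ := by
    intro ψ
    obtain ⟨σ, rfl⟩ := psi_surjective ℓb ψ
    exact exists_combTrivial σ
  choose r hr1 hr2 using this
  refine ⟨fun ψ p => holP (r ψ) p, fun ψ φ h => Subtype.ext ?_⟩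
  rw [← hr1 ψ, ← hr1 φ]
  congr 1
  refine combTrivial_ext (hr2 _) (hr2 _) fun p => ?_
  by_cases hp : p ∈ K
  · exact congrFun h ⟨p, hp⟩
  · have hz : ∀ χ : {ψ : Hom Λ x₀ G // hsupp ψ ℓb ⊆ K}, holP (r χ) p = 1 := by
      intro χ
      by_contra hne
      rw [← Ne, ← mem_hsupp_psi (x₀ := x₀) _ ℓb, hr1] at hne
      exact hp (χ.2 hne)
    rw [hz, hz]

lemma card_hsupp_le [Finite G] (ℓb : ∀ x : VSite Λ, (latticeGraph Λ).Walk x₀ x)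
    (K : Set (Plaq Λ)) :
    Nat.card {ψ : Hom Λ x₀ G // hsupp ψ ℓb ⊆ K} ≤ Nat.card G ^ Nat.card K := by
  obtain ⟨f, hf⟩ := exists_injective_hsupp (G := G) ℓb K
  exact (Nat.card_le_card_of_injective f hf).trans_eq Nat.card_fun

lemma eq_of_hsupp_empty (ℓb : ∀ x : VSite Λ, (latticeGraph Λ).Walk x₀ x) {ψ φ : Hom Λ x₀ G}
    (hψ : hsupp ψ ℓb ⊆ ∅) (hφ : hsupp φ ℓb ⊆ ∅) : ψ = φ := by
  obtain ⟨f, hf⟩ := exists_injective_hsupp (G := G) ℓb ∅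
  have := @hf ⟨ψ, hψ⟩ ⟨φ, hφ⟩ (funext fun p => p.2.elim)
  exact congrArg Subtype.val this

end Comb

section Mix

variable {Λ : Box} {x₀ : VSite Λ} {G : Type*} [Group G] {lo hi : Site}

lemma mem_shell_of_adj {u v : VSite Λ} (h : (latticeGraph Λ).Adj u v)
    (hu : (u : Site) ∈ Set.Icc lo hi) (hv : (v : Site) ∉ Set.Icc lo hi) :
    (u : Site) ∈ shell Λ lo hi := by
  obtain ⟨i, h | h⟩ := h
  · have h1 : hi i < (v : Site) i := by
      by_contra h1
      refine hv ⟨fun j => ?_, fun j => ?_⟩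
      · have := icc_lo hu j
        have h2 := unit_apply_nonneg i j
        rw [h]; simp only [Pi.add_apply]; omega
      · by_cases hj : j = i
        · subst hj; change (v : Site) j ≤ hi j; omega
        · have := icc_hi hu j
          rw [h]; simpa [unit_apply_ne hj] using this
    have h2 := icc_hi hu i
    have h3 := (v.2 i).2
    have h4 : (v : Site) i = (u : Site) i + 1 := by rw [h]; simp [unit_apply_self]
    exact ⟨hu, i, Or.inr ⟨by omega, by omega⟩⟩
  · have h1 : (v : Site) i < lo i := by
      by_contra h1
      refine hv ⟨fun j => ?_, fun j => ?_⟩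
      · by_cases hj : j = i
        · subst hj; change lo j ≤ (v : Site) j; omega
        · have := icc_lo hu j
          rw [h] at this; simpa [unit_apply_ne hj] using this
      · have := icc_hi hu j
        have h2 := unit_apply_nonneg i j
        rw [h] at this; simp only [Pi.add_apply] at this
        change (v : Site) j ≤ hi j; omega
    have h2 := icc_lo hu i
    have h3 := (v.2 i).1
    have h4 : (u : Site) i = (v : Site) i + 1 := by rw [h]; simp [unit_apply_self]
    exact ⟨hu, i, Or.inl ⟨by omega, by omega⟩⟩

lemma add_unit_mem_iff {x y : Site} {i : Fin 4} (_hx : x ∈ Set.Icc lo hi) (hy : y ∈ Set.Icc lo hi)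
    (hxy : x i = y i) (h : x + unit i ∈ Set.Icc lo hi) : y + unit i ∈ Set.Icc lo hi := by
  refine ⟨fun j => ?_, fun j => ?_⟩
  · have := icc_lo hy j
    have h2 := unit_apply_nonneg i j
    simp only [Pi.add_apply]; omega
  · by_cases hj : j = i
    · subst hj
      have := icc_hi h j
      simp only [Pi.add_apply, unit_apply_self] at this ⊢; omega
    · simpa [unit_apply_ne hj] using icc_hi hy j

lemma sub_unit_mem_iff {x y : Site} {i : Fin 4} (hx : x + unit i ∈ Set.Icc lo hi)
    (hy : y + unit i ∈ Set.Icc lo hi) (hxy : x i = y i) (h : x ∈ Set.Icc lo hi) :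
    y ∈ Set.Icc lo hi := by
  refine ⟨fun j => ?_, fun j => ?_⟩
  · by_cases hj : j = i
    · subst hj
      have := icc_lo h j
      change lo j ≤ y j; omega
    · simpa [unit_apply_ne hj] using icc_lo hy j
  · have := icc_hi hy j
    have h2 := unit_apply_nonneg i j
    simp only [Pi.add_apply] at this
    change y j ≤ hi j; omega

/-- A plaquette all of whose corners lie in a box. -/
def PlaqInBox (lo hi : Site) (p : Plaq Λ) : Prop :=
  (p.c0 : Site) ∈ Set.Icc lo hi ∧ (p.c1 : Site) ∈ Set.Icc lo hi ∧
    (p.c2 : Site) ∈ Set.Icc lo hi ∧ (p.c3 : Site) ∈ Set.Icc lo hi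

/-- A plaquette all of whose corners lie in the shell of a box. -/
def PlaqInShell (lo hi : Site) (p : Plaq Λ) : Prop :=
  (p.c0 : Site) ∈ shell Λ lo hi ∧ (p.c1 : Site) ∈ shell Λ lo hi ∧
    (p.c2 : Site) ∈ shell Λ lo hi ∧ (p.c3 : Site) ∈ shell Λ lo hi

/-- The edges of a plaquette, as ordered pairs along its boundary loop. -/
def Plaq.IsSide (p : Plaq Λ) (u v : VSite Λ) : Prop :=
  (u = p.c0 ∧ v = p.c1) ∨ (u = p.c1 ∧ v = p.c2) ∨ (u = p.c2 ∧ v = p.c3) ∨ (u = p.c3 ∧ v = p.c0)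

lemma Plaq.IsSide.adj {p : Plaq Λ} {u v : VSite Λ} (h : p.IsSide u v) :
    (latticeGraph Λ).Adj u v := by
  rcases h with ⟨rfl, rfl⟩ | ⟨rfl, rfl⟩ | ⟨rfl, rfl⟩ | ⟨rfl, rfl⟩
  exacts [p.adj01, p.adj12, p.adj23, p.adj30]

lemma side_mem_shell {p : Plaq Λ} (hp : ¬ PlaqInBox lo hi p) {u v : VSite Λ} (h : p.IsSide u v)
    (hu : (u : Site) ∈ Set.Icc lo hi) (hv : (v : Site) ∈ Set.Icc lo hi) :
    (u : Site) ∈ shell Λ lo hi ∧ (v : Site) ∈ shell Λ lo hi := by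
  have hkl : p.1.2.1 ≠ p.1.2.2 := p.2.1.ne
  have e2 : (p.c2 : Site) = p.c3 + unit p.1.2.1 := add_right_comm _ _ _
  have e2' : (p.c2 : Site) = p.c1 + unit p.1.2.2 := rfl
  have e1 : (p.c1 : Site) = p.c0 + unit p.1.2.1 := rfl
  have e3 : (p.c3 : Site) = p.c0 + unit p.1.2.2 := rfl
  have k1 : (p.c1 : Site) p.1.2.2 = (p.c0 : Site) p.1.2.2 := by
    rw [e1]; simp [unit_apply_ne hkl.symm]
  have k2 : (p.c3 : Site) p.1.2.1 = (p.c0 : Site) p.1.2.1 := by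
    rw [e3]; simp [unit_apply_ne hkl]
  rcases h with ⟨rfl, rfl⟩ | ⟨rfl, rfl⟩ | ⟨rfl, rfl⟩ | ⟨rfl, rfl⟩
  · have a : (p.c2 : Site) ∈ Set.Icc lo hi ↔ (p.c3 : Site) ∈ Set.Icc lo hi := by
      rw [e2', e3]
      exact ⟨add_unit_mem_iff hv hu k1, add_unit_mem_iff hu hv k1.symm⟩
    have n3 : (p.c3 : Site) ∉ Set.Icc lo hi := fun h3 => hp ⟨hu, hv, a.2 h3, h3⟩
    exact ⟨mem_shell_of_adj p.adj30.symm hu n3,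
      mem_shell_of_adj p.adj12 hv fun h2 => n3 (a.1 h2)⟩
  · have a : (p.c0 : Site) ∈ Set.Icc lo hi ↔ (p.c3 : Site) ∈ Set.Icc lo hi := by
      rw [e1] at hu
      rw [e2] at hv
      exact ⟨sub_unit_mem_iff hu hv k2.symm, sub_unit_mem_iff hv hu k2⟩
    have n3 : (p.c3 : Site) ∉ Set.Icc lo hi := fun h3 => hp ⟨a.2 h3, hu, hv, h3⟩
    exact ⟨mem_shell_of_adj p.adj01.symm hu fun h2 => n3 (a.1 h2),
      mem_shell_of_adj p.adj23 hv n3⟩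
  · have a : (p.c0 : Site) ∈ Set.Icc lo hi ↔ (p.c1 : Site) ∈ Set.Icc lo hi := by
      rw [e3] at hv
      rw [e2'] at hu
      exact ⟨sub_unit_mem_iff hv hu k1.symm, sub_unit_mem_iff hu hv k1⟩
    have n1 : (p.c1 : Site) ∉ Set.Icc lo hi := fun h3 => hp ⟨a.2 h3, h3, hu, hv⟩
    exact ⟨mem_shell_of_adj p.adj12.symm hu n1,
      mem_shell_of_adj p.adj30 hv fun h2 => n1 (a.1 h2)⟩
  · have a : (p.c2 : Site) ∈ Set.Icc lo hi ↔ (p.c1 : Site) ∈ Set.Icc lo hi := by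
      rw [e2, e1]
      exact ⟨add_unit_mem_iff hu hv k2, add_unit_mem_iff hv hu k2.symm⟩
    have n1 : (p.c1 : Site) ∉ Set.Icc lo hi := fun h3 => hp ⟨hv, h3, a.2 h3, hu⟩
    exact ⟨mem_shell_of_adj p.adj23.symm hu fun h2 => n1 (a.1 h2),
      mem_shell_of_adj p.adj01 hv n1⟩

/-- The configuration equal to `σ` on edges inside the box and to `τ` elsewhere. -/
def mix (lo hi : Site) (σ τ : EdgeConf Λ G) : EdgeConf Λ G := fun e =>
  if (e.v0 : Site) ∈ Set.Icc lo hi ∧ (e.v1 : Site) ∈ Set.Icc lo hi then σ e else τ e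

lemma oval_mix (σ τ : EdgeConf Λ G) {u v : VSite Λ} (h : (latticeGraph Λ).Adj u v) :
    oval (mix lo hi σ τ) u v =
      if (u : Site) ∈ Set.Icc lo hi ∧ (v : Site) ∈ Set.Icc lo hi then oval σ u v
      else oval τ u v := by
  obtain ⟨e, ⟨rfl, rfl⟩ | ⟨rfl, rfl⟩⟩ := adj_edge h
  · simp only [oval_edge]; rfl
  · simp only [oval_swap _ h.symm, oval_edge, mix, and_comm]
    split_ifs <;> rfl

/-- A walk to the shell which stays on one side of it. -/
def OneSided (G : Type*) [Group G] (lo hi : Site) {u s : VSite Λ}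
    (w : (latticeGraph Λ).Walk u s) : Prop :=
  ((u : Site) ∈ Set.Icc lo hi → ∀ σ τ : EdgeConf Λ G, hol (mix lo hi σ τ) w = hol σ w) ∧
  ((u : Site) ∉ Set.Icc lo hi → ∀ σ τ : EdgeConf Λ G, hol (mix lo hi σ τ) w = hol τ w) ∧
  ((u : Site) ∈ shell Λ lo hi → s = u ∧ ∀ σ : EdgeConf Λ G, hol σ w = 1)

lemma exists_oneSided {u v : VSite Λ} (w : (latticeGraph Λ).Walk u v)
    (hv : (v : Site) ∈ shell Λ lo hi) :
    ∃ s : VSite Λ, (s : Site) ∈ shell Λ lo hi ∧ ∃ w' : (latticeGraph Λ).Walk u s,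
      OneSided G lo hi w' := by
  induction w with
  | nil => exact ⟨_, hv, SimpleGraph.Walk.nil, by simp, by simp, by simp⟩
  | @cons u m v h q ih =>
    by_cases hu : (u : Site) ∈ shell Λ lo hi
    · exact ⟨_, hu, SimpleGraph.Walk.nil, by simp, by simp, by simp⟩
    obtain ⟨s, hs, w', h1, h2, -⟩ := ih hv
    by_cases hur : (u : Site) ∈ Set.Icc lo hi
    · have hm : (m : Site) ∈ Set.Icc lo hi := by
        by_contra hm
        exact hu (mem_shell_of_adj h hur hm)
      refine ⟨s, hs, SimpleGraph.Walk.cons h w', fun _ σ τ => ?_, fun h' => absurd hur h',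
        fun h' => absurd h' hu⟩
      rw [hol_cons, hol_cons, h1 hm, oval_mix _ _ h, if_pos ⟨hur, hm⟩]
    · by_cases hm : (m : Site) ∈ Set.Icc lo hi
      · refine ⟨m, mem_shell_of_adj h.symm hm hur, SimpleGraph.Walk.cons h SimpleGraph.Walk.nil,
          fun h' => absurd h' hur, fun _ σ τ => ?_, fun h' => absurd h' hu⟩
        rw [hol_cons, hol_cons, oval_mix _ _ h, if_neg (fun h' => hur h'.1)]
        simp
      · refine ⟨s, hs, SimpleGraph.Walk.cons h w', fun h' => absurd h' hur, fun _ σ τ => ?_,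
          fun h' => absurd h' hu⟩
        rw [hol_cons, hol_cons, h2 hm, oval_mix _ _ h, if_neg (fun h' => hur h'.1)]

/-- Configurations trivial on the shell and along a walk from the base point to it. -/
def Normalized (lo hi : Site) {s : VSite Λ} (w : (latticeGraph Λ).Walk x₀ s)
    (σ : EdgeConf Λ G) : Prop :=
  (∀ u v : VSite Λ, (latticeGraph Λ).Adj u v → (u : Site) ∈ shell Λ lo hi →
    (v : Site) ∈ shell Λ lo hi → oval σ u v = 1) ∧ hol σ w = 1

lemma oval_one {u v : VSite Λ} : oval (1 : EdgeConf Λ G) u v = 1 := by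
  unfold oval
  split_ifs <;> simp

lemma hol_one {u v : VSite Λ} (w : (latticeGraph Λ).Walk u v) :
    hol (1 : EdgeConf Λ G) w = 1 := by
  induction w with
  | nil => simp
  | cons h p ih => rw [hol_cons, ih, oval_one, mul_one]

lemma normalized_one {s : VSite Λ} (w : (latticeGraph Λ).Walk x₀ s) :
    Normalized lo hi w (1 : EdgeConf Λ G) :=
  ⟨fun _ _ _ _ _ => oval_one, hol_one w⟩

lemma Normalized.mix {s : VSite Λ} {w : (latticeGraph Λ).Walk x₀ s} (hw : OneSided G lo hi w)
    {σ τ : EdgeConf Λ G} (hσ : Normalized lo hi w σ) (hτ : Normalized lo hi w τ) :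
    Normalized lo hi w (mix lo hi σ τ) := by
  refine ⟨fun u v h hu hv => ?_, ?_⟩
  · rw [oval_mix _ _ h, if_pos ⟨hu.1, hv.1⟩]
    exact hσ.1 u v h hu hv
  · by_cases hx : (x₀ : Site) ∈ Set.Icc lo hi
    · rw [hw.1 hx, hσ.2]
    · rw [hw.2.1 hx, hτ.2]

lemma holP_mix_of_in (σ τ : EdgeConf Λ G) {p : Plaq Λ} (hp : PlaqInBox lo hi p) :
    holP (mix lo hi σ τ) p = holP σ p := by
  obtain ⟨h0, h1, h2, h3⟩ := hp
  rw [holP_eq, holP_eq, oval_mix _ _ p.adj01, oval_mix _ _ p.adj12, oval_mix _ _ p.adj23,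
    oval_mix _ _ p.adj30, if_pos ⟨h0, h1⟩, if_pos ⟨h1, h2⟩, if_pos ⟨h2, h3⟩, if_pos ⟨h3, h0⟩]

lemma oval_mix_of_side {s : VSite Λ} {w : (latticeGraph Λ).Walk x₀ s}
    {σ τ : EdgeConf Λ G} (hσ : Normalized lo hi w σ) (hτ : Normalized lo hi w τ) {p : Plaq Λ}
    (hp : ¬ PlaqInBox lo hi p) {u v : VSite Λ} (h : p.IsSide u v) :
    oval (mix lo hi σ τ) u v = oval τ u v := by
  rw [oval_mix _ _ h.adj]
  split_ifs with hc
  · obtain ⟨h1, h2⟩ := side_mem_shell hp h hc.1 hc.2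
    rw [hσ.1 u v h.adj h1 h2, hτ.1 u v h.adj h1 h2]
  · rfl

lemma holP_mix_of_not_in {s : VSite Λ} {w : (latticeGraph Λ).Walk x₀ s}
    {σ τ : EdgeConf Λ G} (hσ : Normalized lo hi w σ) (hτ : Normalized lo hi w τ) {p : Plaq Λ}
    (hp : ¬ PlaqInBox lo hi p) : holP (mix lo hi σ τ) p = holP τ p := by
  rw [holP_eq, holP_eq, oval_mix_of_side hσ hτ hp (Or.inl ⟨rfl, rfl⟩),
    oval_mix_of_side hσ hτ hp (Or.inr (Or.inl ⟨rfl, rfl⟩)),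
    oval_mix_of_side hσ hτ hp (Or.inr (Or.inr (Or.inl ⟨rfl, rfl⟩))),
    oval_mix_of_side hσ hτ hp (Or.inr (Or.inr (Or.inr ⟨rfl, rfl⟩)))]

lemma mix_self {H : Type*} (σ : EdgeConf Λ H) : mix lo hi σ σ = σ := funext fun e => by simp [mix]

lemma mix_mix_left {H : Type*} (σ τ ρ : EdgeConf Λ H) :
    mix lo hi (mix lo hi σ τ) ρ = mix lo hi σ ρ := funext fun e => by
  simp only [mix]; split_ifs <;> rfl

lemma mix_mix_right {H : Type*} (σ τ ρ : EdgeConf Λ H) :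
    mix lo hi σ (mix lo hi τ ρ) = mix lo hi σ ρ := funext fun e => by
  simp only [mix]; split_ifs <;> rfl

lemma shell_subset_Icc (h : GoodBox G Λ lo hi) : shell Λ lo hi ⊆ Set.Icc Λ.a Λ.b :=
  fun _ hx => ⟨h.a_le.trans hx.1.1, hx.1.2.trans h.le_b⟩

lemma eq_one_on_shell (hR : GoodBox G Λ lo hi) {s : VSite Λ} (hs : (s : Site) ∈ shell Λ lo hi)
    {w : (latticeGraph Λ).Walk x₀ s} {σ : EdgeConf Λ G} {g : VSite Λ → G} (hg : g x₀ = 1)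
    (h1 : Normalized lo hi w σ) (h2 : Normalized lo hi w (gaugeT g σ)) (u : VSite Λ)
    (hu : (u : Site) ∈ shell Λ lo hi) : g u = 1 := by
  have hgs : g s = 1 := by
    have := h2.2
    rw [hol_gaugeT, hg, h1.2] at this
    simpa using this
  have := hR.linked.eq_of_step (fun x => if h : Λ.mem x then g ⟨x, h⟩ else 1) ?_ hu hs
  · simpa only [dif_pos u.2, dif_pos s.2, hgs] using this
  · intro x k hx hk
    have mx := mem_iff_mem_Icc.2 (shell_subset_Icc hR hx)
    have mk := mem_iff_mem_Icc.2 (shell_subset_Icc hR hk)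
    simp only [dif_pos mx, dif_pos mk]
    have hadj : (latticeGraph Λ).Adj ⟨x, mx⟩ ⟨x + unit k, mk⟩ := ⟨k, Or.inl rfl⟩
    have e := h2.1 _ _ hadj hx hk
    rw [oval_gaugeT _ _ hadj, h1.1 _ _ hadj hx hk, mul_one, mul_inv_eq_one] at e
    exact e

lemma psi_mix_congr (hR : GoodBox G Λ lo hi) (ℓb : ∀ x : VSite Λ, (latticeGraph Λ).Walk x₀ x)
    {s : VSite Λ} (hs : (s : Site) ∈ shell Λ lo hi) {w : (latticeGraph Λ).Walk x₀ s}
    {σ σ' τ τ' : EdgeConf Λ G} (hσ : Normalized lo hi w σ) (hσ' : Normalized lo hi w σ')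
    (hτ : Normalized lo hi w τ) (hτ' : Normalized lo hi w τ')
    (h1 : psi Λ x₀ σ = psi Λ x₀ σ') (h2 : psi Λ x₀ τ = psi Λ x₀ τ') :
    psi Λ x₀ (mix lo hi σ τ) = psi Λ x₀ (mix lo hi σ' τ') := by
  obtain ⟨g, hg, rfl⟩ := exists_gaugeT_of_psi_eq ℓb h1
  obtain ⟨g', hg', rfl⟩ := exists_gaugeT_of_psi_eq ℓb h2
  have a1 := eq_one_on_shell hR hs hg hσ hσ'
  have a2 := eq_one_on_shell hR hs hg' hτ hτ'
  have e : mix lo hi (gaugeT g σ) (gaugeT g' τ) =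
      gaugeT (fun x => if (x : Site) ∈ Set.Icc lo hi then g x else g' x) (mix lo hi σ τ) := by
    funext e
    simp only [mix, gaugeT]
    by_cases hc : (e.v0 : Site) ∈ Set.Icc lo hi ∧ (e.v1 : Site) ∈ Set.Icc lo hi
    · simp only [if_pos hc, if_pos hc.1, if_pos hc.2]
    · simp only [if_neg hc]
      have b0 : (if (e.v0 : Site) ∈ Set.Icc lo hi then g e.v0 else g' e.v0) = g' e.v0 := by
        split_ifs with h
        · have := mem_shell_of_adj e.adj h fun h' => hc ⟨h, h'⟩
          rw [a1 _ this, a2 _ this]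
        · rfl
      have b1 : (if (e.v1 : Site) ∈ Set.Icc lo hi then g e.v1 else g' e.v1) = g' e.v1 := by
        split_ifs with h
        · have := mem_shell_of_adj e.adj.symm h fun h' => hc ⟨h', h⟩
          rw [a1 _ this, a2 _ this]
        · rfl
      rw [b0, b1]
  rw [e, psi_gaugeT]
  simp [hg, hg']

lemma exists_normalized (hR : GoodBox G Λ lo hi)
    (ℓb : ∀ x : VSite Λ, (latticeGraph Λ).Walk x₀ x)
    {s : VSite Λ} (hs : (s : Site) ∈ shell Λ lo hi) {w : (latticeGraph Λ).Walk x₀ s}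
    (hw : OneSided G lo hi w) (ψ : Hom Λ x₀ G)
    (hψ : ∀ p ∈ hsupp ψ ℓb, ¬ PlaqInShell lo hi p) :
    ∃ σ : EdgeConf Λ G, psi Λ x₀ σ = ψ ∧ Normalized lo hi w σ := by
  obtain ⟨σ, rfl⟩ := psi_surjective ℓb ψ
  have hflat1 : ∀ x k l, k < l → x ∈ shell Λ lo hi → x + unit k ∈ shell Λ lo hi →
      x + unit l ∈ shell Λ lo hi → x + unit k + unit l ∈ shell Λ lo hi →
      siteField σ x k * siteField σ (x + unit k) l
        = siteField σ x l * siteField σ (x + unit l) k := by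
    intro x k l hkl h1 h2 h3 h4
    have mm := fun {y : Site} (h : y ∈ shell Λ lo hi) =>
      mem_iff_mem_Icc.2 (shell_subset_Icc hR h)
    set p : Plaq Λ := ⟨(x, k, l), hkl, mm h1, mm h2, mm h4, mm h3⟩ with hp
    have : holP σ p = 1 := by
      by_contra hne
      exact hψ p ((mem_hsupp_psi σ ℓb p).2 hne) ⟨h1, h2, h4, h3⟩
    rw [holP_eq_site, mul_inv_eq_one, mul_inv_eq_iff_eq_mul] at this
    exact this
  obtain ⟨g, hg⟩ := hR.flat (siteField σ) fun x k l hkl h1 h2 h3 h4 => by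
    rcases lt_or_gt_of_ne hkl with h | h
    · exact hflat1 x k l h h1 h2 h3 h4
    · exact (hflat1 x l k h h1 h3 h2 (by rwa [add_right_comm])).symm
  set h : VSite Λ → G := fun x =>
    if (x : Site) ∈ shell Λ lo hi then hol σ w * (g s)⁻¹ * g x else 1 with hh
  have hx0 : h x₀ = 1 := by
    simp only [hh]
    split_ifs with hx
    · obtain ⟨h1, h2⟩ := hw.2.2 hx
      rw [h2, h1]; group
    · rfl
  refine ⟨gaugeT h σ, psi_gaugeT hx0 σ, fun u v huv hu hv => ?_, ?_⟩
  · rw [oval_gaugeT _ _ huv]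
    simp only [hh, if_pos hu, if_pos hv]
    obtain ⟨i, hi | hi⟩ := huv
    · rw [oval_pos σ hi, hg _ i hu (hi ▸ hv), ← hi]; group
    · rw [oval_neg σ hi, hg _ i hv (hi ▸ hu), ← hi]; group
  · rw [hol_gaugeT, hx0]
    simp only [hh, if_pos hs]
    group

lemma psi_eq_one_of_flat (ℓb : ∀ x : VSite Λ, (latticeGraph Λ).Walk x₀ x) {σ : EdgeConf Λ G}
    (h : ∀ p, holP σ p = 1) : psi Λ x₀ σ = psi Λ x₀ 1 := by
  refine eq_of_hsupp_empty ℓb (fun p hp => ?_) (fun p hp => ?_)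
  · exact (mem_hsupp_psi σ ℓb p).1 hp (h p)
  · exact (mem_hsupp_psi _ ℓb p).1 hp (hol_one _)

end Mix

section Split

variable {Λ : Box} {x₀ : VSite Λ} {G : Type*} [Group G] {lo hi : Site}

lemma exists_plaq_of_square {B : Rect Λ} {x : Site} {i m : Fin 4} (him : i ≠ m)
    (h0 : B.memV x) (h1 : B.memV (x + unit i)) (h2 : B.memV (x + unit i + unit m))
    (h3 : B.memV (x + unit m)) :
    ∃ p ∈ S2 B, ∀ u v : VSite Λ,
      ((u : Site) = x ∧ (v : Site) = x + unit i) ∨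
        ((u : Site) = x + unit m ∧ (v : Site) = x + unit m + unit i) →
      p.IsSide u v ∨ p.IsSide v u := by
  have mm : ∀ {y : Site}, B.memV y → Λ.mem y := fun h i =>
    ⟨(B.a_le_lo i).trans (h i).1, (h i).2.trans (B.hi_le_b i)⟩
  rcases lt_or_gt_of_ne him with h | h
  · refine ⟨⟨(x, i, m), h, mm h0, mm h1, mm h2, mm h3⟩, ⟨h0, h1, h2, h3⟩, fun u v huv => ?_⟩
    rcases huv with ⟨hu, hv⟩ | ⟨hu, hv⟩
    · exact Or.inl (Or.inl ⟨Subtype.ext hu, Subtype.ext hv⟩)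
    · exact Or.inr (Or.inr (Or.inr (Or.inl
        ⟨Subtype.ext (hv.trans (add_right_comm _ _ _)), Subtype.ext hu⟩)))
  · have h2' : B.memV (x + unit m + unit i) := by rwa [add_right_comm]
    refine ⟨⟨(x, m, i), h, mm h0, mm h3, mm h2', mm h1⟩, ⟨h0, h3, h2', h1⟩, fun u v huv => ?_⟩
    rcases huv with ⟨hu, hv⟩ | ⟨hu, hv⟩
    · exact Or.inr (Or.inr (Or.inr (Or.inr ⟨Subtype.ext hv, Subtype.ext hu⟩)))
    · exact Or.inl (Or.inr (Or.inl ⟨Subtype.ext hu, Subtype.ext hv⟩))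

lemma Rect.lt_of_plaqIn {B : Rect Λ} {p : Plaq Λ} (hp : B.plaqIn p) :
    B.lo p.1.2.1 < B.hi p.1.2.1 ∧ B.lo p.1.2.2 < B.hi p.1.2.2 := by
  have a0 := (hp.1 p.1.2.1).1
  have a1 := (hp.2.1 p.1.2.1).2
  have b0 := (hp.1 p.1.2.2).1
  have b1 := (hp.2.2.2 p.1.2.2).2
  simp only [Plaq.c0, Plaq.c1, Plaq.c3, Pi.add_apply, unit_apply_self] at a0 a1 b0 b1
  constructor <;> omega

lemma exists_plaq_side_of_pos {B : Rect Λ} (hB : (S2 B).Nonempty) {u v : VSite Λ} {i : Fin 4}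
    (h : (v : Site) = u + unit i) (hu : B.memV u) (hv : B.memV v) :
    ∃ p ∈ S2 B, p.IsSide u v ∨ p.IsSide v u := by
  obtain ⟨m, him, hm⟩ : ∃ m, i ≠ m ∧ B.lo m < B.hi m := by
    obtain ⟨p, hp⟩ := hB
    obtain ⟨h1, h2⟩ := Rect.lt_of_plaqIn hp
    by_cases hi : i = p.1.2.1
    · exact ⟨_, hi ▸ p.2.1.ne, h2⟩
    · exact ⟨_, hi, h1⟩
  rw [h] at hv
  have hvm : (u + unit i : Site) m = (u : Site) m := by simp [unit_apply_ne him.symm]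
  by_cases hum : (u : Site) m < B.hi m
  · have up : ∀ {y : Site}, B.memV y → y m = (u : Site) m → B.memV (y + unit m) := by
      intro y hy hym j
      have := hy j
      by_cases hj : j = m
      · subst hj; simp only [Pi.add_apply, unit_apply_self]; omega
      · simpa [unit_apply_ne hj] using this
    obtain ⟨p, hp, hs⟩ := exists_plaq_of_square him hu hv (up hv hvm) (up hu rfl)
    exact ⟨p, hp, hs u v (Or.inl ⟨rfl, h⟩)⟩
  · have dn : ∀ {y : Site}, B.memV y → y m = (u : Site) m → B.memV (y - unit m) := by
      intro y hy hym j
      have := hy j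
      by_cases hj : j = m
      · subst hj; simp only [Pi.sub_apply, unit_apply_self]; omega
      · simpa [unit_apply_ne hj] using this
    have e : (u : Site) - unit m + unit i = u + unit i - unit m := by abel
    obtain ⟨p, hp, hs⟩ := exists_plaq_of_square (x := (u : Site) - unit m) him (dn hu rfl)
      (e ▸ dn hv hvm) (by rw [e, sub_add_cancel]; exact hv) (by rw [sub_add_cancel]; exact hu)
    exact ⟨p, hp, hs u v (Or.inr ⟨by rw [sub_add_cancel], by rw [sub_add_cancel]; exact h⟩)⟩

lemma exists_plaq_side {B : Rect Λ} (hB : (S2 B).Nonempty) {u v : VSite Λ}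
    (h : (latticeGraph Λ).Adj u v) (hu : B.memV u) (hv : B.memV v) :
    ∃ p ∈ S2 B, p.IsSide u v ∨ p.IsSide v u := by
  obtain ⟨i, h | h⟩ := h
  · exact exists_plaq_side_of_pos hB h hu hv
  · obtain ⟨p, hp, hs⟩ := exists_plaq_side_of_pos hB h hv hu
    exact ⟨p, hp, hs.symm⟩

lemma Plaq.IsSide.mem_of_inBox {p : Plaq Λ} (hp : PlaqInBox lo hi p) {u v : VSite Λ}
    (h : p.IsSide u v) : (u : Site) ∈ Set.Icc lo hi ∧ (v : Site) ∈ Set.Icc lo hi := by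
  obtain ⟨h0, h1, h2, h3⟩ := hp
  rcases h with ⟨rfl, rfl⟩ | ⟨rfl, rfl⟩ | ⟨rfl, rfl⟩ | ⟨rfl, rfl⟩
  exacts [⟨h0, h1⟩, ⟨h1, h2⟩, ⟨h2, h3⟩, ⟨h3, h0⟩]

/-- A factorization of the homomorphisms supported in `A ∪ Q` into homomorphisms supported
in `A` and in `Q`, compatible with plaquette variables and with loops in rectangles. -/
structure Splitting (G : Type*) [Group G] (ℓb : ∀ x : VSite Λ, (latticeGraph Λ).Walk x₀ x)
    (A Q : Set (Plaq Λ)) where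
  e : {ψ : Hom Λ x₀ G // hsupp ψ ℓb ⊆ A ∪ Q} ≃
    {ψ : Hom Λ x₀ G // hsupp ψ ℓb ⊆ A} × {ψ : Hom Λ x₀ G // hsupp ψ ℓb ⊆ Q}
  conj : ∀ ψ p,
    (IsConj (evalP ψ.1 ℓb p) (evalP (e ψ).1.1 ℓb p) ∧ evalP (e ψ).2.1 ℓb p = 1) ∨
    (IsConj (evalP ψ.1 ℓb p) (evalP (e ψ).2.1 ℓb p) ∧ evalP (e ψ).1.1 ℓb p = 1)
  loop_left : ∀ ψ (B : Rect Λ), (S2 B).Nonempty → S2 B ⊆ A → ∀ u : VSite Λ,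
    ∀ γ : (latticeGraph Λ).Walk u u, WalkInRect B γ →
      IsConj (evalLoop ψ.1 ℓb γ) (evalLoop (e ψ).1.1 ℓb γ)
  loop_right : ∀ ψ (B : Rect Λ), (S2 B).Nonempty → S2 B ⊆ Q → ∀ u : VSite Λ,
    ∀ γ : (latticeGraph Λ).Walk u u, WalkInRect B γ →
      IsConj (evalLoop ψ.1 ℓb γ) (evalLoop (e ψ).2.1 ℓb γ)

variable {ℓb : ∀ x : VSite Λ, (latticeGraph Λ).Walk x₀ x} {A Q : Set (Plaq Λ)}

/-- A splitting with the two parts exchanged. -/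
def Splitting.swap (S : Splitting G ℓb A Q) : Splitting G ℓb Q A where
  e := (Equiv.subtypeEquivRight fun ψ => by rw [Set.union_comm]).trans
    (S.e.trans (Equiv.prodComm _ _))
  conj := fun ψ p => (S.conj ⟨ψ.1, Set.union_comm Q A ▸ ψ.2⟩ p).symm
  loop_left := fun ψ => S.loop_right ⟨ψ.1, Set.union_comm Q A ▸ ψ.2⟩
  loop_right := fun ψ => S.loop_left ⟨ψ.1, Set.union_comm Q A ▸ ψ.2⟩

lemma Splitting.hsupp_eq (S : Splitting G ℓb A Q) (ψ : {ψ : Hom Λ x₀ G // hsupp ψ ℓb ⊆ A ∪ Q}) :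
    hsupp ψ.1 ℓb = hsupp (S.e ψ).1.1 ℓb ∪ hsupp (S.e ψ).2.1 ℓb := by
  ext p
  simp only [hsupp, Set.mem_union, Set.mem_ofPred_eq]
  rcases S.conj ψ p with ⟨h1, h2⟩ | ⟨h1, h2⟩ <;> rw [ne_eq, isConj_eq_one_iff h1]
  · exact ⟨Or.inl, fun h => h.resolve_right (not_not.2 h2)⟩
  · exact ⟨Or.inr, fun h => h.resolve_left (not_not.2 h2)⟩

lemma nonempty_splitting_of_goodBox (hR : GoodBox G Λ lo hi)
    (ℓb : ∀ x : VSite Λ, (latticeGraph Λ).Walk x₀ x) {A Q : Set (Plaq Λ)}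
    (hA : ∀ p ∈ A, PlaqInBox lo hi p ∧ ¬ PlaqInShell lo hi p)
    (hQ : ∀ p ∈ Q, ¬ PlaqInBox lo hi p) : Nonempty (Splitting G ℓb A Q) := by
  obtain ⟨y, hy⟩ := hR.nonempty
  obtain ⟨s, hs, w, hw⟩ := exists_oneSided (G := G)
    (ℓb ⟨y, mem_iff_mem_Icc.2 (shell_subset_Icc hR hy)⟩) hy
  have hQ' : ∀ p ∈ Q, ¬ PlaqInShell lo hi p := fun p hp h =>
    hQ p hp ⟨h.1.1, h.2.1.1, h.2.2.1.1, h.2.2.2.1⟩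
  have hAQ : ∀ p ∈ A ∪ Q, ¬ PlaqInShell lo hi p := fun p hp =>
    hp.elim (fun h => (hA p h).2) (hQ' p)
  have ex : ∀ ψ : Hom Λ x₀ G, ∃ σ : EdgeConf Λ G, hsupp ψ ℓb ⊆ A ∪ Q →
      psi Λ x₀ σ = ψ ∧ Normalized lo hi w σ := by
    intro ψ
    by_cases h : hsupp ψ ℓb ⊆ A ∪ Q
    · obtain ⟨σ, hσ⟩ := exists_normalized hR ℓb hs hw ψ fun p hp => hAQ p (h hp)
      exact ⟨σ, fun _ => hσ⟩
    · exact ⟨1, fun h' => absurd h' h⟩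
  choose f hf using ex
  have hn1 := normalized_one (G := G) (lo := lo) (hi := hi) w
  have holP_one : ∀ p : Plaq Λ, holP (1 : EdgeConf Λ G) p = 1 := fun p => hol_one _
  have supp_f : ∀ ψ : Hom Λ x₀ G, ∀ h : hsupp ψ ℓb ⊆ A ∪ Q, ∀ p, holP (f ψ) p ≠ 1 →
      p ∈ hsupp ψ ℓb := by
    intro ψ h p hp
    rw [← (hf ψ h).1]
    exact (mem_hsupp_psi _ ℓb p).2 hp
  have left_supp : ∀ ψ : Hom Λ x₀ G, hsupp ψ ℓb ⊆ A ∪ Q →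
      hsupp (psi Λ x₀ (mix lo hi (f ψ) 1)) ℓb ⊆ A := by
    intro ψ h p hp
    rw [mem_hsupp_psi] at hp
    by_cases hb : PlaqInBox lo hi p
    · rw [holP_mix_of_in _ _ hb] at hp
      exact (h (supp_f ψ h p hp)).resolve_right fun h' => hQ p h' hb
    · rw [holP_mix_of_not_in (hf ψ h).2 hn1 hb, holP_one] at hp
      exact absurd rfl hp
  have right_supp : ∀ ψ : Hom Λ x₀ G, hsupp ψ ℓb ⊆ A ∪ Q →
      hsupp (psi Λ x₀ (mix lo hi 1 (f ψ))) ℓb ⊆ Q := by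
    intro ψ h p hp
    rw [mem_hsupp_psi] at hp
    by_cases hb : PlaqInBox lo hi p
    · rw [holP_mix_of_in _ _ hb, holP_one] at hp
      exact absurd rfl hp
    · rw [holP_mix_of_not_in hn1 (hf ψ h).2 hb] at hp
      exact (h (supp_f ψ h p hp)).resolve_left fun h' => hb (hA p h').1
  have join_supp : ∀ α γ : Hom Λ x₀ G, hsupp α ℓb ⊆ A → hsupp γ ℓb ⊆ Q →
      hsupp (psi Λ x₀ (mix lo hi (f α) (f γ))) ℓb ⊆ A ∪ Q := by
    intro α γ hα hγ p hp
    have hα' := hα.trans (Set.subset_union_left (t := Q))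
    have hγ' := hγ.trans (Set.subset_union_right (s := A))
    rw [mem_hsupp_psi] at hp
    by_cases hb : PlaqInBox lo hi p
    · rw [holP_mix_of_in _ _ hb] at hp
      exact Or.inl (hα (supp_f α hα' p hp))
    · rw [holP_mix_of_not_in (hf α hα').2 (hf γ hγ').2 hb] at hp
      exact Or.inr (hγ (supp_f γ hγ' p hp))
  have flatA : ∀ α : Hom Λ x₀ G, hsupp α ℓb ⊆ A →
      psi Λ x₀ (mix lo hi 1 (f α)) = psi Λ x₀ 1 := by
    intro α hα
    have hα' := hα.trans (Set.subset_union_left (t := Q))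
    refine psi_eq_one_of_flat ℓb fun p => ?_
    by_cases hb : PlaqInBox lo hi p
    · rw [holP_mix_of_in _ _ hb, holP_one]
    · rw [holP_mix_of_not_in hn1 (hf α hα').2 hb]
      by_contra hne
      exact hb (hA p (hα (supp_f α hα' p hne))).1
  have flatQ : ∀ γ : Hom Λ x₀ G, hsupp γ ℓb ⊆ Q →
      psi Λ x₀ (mix lo hi (f γ) 1) = psi Λ x₀ 1 := by
    intro γ hγ
    have hγ' := hγ.trans (Set.subset_union_right (s := A))
    refine psi_eq_one_of_flat ℓb fun p => ?_
    by_cases hb : PlaqInBox lo hi p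
    · rw [holP_mix_of_in _ _ hb]
      by_contra hne
      exact hQ p (hγ (supp_f γ hγ' p hne)) hb
    · rw [holP_mix_of_not_in (hf γ hγ').2 hn1 hb, holP_one]
  refine ⟨⟨⟨fun ψ => (⟨_, left_supp ψ.1 ψ.2⟩, ⟨_, right_supp ψ.1 ψ.2⟩),
    fun αγ => ⟨_, join_supp αγ.1.1 αγ.2.1 αγ.1.2 αγ.2.2⟩, ?_, ?_⟩, ?_, ?_, ?_⟩⟩
  · rintro ⟨ψ, hψ⟩
    apply Subtype.ext
    have h1 := hf ψ hψ
    have h2 := hf _ ((left_supp ψ hψ).trans (Set.subset_union_left (t := Q)))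
    have h3 := hf _ ((right_supp ψ hψ).trans (Set.subset_union_right (s := A)))
    change psi Λ x₀ (mix lo hi (f (psi Λ x₀ (mix lo hi (f ψ) 1)))
      (f (psi Λ x₀ (mix lo hi 1 (f ψ))))) = ψ
    rw [psi_mix_congr hR ℓb hs h2.2 (h1.2.mix hw hn1) h3.2 (hn1.mix hw h1.2) h2.1 h3.1,
      mix_mix_left, mix_mix_right, mix_self, h1.1]
  · rintro ⟨⟨α, hα⟩, ⟨γ, hγ⟩⟩
    have h1 := hf α (hα.trans (Set.subset_union_left (t := Q)))
    have h2 := hf γ (hγ.trans (Set.subset_union_right (s := A)))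
    have h3 := hf _ (join_supp α γ hα hγ)
    refine Prod.ext (Subtype.ext ?_) (Subtype.ext ?_)
    · change psi Λ x₀ (mix lo hi (f (psi Λ x₀ (mix lo hi (f α) (f γ)))) 1) = α
      rw [psi_mix_congr hR ℓb hs h3.2 (h1.2.mix hw h2.2) hn1 (hn1.mix hw h1.2) h3.1
        (flatA α hα).symm, mix_mix_left, mix_mix_right, mix_self, h1.1]
    · change psi Λ x₀ (mix lo hi 1 (f (psi Λ x₀ (mix lo hi (f α) (f γ))))) = γ
      rw [psi_mix_congr hR ℓb hs hn1 (h2.2.mix hw hn1) h3.2 (h1.2.mix hw h2.2)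
        (flatQ γ hγ).symm h3.1, mix_mix_left, mix_mix_right, mix_self, h2.1]
  · rintro ⟨ψ, hψ⟩ p
    have h1 := hf ψ hψ
    have c0 : IsConj (evalP ψ ℓb p) (holP (f ψ) p) := by
      have := isConj_evalP_psi (x₀ := x₀) (f ψ) ℓb p
      rwa [h1.1] at this
    have c1 := isConj_evalP_psi (x₀ := x₀) (mix lo hi (f ψ) 1) ℓb p
    have c2 := isConj_evalP_psi (x₀ := x₀) (mix lo hi 1 (f ψ)) ℓb p
    by_cases hb : PlaqInBox lo hi p
    · rw [holP_mix_of_in _ _ hb] at c1 c2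
      exact Or.inl ⟨c0.trans c1.symm, (isConj_eq_one_iff c2).2 (holP_one p)⟩
    · rw [holP_mix_of_not_in h1.2 hn1 hb] at c1
      rw [holP_mix_of_not_in hn1 h1.2 hb] at c2
      exact Or.inr ⟨c0.trans c2.symm, (isConj_eq_one_iff c1).2 (holP_one p)⟩
  · rintro ⟨ψ, hψ⟩ B hB hBA u γ hγ
    have h1 := hf ψ hψ
    have c0 : IsConj (evalLoop ψ ℓb γ) (hol (f ψ) γ) := by
      have := isConj_evalLoop_psi (x₀ := x₀) (f ψ) ℓb γ
      rwa [h1.1] at this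
    refine c0.trans ?_
    rw [← hol_congr (σ := mix lo hi (f ψ) 1) γ]
    · exact (isConj_evalLoop_psi _ ℓb γ).symm
    · intro d hd
      obtain ⟨p, hp, hside⟩ := exists_plaq_side hB d.adj
        (hγ _ (γ.dart_fst_mem_support_of_mem_darts hd))
        (hγ _ (γ.dart_snd_mem_support_of_mem_darts hd))
      rw [oval_mix _ _ d.adj]
      have hb := (hA p (hBA hp)).1
      rw [if_pos (hside.elim (fun h => h.mem_of_inBox hb) fun h => (h.mem_of_inBox hb).symm)]
  · rintro ⟨ψ, hψ⟩ B hB hBA u γ hγ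
    have h1 := hf ψ hψ
    have c0 : IsConj (evalLoop ψ ℓb γ) (hol (f ψ) γ) := by
      have := isConj_evalLoop_psi (x₀ := x₀) (f ψ) ℓb γ
      rwa [h1.1] at this
    refine c0.trans ?_
    rw [← hol_congr (σ := mix lo hi 1 (f ψ)) γ]
    · exact (isConj_evalLoop_psi _ ℓb γ).symm
    · intro d hd
      obtain ⟨p, hp, hside⟩ := exists_plaq_side hB d.adj
        (hγ _ (γ.dart_fst_mem_support_of_mem_darts hd))
        (hγ _ (γ.dart_snd_mem_support_of_mem_darts hd))
      have hb := hQ p (hBA hp)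
      rcases hside with h | h
      · exact oval_mix_of_side hn1 h1.2 hb h
      · rw [oval_swap _ h.adj, oval_swap _ h.adj, oval_mix_of_side hn1 h1.2 hb h]

end Split

section Swappable

variable {Λ : Box} {x₀ : VSite Λ} {G : Type*} [Group G] {χ : G → ℂ} {β : ℝ}
  {ℓb : ∀ x : VSite Λ, (latticeGraph Λ).Walk x₀ x} {A Q P₀ P : Set (Plaq Λ)} {B₁ B₂ : Rect Λ}

lemma phiB_one : phiB χ β 1 = 1 := by simp [phiB]

lemma phiB_congr (hχ : ∀ a b : G, IsConj a b → χ a = χ b) {a b : G} (h : IsConj a b) :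
    phiB χ β a = phiB χ β b := by
  unfold phiB; rw [hχ a b h]

lemma nuW_eq_mul (hχ : ∀ a b : G, IsConj a b → χ a = χ b) (S : Splitting G ℓb A Q)
    (ψ : {ψ : Hom Λ x₀ G // hsupp ψ ℓb ⊆ A ∪ Q}) :
    nuW Λ x₀ χ β ℓb ψ.1 = nuW Λ x₀ χ β ℓb (S.e ψ).1.1 * nuW Λ x₀ χ β ℓb (S.e ψ).2.1 := by
  unfold nuW
  rw [← finprod_mul_distrib (Set.toFinite _) (Set.toFinite _)]
  refine finprod_congr fun p => ?_
  rcases S.conj ψ p with ⟨h1, h2⟩ | ⟨h1, h2⟩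
  · rw [h2, phiB_one, mul_one, phiB_congr hχ h1]
  · rw [h2, phiB_one, one_mul, phiB_congr hχ h1]

/-- Pairs of homomorphisms with prescribed joint support. -/
abbrev PairSupp (G : Type*) [Group G] (ℓb : ∀ x : VSite Λ, (latticeGraph Λ).Walk x₀ x)
    (P₀ P : Set (Plaq Λ)) : Type _ :=
  {Ψ : Hom Λ x₀ G × Hom Λ x₀ G // supp2 Λ x₀ ℓb P₀ Ψ.1 Ψ.2 = P}

/-- The weight of a pair of homomorphisms. -/
def pairW (χ : G → ℂ) (β : ℝ) (ℓb : ∀ x : VSite Λ, (latticeGraph Λ).Walk x₀ x)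
    (Ψ : Hom Λ x₀ G × Hom Λ x₀ G) : ℝ :=
  nuW Λ x₀ χ β ℓb Ψ.1 * nuW Λ x₀ χ β ℓb Ψ.2

/-- A permutation of the pairs with joint support `P` which moves the values of the second
homomorphism on `B₂` to the first one, and keeps those of the first one on `B₁`. -/
def IsSwap (χ : G → ℂ) (β : ℝ) (ℓb : ∀ x : VSite Λ, (latticeGraph Λ).Walk x₀ x)
    (B₁ B₂ : Rect Λ) (Ψ Φ : Hom Λ x₀ G × Hom Λ x₀ G) : Prop :=
  pairW χ β ℓb Φ = pairW χ β ℓb Ψ ∧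
  (∀ (u : VSite Λ) (γ : (latticeGraph Λ).Walk u u), WalkInRect B₁ γ →
    IsConj (evalLoop Ψ.1 ℓb γ) (evalLoop Φ.1 ℓb γ)) ∧
  (∀ (u : VSite Λ) (γ : (latticeGraph Λ).Walk u u), WalkInRect B₂ γ →
    IsConj (evalLoop Ψ.2 ℓb γ) (evalLoop Φ.1 ℓb γ))

/-- The pairs with joint support `P` can be swapped. -/
def Swappable (χ : G → ℂ) (β : ℝ) (ℓb : ∀ x : VSite Λ, (latticeGraph Λ).Walk x₀ x)
    (B₁ B₂ : Rect Λ) (P₀ P : Set (Plaq Λ)) : Prop :=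
  ∃ e : Equiv.Perm (PairSupp G ℓb P₀ P), ∀ Ψ, IsSwap χ β ℓb B₁ B₂ Ψ.1 (e Ψ).1

lemma PairSupp.left_subset (Ψ : PairSupp G ℓb P₀ P) : hsupp Ψ.1.1 ℓb ⊆ P := fun _ hp =>
  Ψ.2 ▸ Or.inl (Or.inl hp)

lemma PairSupp.right_subset (Ψ : PairSupp G ℓb P₀ P) : hsupp Ψ.1.2 ℓb ⊆ P := fun _ hp =>
  Ψ.2 ▸ Or.inl (Or.inr hp)

lemma Splitting.hsupp_symm (S : Splitting G ℓb A Q) (x) :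
    hsupp (S.e.symm x).1 ℓb = hsupp x.1.1 ℓb ∪ hsupp x.2.1 ℓb := by
  rw [S.hsupp_eq, Equiv.apply_symm_apply]

lemma eq_of_union_eq_union {α : Type*} {X Y A Q : Set α} (hX : X ⊆ A) (hY : Y ⊆ Q)
    (h : X ∪ Y = A ∪ Q) (hd : Disjoint A Q) : X = A ∧ Y = Q := by
  refine ⟨hX.antisymm fun a ha => ?_, hY.antisymm fun a ha => ?_⟩
  · exact (h.ge (Or.inl ha)).resolve_right fun h' => Set.disjoint_left.1 hd ha (hY h')
  · exact (h.ge (Or.inr ha)).resolve_left fun h' => Set.disjoint_left.1 hd (hX h') ha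

lemma Splitting.supp2_eq (S : Splitting G ℓb A Q) (hd : Disjoint A Q) (h0 : P₀ ⊆ A)
    (ψ φ : {ψ : Hom Λ x₀ G // hsupp ψ ℓb ⊆ A ∪ Q}) (h : supp2 Λ x₀ ℓb P₀ ψ.1 φ.1 = A ∪ Q) :
    supp2 Λ x₀ ℓb P₀ (S.e ψ).1.1 (S.e φ).1.1 = A ∧
      supp2 Λ x₀ ℓb ∅ (S.e ψ).2.1 (S.e φ).2.1 = Q := by
  refine eq_of_union_eq_union ?_ ?_ ?_ hd
  · exact Set.union_subset (Set.union_subset (S.e ψ).1.2 (S.e φ).1.2) h0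
  · exact Set.union_subset (Set.union_subset (S.e ψ).2.2 (S.e φ).2.2) (Set.empty_subset _)
  · refine Eq.trans ?_ h
    simp only [supp2, S.hsupp_eq]
    ext p
    simp only [Set.mem_union, Set.mem_empty_iff_false]
    tauto

/-- A splitting factorizes pairs of homomorphisms. -/
def Splitting.pairEquiv (S : Splitting G ℓb A Q) (hd : Disjoint A Q) (h0 : P₀ ⊆ A) :
    PairSupp G ℓb P₀ (A ∪ Q) ≃ PairSupp G ℓb P₀ A × PairSupp G ℓb ∅ Q where
  toFun Ψ :=
    (⟨((S.e ⟨Ψ.1.1, Ψ.left_subset⟩).1.1, (S.e ⟨Ψ.1.2, Ψ.right_subset⟩).1.1),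
      (S.supp2_eq hd h0 ⟨Ψ.1.1, Ψ.left_subset⟩ ⟨Ψ.1.2, Ψ.right_subset⟩ Ψ.2).1⟩,
     ⟨((S.e ⟨Ψ.1.1, Ψ.left_subset⟩).2.1, (S.e ⟨Ψ.1.2, Ψ.right_subset⟩).2.1),
      (S.supp2_eq hd h0 ⟨Ψ.1.1, Ψ.left_subset⟩ ⟨Ψ.1.2, Ψ.right_subset⟩ Ψ.2).2⟩)
  invFun x :=
    ⟨((S.e.symm (⟨x.1.1.1, x.1.left_subset⟩, ⟨x.2.1.1, x.2.left_subset⟩)).1,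
      (S.e.symm (⟨x.1.1.2, x.1.right_subset⟩, ⟨x.2.1.2, x.2.right_subset⟩)).1), by
      have h1 : hsupp x.1.1.1 ℓb ∪ hsupp x.1.1.2 ℓb ∪ P₀ = A := x.1.2
      have h2 : hsupp x.2.1.1 ℓb ∪ hsupp x.2.1.2 ℓb ∪ ∅ = Q := x.2.2
      refine Eq.trans ?_ (congrArg₂ (· ∪ ·) h1 h2)
      simp only [supp2, S.hsupp_symm]
      ext p
      simp only [Set.mem_union, Set.mem_empty_iff_false]
      tauto⟩
  left_inv Ψ := by simp
  right_inv x := by simp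

lemma Splitting.pairW_eq (hχ : ∀ a b : G, IsConj a b → χ a = χ b) (S : Splitting G ℓb A Q)
    (hd : Disjoint A Q) (h0 : P₀ ⊆ A) (Ψ : PairSupp G ℓb P₀ (A ∪ Q)) :
    pairW χ β ℓb Ψ.1 =
      pairW χ β ℓb (S.pairEquiv hd h0 Ψ).1.1 * pairW χ β ℓb (S.pairEquiv hd h0 Ψ).2.1 := by
  simp only [pairW, Splitting.pairEquiv, Equiv.coe_fn_mk]
  rw [nuW_eq_mul hχ S ⟨Ψ.1.1, Ψ.left_subset⟩, nuW_eq_mul hχ S ⟨Ψ.1.2, Ψ.right_subset⟩]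
  ring

lemma Swappable.union (hχ : ∀ a b : G, IsConj a b → χ a = χ b) (S : Splitting G ℓb A Q)
    (hd : Disjoint A Q) (h0 : P₀ ⊆ A) (hB₁ : (S2 B₁).Nonempty) (hB₂ : (S2 B₂).Nonempty)
    (h1 : S2 B₁ ⊆ P₀) (h2 : S2 B₂ ⊆ P₀) (h : Swappable χ β ℓb B₁ B₂ P₀ A) :
    Swappable χ β ℓb B₁ B₂ P₀ (A ∪ Q) := by
  obtain ⟨e, he⟩ := h
  set E := S.pairEquiv hd h0
  refine ⟨(E.trans (Equiv.prodCongr e (Equiv.refl _))).trans E.symm, fun Ψ => ?_⟩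
  set Φ := ((E.trans (Equiv.prodCongr e (Equiv.refl _))).trans E.symm) Ψ with hΦ
  have hE : E Φ = (e (E Ψ).1, (E Ψ).2) := by
    rw [hΦ]; simp; rfl
  have hE1 : (E Φ).1.1 = (e (E Ψ).1).1 := by rw [hE]
  obtain ⟨k1, k2, k3⟩ := he (E Ψ).1
  rw [← hE1] at k1 k2 k3
  refine ⟨?_, fun u γ hγ => ?_, fun u γ hγ => ?_⟩
  · rw [S.pairW_eq hχ hd h0, S.pairW_eq hχ hd h0]
    change pairW χ β ℓb (E Φ).1.1 * pairW χ β ℓb (E Φ).2.1 = _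
    rw [k1, hE]
  · have a := S.loop_left ⟨Ψ.1.1, Ψ.left_subset⟩ B₁ hB₁ (h1.trans h0) u γ hγ
    have b := S.loop_left ⟨Φ.1.1, Φ.left_subset⟩ B₁ hB₁ (h1.trans h0) u γ hγ
    exact (a.trans (k2 u γ hγ)).trans b.symm
  · have a := S.loop_left ⟨Ψ.1.2, Ψ.right_subset⟩ B₂ hB₂ (h2.trans h0) u γ hγ
    have b := S.loop_left ⟨Φ.1.1, Φ.left_subset⟩ B₂ hB₂ (h2.trans h0) u γ hγ
    exact (a.trans (k3 u γ hγ)).trans b.symm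

lemma Splitting.swappable (hχ : ∀ a b : G, IsConj a b → χ a = χ b) (S : Splitting G ℓb A Q)
    (hB₁ : (S2 B₁).Nonempty) (hB₂ : (S2 B₂).Nonempty)
    (h1 : S2 B₁ ⊆ A) (h2 : S2 B₂ ⊆ Q) : Swappable χ β ℓb B₁ B₂ P₀ (A ∪ Q) := by
  set T : PairSupp G ℓb P₀ (A ∪ Q) → PairSupp G ℓb P₀ (A ∪ Q) := fun Ψ =>
    ⟨((S.e.symm ((S.e ⟨Ψ.1.1, Ψ.left_subset⟩).1, (S.e ⟨Ψ.1.2, Ψ.right_subset⟩).2)).1,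
      (S.e.symm ((S.e ⟨Ψ.1.2, Ψ.right_subset⟩).1, (S.e ⟨Ψ.1.1, Ψ.left_subset⟩).2)).1), by
      refine Eq.trans ?_ Ψ.2
      have a := S.hsupp_eq ⟨Ψ.1.1, Ψ.left_subset⟩
      have b := S.hsupp_eq ⟨Ψ.1.2, Ψ.right_subset⟩
      simp only [supp2, S.hsupp_symm]
      simp only at a b
      conv_rhs => rw [a, b]
      ext p
      simp only [Set.mem_union]
      tauto⟩ with hT
  have hinv : Function.Involutive T := by
    intro Ψ
    simp [hT]
  refine ⟨hinv.toPerm, fun Ψ => ?_⟩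
  have e1 : S.e ⟨(T Ψ).1.1, (T Ψ).left_subset⟩ =
      ((S.e ⟨Ψ.1.1, Ψ.left_subset⟩).1, (S.e ⟨Ψ.1.2, Ψ.right_subset⟩).2) := by simp [hT]
  have e2 : S.e ⟨(T Ψ).1.2, (T Ψ).right_subset⟩ =
      ((S.e ⟨Ψ.1.2, Ψ.right_subset⟩).1, (S.e ⟨Ψ.1.1, Ψ.left_subset⟩).2) := by simp [hT]
  change IsSwap χ β ℓb B₁ B₂ Ψ.1 (T Ψ).1
  refine ⟨?_, fun u γ hγ => ?_, fun u γ hγ => ?_⟩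
  · unfold pairW
    rw [nuW_eq_mul hχ S ⟨Ψ.1.1, Ψ.left_subset⟩, nuW_eq_mul hχ S ⟨Ψ.1.2, Ψ.right_subset⟩,
      nuW_eq_mul hχ S ⟨(T Ψ).1.1, (T Ψ).left_subset⟩,
      nuW_eq_mul hχ S ⟨(T Ψ).1.2, (T Ψ).right_subset⟩, e1, e2]
    ring
  · have a := S.loop_left ⟨Ψ.1.1, Ψ.left_subset⟩ B₁ hB₁ h1 u γ hγ
    have b := S.loop_left ⟨(T Ψ).1.1, (T Ψ).left_subset⟩ B₁ hB₁ h1 u γ hγ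
    rw [e1] at b
    exact a.trans b.symm
  · have a := S.loop_right ⟨Ψ.1.2, Ψ.right_subset⟩ B₂ hB₂ h2 u γ hγ
    have b := S.loop_right ⟨(T Ψ).1.1, (T Ψ).left_subset⟩ B₂ hB₂ h2 u γ hγ
    rw [e1] at b
    exact a.trans b.symm

end Swappable

section Tangled

variable {Λ : Box} {x₀ : VSite Λ} {G : Type*} [Group G] {χ : G → ℂ} {β : ℝ}
  {ℓb : ∀ x : VSite Λ, (latticeGraph Λ).Walk x₀ x} {A Q P₀ P : Set (Plaq Λ)} {B₁ B₂ : Rect Λ}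

/-- A good box contains the plaquettes of `A`, off its shell, and none of those of `Q`. -/
def BoxSep (G : Type*) [Group G] (A Q : Set (Plaq Λ)) : Prop :=
  ∃ lo hi : Site, GoodBox G Λ lo hi ∧
    (∀ p ∈ A, PlaqInBox lo hi p ∧ ¬ PlaqInShell lo hi p) ∧ ∀ p ∈ Q, ¬ PlaqInBox lo hi p

/-- A good box separates `A` from `Q`. -/
def Sep (G : Type*) [Group G] (A Q : Set (Plaq Λ)) : Prop := BoxSep G A Q ∨ BoxSep G Q A

lemma Sep.symm (h : Sep G A Q) : Sep G Q A := Or.symm h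

lemma BoxSep.mono {A' Q' : Set (Plaq Λ)} (h : BoxSep G A Q) (hA : A' ⊆ A) (hQ : Q' ⊆ Q) :
    BoxSep G A' Q' := by
  obtain ⟨lo, hi, h1, h2, h3⟩ := h
  exact ⟨lo, hi, h1, fun p hp => h2 p (hA hp), fun p hp => h3 p (hQ hp)⟩

lemma Sep.mono {A' Q' : Set (Plaq Λ)} (h : Sep G A Q) (hA : A' ⊆ A) (hQ : Q' ⊆ Q) :
    Sep G A' Q' :=
  h.imp (fun h => h.mono hA hQ) fun h => h.mono hQ hA

lemma BoxSep.disjoint (h : BoxSep G A Q) : Disjoint A Q := by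
  obtain ⟨lo, hi, -, h2, h3⟩ := h
  exact Set.disjoint_left.2 fun p hp hq => h3 p hq (h2 p hp).1

lemma Sep.disjoint (h : Sep G A Q) : Disjoint A Q := h.elim (·.disjoint) fun h => h.disjoint.symm

lemma BoxSep.splitting (h : BoxSep G A Q) (ℓb : ∀ x : VSite Λ, (latticeGraph Λ).Walk x₀ x) :
    Nonempty (Splitting G ℓb A Q) := by
  obtain ⟨lo, hi, h1, h2, h3⟩ := h
  exact nonempty_splitting_of_goodBox h1 ℓb h2 h3

lemma Sep.splitting (h : Sep G A Q) (ℓb : ∀ x : VSite Λ, (latticeGraph Λ).Walk x₀ x) :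
    Nonempty (Splitting G ℓb A Q) :=
  h.elim (·.splitting ℓb) fun h => (h.splitting ℓb).map Splitting.swap

/-- The total weight of the pairs with joint support `P`. -/
def pairM (G : Type*) [Group G] (χ : G → ℂ) (β : ℝ)
    (ℓb : ∀ x : VSite Λ, (latticeGraph Λ).Walk x₀ x) (P₀ P : Set (Plaq Λ)) : ℝ :=
  ∑ᶠ Ψ : PairSupp G ℓb P₀ P, pairW χ β ℓb Ψ.1

lemma nuW_nonneg (ψ : Hom Λ x₀ G) : 0 ≤ nuW Λ x₀ χ β ℓb ψ :=
  finprod_nonneg fun _ => (Real.exp_pos _).le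

lemma pairW_nonneg (Ψ : Hom Λ x₀ G × Hom Λ x₀ G) : 0 ≤ pairW χ β ℓb Ψ :=
  mul_nonneg (nuW_nonneg _) (nuW_nonneg _)

lemma pairM_nonneg : 0 ≤ pairM G χ β ℓb P₀ P := finsum_nonneg fun _ => pairW_nonneg _

lemma pairM_union [Finite G] (hχ : ∀ a b : G, IsConj a b → χ a = χ b) (h : Sep G A Q)
    (h0 : P₀ ⊆ A) :
    pairM G χ β ℓb P₀ (A ∪ Q) = pairM G χ β ℓb P₀ A * pairM G χ β ℓb ∅ Q := by
  obtain ⟨S⟩ := h.splitting ℓb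
  have := finite_hom (G := G) ℓb
  let _ := Fintype.ofFinite (PairSupp G ℓb P₀ (A ∪ Q))
  let _ := Fintype.ofFinite (PairSupp G ℓb P₀ A)
  let _ := Fintype.ofFinite (PairSupp G ℓb ∅ Q)
  unfold pairM
  rw [finsum_eq_sum_of_fintype, finsum_eq_sum_of_fintype, finsum_eq_sum_of_fintype,
    Fintype.sum_mul_sum, ← Fintype.sum_prod_type']
  exact Fintype.sum_equiv (S.pairEquiv h.disjoint h0) _ _ fun Ψ => S.pairW_eq hχ h.disjoint h0 Ψ

lemma one_le_pairM_empty [Finite G] : 1 ≤ pairM G χ β ℓb ∅ ∅ := by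
  have := finite_hom (G := G) ℓb
  have hp : ∀ p, evalP (psi Λ x₀ (1 : EdgeConf Λ G)) ℓb p = 1 := fun p =>
    (isConj_eq_one_iff (isConj_evalP_psi (x₀ := x₀) 1 ℓb p)).2 (hol_one _)
  have h1 : nuW Λ x₀ χ β ℓb (psi Λ x₀ (1 : EdgeConf Λ G)) = 1 := by
    unfold nuW
    simp only [hp, phiB_one, finprod_one]
  have h2 : hsupp (psi Λ x₀ (1 : EdgeConf Λ G)) ℓb = ∅ := by
    ext p; simp [hsupp, hp]
  have h3 := single_le_finsum (f := fun Ψ : PairSupp G ℓb ∅ ∅ => pairW χ β ℓb Ψ.1)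
    ⟨(psi Λ x₀ 1, psi Λ x₀ 1), by simp [supp2, h2]⟩ (Set.toFinite _) fun _ => pairW_nonneg _
  refine le_trans ?_ h3
  simp [pairW, h1]

/-- A joint support which can neither be swapped nor be separated from `P₀`. -/
def Tangled (χ : G → ℂ) (β : ℝ) (ℓb : ∀ x : VSite Λ, (latticeGraph Λ).Walk x₀ x)
    (B₁ B₂ : Rect Λ) (P₀ K : Set (Plaq Λ)) : Prop :=
  ¬ Swappable χ β ℓb B₁ B₂ P₀ K ∧
    ∀ A Q : Set (Plaq Λ), A ∪ Q = K → Q.Nonempty → P₀ ⊆ A → ¬ Sep G A Q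

lemma exists_tangled [Finite G] (hχ : ∀ a b : G, IsConj a b → χ a = χ b)
    (hB₁ : (S2 B₁).Nonempty) (hB₂ : (S2 B₂).Nonempty)
    (h1 : S2 B₁ ⊆ P₀) (h2 : S2 B₂ ⊆ P₀) (hP : P₀ ⊆ P)
    (hs : ¬ Swappable χ β ℓb B₁ B₂ P₀ P) :
    ∃ K, Tangled χ β ℓb B₁ B₂ P₀ K ∧ P₀ ⊆ K ∧ K ⊆ P ∧
      pairM G χ β ℓb P₀ P ≤ pairM G χ β ℓb P₀ K * pairM G χ β ℓb ∅ (P \ K) := by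
  induction hn : P.ncard using Nat.strong_induction_on generalizing P with
  | _ n ih =>
    by_cases hT : Tangled χ β ℓb B₁ B₂ P₀ P
    · refine ⟨P, hT, hP, le_rfl, ?_⟩
      rw [Set.sdiff_self]
      exact le_mul_of_one_le_right pairM_nonneg one_le_pairM_empty
    · simp only [Tangled, not_and, not_forall, not_not] at hT
      obtain ⟨A, Q, rfl, hQ, hPA, hsep⟩ := hT hs
      have hlt : A.ncard < n := by
        rw [← hn, Set.ncard_union_eq hsep.disjoint]
        have := (Set.ncard_pos (Set.toFinite Q)).2 hQ
        omega
      have hsA : ¬ Swappable χ β ℓb B₁ B₂ P₀ A := fun h => by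
        obtain ⟨S⟩ := hsep.splitting ℓb
        exact hs (h.union hχ S hsep.disjoint hPA hB₁ hB₂ h1 h2)
      obtain ⟨K, k1, k2, k3, k4⟩ := ih _ hlt hPA hsA rfl
      refine ⟨K, k1, k2, k3.trans Set.subset_union_left, ?_⟩
      have e : (A ∪ Q) \ K = A \ K ∪ Q := by
        rw [Set.union_sdiff_distrib]
        congr 1
        exact (Set.disjoint_of_subset_left k3 hsep.disjoint).symm.sdiff_eq_left
      rw [e, pairM_union hχ hsep hPA,
        pairM_union hχ (hsep.mono Set.sdiff_subset le_rfl) (Set.empty_subset _), ← mul_assoc]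
      exact mul_le_mul_of_nonneg_right k4 pairM_nonneg

lemma pairM_eq_sum [Fintype (Hom Λ x₀ G)] (P₀ P : Set (Plaq Λ)) :
    pairM G χ β ℓb P₀ P =
      ∑ Ψ : Hom Λ x₀ G × Hom Λ x₀ G with supp2 Λ x₀ ℓb P₀ Ψ.1 Ψ.2 = P, pairW χ β ℓb Ψ := by
  unfold pairM
  rw [finsum_eq_sum_of_fintype]
  exact (Finset.sum_subtype _ (fun Ψ => by simp) _).symm

lemma nuZ_pos [Finite G] : 0 < nuZ Λ x₀ G χ β ℓb := by
  have := finite_hom (G := G) ℓb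
  refine finsum_pos (fun _ => nuW_nonneg _) ⟨psi Λ x₀ 1, ?_⟩ (Set.toFinite _)
  let _ := Fintype.ofFinite (Plaq Λ)
  unfold nuW
  rw [finprod_eq_prod_of_fintype]
  exact Finset.prod_pos fun _ _ => Real.exp_pos _

lemma sum_pairW [Fintype (Hom Λ x₀ G)] :
    ∑ Ψ : Hom Λ x₀ G × Hom Λ x₀ G, pairW χ β ℓb Ψ = nuZ Λ x₀ G χ β ℓb ^ 2 := by
  unfold nuZ pairW
  rw [finsum_eq_sum_of_fintype, sq, Fintype.sum_mul_sum, Fintype.sum_prod_type]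

lemma nuP2_eq [Fintype (Hom Λ x₀ G)] (S : Set (Hom Λ x₀ G × Hom Λ x₀ G)) :
    nuP2 Λ x₀ χ β ℓb S =
      (∑ Ψ : Hom Λ x₀ G × Hom Λ x₀ G with Ψ ∈ S, pairW χ β ℓb Ψ) / nuZ Λ x₀ G χ β ℓb ^ 2 := by
  unfold nuP2 nuP pairW
  rw [Finset.sum_div, finsum_mem_eq_finite_toFinset_sum _ (Set.toFinite _)]
  refine Finset.sum_congr (by ext; simp) fun Ψ _ => ?_
  rw [div_mul_div_comm, sq]

lemma nuP2_le_one [Finite G] (S : Set (Hom Λ x₀ G × Hom Λ x₀ G)) :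
    nuP2 Λ x₀ χ β ℓb S ≤ 1 := by
  have := finite_hom (G := G) ℓb
  let _ := Fintype.ofFinite (Hom Λ x₀ G)
  rw [nuP2_eq, div_le_one (pow_pos nuZ_pos 2), ← sum_pairW]
  exact Finset.sum_le_sum_of_subset_of_nonneg (Finset.filter_subset _ _)
    fun _ _ _ => pairW_nonneg _

lemma nuP2_not_swappable_le [Finite G] (hχ : ∀ a b : G, IsConj a b → χ a = χ b)
    (hB₁ : (S2 B₁).Nonempty) (hB₂ : (S2 B₂).Nonempty)
    (h1 : S2 B₁ ⊆ P₀) (h2 : S2 B₂ ⊆ P₀) [Fintype (Set (Plaq Λ))] :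
    nuP2 Λ x₀ χ β ℓb
        {Ψ | Swappable χ β ℓb B₁ B₂ P₀ (supp2 Λ x₀ ℓb P₀ Ψ.1 Ψ.2)}ᶜ ≤
      ∑ K : Set (Plaq Λ) with P₀ ⊆ K ∧ Tangled χ β ℓb B₁ B₂ P₀ K, pairM G χ β ℓb P₀ K := by
  have := finite_hom (G := G) ℓb
  let _ := Fintype.ofFinite (Hom Λ x₀ G)
  obtain ⟨S, hS⟩ : ∃ S, {Ψ : Hom Λ x₀ G × Hom Λ x₀ G |
    Swappable χ β ℓb B₁ B₂ P₀ (supp2 Λ x₀ ℓb P₀ Ψ.1 Ψ.2)}ᶜ = S := ⟨_, rfl⟩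
  rw [hS, nuP2_eq, div_le_iff₀ (pow_pos nuZ_pos 2)]
  set N : Finset (Set (Plaq Λ)) :=
    Finset.univ.filter fun P => P₀ ⊆ P ∧ ¬ Swappable χ β ℓb B₁ B₂ P₀ P
  set T : Finset (Set (Plaq Λ)) :=
    Finset.univ.filter fun K => P₀ ⊆ K ∧ Tangled χ β ℓb B₁ B₂ P₀ K
  have ex : ∀ P, ∃ K, P ∈ N → K ∈ T ∧ K ⊆ P ∧
      pairM G χ β ℓb P₀ P ≤ pairM G χ β ℓb P₀ K * pairM G χ β ℓb ∅ (P \ K) := by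
    intro P
    by_cases hP : P ∈ N
    · obtain ⟨hP1, hP2⟩ := (Finset.mem_filter.1 hP).2
      obtain ⟨K, k1, k2, k3, k4⟩ := exists_tangled hχ hB₁ hB₂ h1 h2 hP1 hP2
      exact ⟨K, fun _ => ⟨Finset.mem_filter.2 ⟨Finset.mem_univ _, k2, k1⟩, k3, k4⟩⟩
    · exact ⟨∅, fun h => absurd h hP⟩
  choose κ hκ using ex
  calc _ = ∑ P ∈ N, pairM G χ β ℓb P₀ P := by
        rw [← Finset.sum_fiberwise_of_maps_to (t := N)
          (g := fun Ψ => supp2 Λ x₀ ℓb P₀ Ψ.1 Ψ.2)]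
        · refine Finset.sum_congr rfl fun P hP => ?_
          rw [pairM_eq_sum, Finset.filter_filter]
          refine Finset.sum_congr (Finset.filter_congr fun Ψ _ => ?_) fun _ _ => rfl
          rw [← hS, Set.mem_compl_iff, Set.mem_ofPred_eq, and_iff_right_iff_imp]
          rintro rfl
          exact (Finset.mem_filter.1 hP).2.2
        · intro Ψ hΨ
          have h := (Finset.mem_filter.1 hΨ).2
          rw [← hS] at h
          exact Finset.mem_filter.2 ⟨Finset.mem_univ _, Set.subset_union_right, h⟩
    _ ≤ ∑ P ∈ N, pairM G χ β ℓb P₀ (κ P) * pairM G χ β ℓb ∅ (P \ κ P) :=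
        Finset.sum_le_sum fun P hP => (hκ P hP).2.2
    _ = ∑ K ∈ T, ∑ P ∈ N with κ P = K, pairM G χ β ℓb P₀ (κ P) * pairM G χ β ℓb ∅ (P \ κ P) :=
        (Finset.sum_fiberwise_of_maps_to (fun P hP => (hκ P hP).1) _).symm
    _ ≤ ∑ K ∈ T, pairM G χ β ℓb P₀ K * nuZ Λ x₀ G χ β ℓb ^ 2 := by
        refine Finset.sum_le_sum fun K _ => ?_
        calc ∑ P ∈ N with κ P = K, pairM G χ β ℓb P₀ (κ P) * pairM G χ β ℓb ∅ (P \ κ P)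
            = ∑ P ∈ N with κ P = K, pairM G χ β ℓb P₀ K * pairM G χ β ℓb ∅ (P \ K) := by
              refine Finset.sum_congr rfl fun P hP => ?_
              rw [(Finset.mem_filter.1 hP).2]
          _ = pairM G χ β ℓb P₀ K * ∑ P ∈ N with κ P = K, pairM G χ β ℓb ∅ (P \ K) :=
              (Finset.mul_sum _ _ _).symm
          _ ≤ pairM G χ β ℓb P₀ K * nuZ Λ x₀ G χ β ℓb ^ 2 := by
              refine mul_le_mul_of_nonneg_left ?_ pairM_nonneg
              have hinj :
                  Set.InjOn (fun P : Set (Plaq Λ) => P \ K) ↑(N.filter fun P => κ P = K) := by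
                intro P hP P' hP' h
                obtain ⟨a1, a2⟩ := Finset.mem_filter.1 hP
                obtain ⟨b1, b2⟩ := Finset.mem_filter.1 hP'
                have a3 : K ⊆ P := a2 ▸ (hκ P a1).2.1
                have b3 : K ⊆ P' := b2 ▸ (hκ P' b1).2.1
                rw [← Set.sdiff_union_of_subset a3, ← Set.sdiff_union_of_subset b3]
                exact congrArg (· ∪ K) h
              rw [← Finset.sum_image (f := fun Q => pairM G χ β ℓb ∅ Q) hinj, ← sum_pairW]
              calc _ ≤ ∑ Q : Set (Plaq Λ), pairM G χ β ℓb ∅ Q :=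
                    Finset.sum_le_sum_of_subset_of_nonneg (Finset.subset_univ _)
                      fun _ _ _ => pairM_nonneg
                _ = _ := by
                    simp only [pairM_eq_sum]
                    exact Finset.sum_fiberwise _ _ _
    _ = _ := (Finset.sum_mul _ _ _).symm

lemma pairM_le [Finite G] {Δ : ℝ} (hβ : 0 ≤ β) (h0 : ∀ g : G, 0 ≤ (χ 1 - χ g).re)
    (hΔ : ∀ g : G, g ≠ 1 → Δ ≤ (χ 1 - χ g).re) :
    pairM G χ β ℓb P₀ P ≤
      ((Nat.card G : ℝ) ^ 2) ^ P.ncard * Real.exp (-(β * Δ)) ^ (P \ P₀).ncard := by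
  have := finite_hom (G := G) ℓb
  let _ := Fintype.ofFinite (PairSupp G ℓb P₀ P)
  have hφ1 : ∀ g : G, phiB χ β g ≤ 1 := fun g =>
    Real.exp_le_one_iff.2 (neg_nonpos.2 (mul_nonneg hβ (h0 g)))
  have hφ0 : ∀ g : G, 0 ≤ phiB χ β g := fun g => (Real.exp_pos _).le
  have hφΔ : ∀ g : G, g ≠ 1 → phiB χ β g ≤ Real.exp (-(β * Δ)) := fun g hg =>
    Real.exp_le_exp.2 (neg_le_neg (mul_le_mul_of_nonneg_left (hΔ g hg) hβ))
  have hW : ∀ Ψ : PairSupp G ℓb P₀ P,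
      pairW χ β ℓb Ψ.1 ≤ Real.exp (-(β * Δ)) ^ (P \ P₀).ncard := by
    intro Ψ
    let _ := Fintype.ofFinite (Plaq Λ)
    have e : Real.exp (-(β * Δ)) ^ (P \ P₀).ncard =
        ∏ p : Plaq Λ, if p ∈ P \ P₀ then Real.exp (-(β * Δ)) else 1 := by
      rw [Finset.prod_ite, Finset.prod_const_one, mul_one, Finset.prod_const,
        Set.ncard_eq_toFinset_card']
      congr 2
      ext p; simp
    unfold pairW nuW
    rw [e, finprod_eq_prod_of_fintype, finprod_eq_prod_of_fintype, ← Finset.prod_mul_distrib]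
    refine Finset.prod_le_prod (fun p _ => mul_nonneg (hφ0 _) (hφ0 _)) fun p _ => ?_
    split_ifs with hp
    · have h : p ∈ supp2 Λ x₀ ℓb P₀ Ψ.1.1 Ψ.1.2 := by rw [Ψ.2]; exact hp.1
      rcases h.resolve_right hp.2 with h | h
      · exact (mul_le_of_le_one_right (hφ0 _) (hφ1 _)).trans (hφΔ _ h)
      · exact (mul_le_of_le_one_left (hφ0 _) (hφ1 _)).trans (hφΔ _ h)
    · exact mul_le_one₀ (hφ1 _) (hφ0 _) (hφ1 _)
  have hcard : (Fintype.card (PairSupp G ℓb P₀ P) : ℝ) ≤ ((Nat.card G : ℝ) ^ 2) ^ P.ncard := by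
    have h1 : Nat.card (PairSupp G ℓb P₀ P) ≤
        Nat.card ({ψ : Hom Λ x₀ G // hsupp ψ ℓb ⊆ P} × {ψ : Hom Λ x₀ G // hsupp ψ ℓb ⊆ P}) := by
      refine Nat.card_le_card_of_injective
        (fun Ψ => (⟨Ψ.1.1, Ψ.left_subset⟩, ⟨Ψ.1.2, Ψ.right_subset⟩)) fun Ψ Φ h => ?_
      simp only [Prod.mk.injEq, Subtype.mk.injEq] at h
      exact Subtype.ext (Prod.ext h.1 h.2)
    have h2 := card_hsupp_le (G := G) ℓb P
    rw [Nat.card_coe_set_eq] at h2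
    rw [Nat.card_prod, Nat.card_eq_fintype_card] at h1
    rw [← pow_mul, mul_comm 2, pow_mul, sq]
    exact_mod_cast h1.trans (Nat.mul_le_mul h2 h2)
  unfold pairM
  rw [finsum_eq_sum_of_fintype]
  calc _ ≤ ∑ _Ψ : PairSupp G ℓb P₀ P, Real.exp (-(β * Δ)) ^ (P \ P₀).ncard :=
        Finset.sum_le_sum fun Ψ _ => hW Ψ
    _ = Fintype.card (PairSupp G ℓb P₀ P) * Real.exp (-(β * Δ)) ^ (P \ P₀).ncard := by
        rw [Finset.sum_const, nsmul_eq_mul, Finset.card_univ]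
    _ ≤ _ := mul_le_mul_of_nonneg_right hcard (pow_nonneg (Real.exp_pos _).le _)

end Tangled

section JoinTree

variable {α : Type*} [DecidableEq α] {w : α → α → ℝ} {K K' : Finset α} {p q r : α}
  {v v' W : ℝ}

/-- The total weight of the joining trees with `n` joins, root `p` and vertex set `K`. -/
def treeSum [Fintype α] (w : α → α → ℝ) : ℕ → α → Finset α → ℝ
  | 0, p, K => if K = {p} then 1 else 0
  | n + 1, p, K => ∑ i : Fin (n + 1), ∑ q, w p q *
      ∑ X : Finset α × Finset α with X.1 ∪ X.2 = K, treeSum w i p X.1 * treeSum w (n - i) q X.2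

lemma treeSum_nonneg [Fintype α] (hw : ∀ p q, 0 ≤ w p q) (n : ℕ) (p : α) (K : Finset α) :
    0 ≤ treeSum w n p K := by
  induction n using Nat.strong_induction_on generalizing p K with
  | _ n ih =>
    cases n with
    | zero =>
      rw [treeSum]
      split_ifs <;> norm_num
    | succ n =>
      rw [treeSum]
      exact Finset.sum_nonneg fun i _ => Finset.sum_nonneg fun q _ =>
        mul_nonneg (hw _ _) (Finset.sum_nonneg fun X _ =>
          mul_nonneg (ih _ i.2 _ _) (ih _ (by omega) _ _))

lemma sum_treeSum_le [Fintype α] (hw : ∀ p q, 0 ≤ w p q) (hW : ∀ p, ∑ q, w p q ≤ W)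
    (n : ℕ) (p : α) :
    ∑ K, treeSum w n p K ≤ W ^ n * catalan n := by
  induction n using Nat.strong_induction_on generalizing p with
  | _ n ih =>
    cases n with
    | zero => simp [treeSum]
    | succ n =>
      have h0 : 0 ≤ W := (Finset.sum_nonneg fun q _ => hw p q).trans (hW p)
      have e : ∑ K, treeSum w (n + 1) p K = ∑ i : Fin (n + 1), ∑ q, w p q *
          ((∑ K, treeSum w i p K) * ∑ K, treeSum w (n - i) q K) := by
        simp only [treeSum]
        rw [Finset.sum_comm]
        refine Finset.sum_congr rfl fun i _ => ?_
        rw [Finset.sum_comm]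
        refine Finset.sum_congr rfl fun q _ => ?_
        rw [← Finset.mul_sum, Finset.sum_fiberwise, Fintype.sum_mul_sum, Fintype.sum_prod_type]
      rw [e, catalan_succ, Nat.cast_sum, Finset.mul_sum]
      refine Finset.sum_le_sum fun i _ => ?_
      have hi : (i : ℕ) + (n - i) = n := by omega
      calc ∑ q, w p q * ((∑ K, treeSum w i p K) * ∑ K, treeSum w (n - i) q K)
          ≤ ∑ q, w p q * ((W ^ (i : ℕ) * catalan i) * (W ^ (n - i) * catalan (n - i))) := by
            refine Finset.sum_le_sum fun q _ => mul_le_mul_of_nonneg_left ?_ (hw _ _)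
            exact mul_le_mul (ih _ i.2 _) (ih _ (by omega) _)
              (Finset.sum_nonneg fun _ _ => treeSum_nonneg hw _ _ _) (by positivity)
        _ = (∑ q, w p q) * (W ^ n * (catalan i * catalan (n - i))) := by
            rw [Finset.sum_mul]
            refine Finset.sum_congr rfl fun q _ => ?_
            rw [show W ^ n = W ^ (i : ℕ) * W ^ (n - i) by rw [← pow_add, hi]]
            ring
        _ ≤ W * (W ^ n * (catalan i * catalan (n - i))) :=
            mul_le_mul_of_nonneg_right (hW p) (by positivity)
        _ = W ^ (n + 1) * ((catalan i * catalan (n - i) : ℕ) : ℝ) := by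
            push_cast
            ring

lemma catalan_le_four_pow (n : ℕ) : catalan n ≤ 4 ^ n := by
  rw [catalan_eq_centralBinom_div]
  exact (Nat.div_le_self _ _).trans (Nat.centralBinom_le_four_pow n)

/-- `v` is the weight of a joining tree with root `p` and vertex set `K`. -/
inductive JoinTree (w : α → α → ℝ) : Finset α → α → ℝ → Prop
  | single (p : α) : JoinTree w {p} p 1
  | join {K K' : Finset α} {p q : α} {v v' : ℝ} (h : JoinTree w K p v)
      (h' : JoinTree w K' q v') (hd : Disjoint K K') :
      JoinTree w (K ∪ K') p (w p q * (v * v'))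

namespace JoinTree

lemma root_mem (h : JoinTree w K p v) : p ∈ K := by
  induction h with
  | single p => exact Finset.mem_singleton_self p
  | join _ _ _ ih _ => exact Finset.mem_union_left _ ih

lemma nonneg (hw : ∀ p q, 0 ≤ w p q) (h : JoinTree w K p v) : 0 ≤ v := by
  induction h with
  | single p => exact zero_le_one
  | join _ _ _ ih ih' => exact mul_nonneg (hw _ _) (mul_nonneg ih ih')

lemma le_treeSum [Fintype α] (hw : ∀ p q, 0 ≤ w p q) (h : JoinTree w K p v) :
    v ≤ treeSum w (K.card - 1) p K := by
  induction h with
  | single p => simp [treeSum]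
  | @join K K' p q v v' h h' hd ih ih' =>
    have h1 := Finset.card_pos.2 ⟨_, h.root_mem⟩
    have h2 := Finset.card_pos.2 ⟨_, h'.root_mem⟩
    have e : (K ∪ K').card - 1 = (K.card + K'.card - 2) + 1 := by
      rw [Finset.card_union_of_disjoint hd]
      omega
    have t0 := treeSum_nonneg hw
    rw [e, treeSum]
    let i : Fin (K.card + K'.card - 2 + 1) := ⟨K.card - 1, by omega⟩
    have hi : K.card + K'.card - 2 - (i : ℕ) = K'.card - 1 := by
      simp only [i]
      omega
    refine le_trans ?_ (Finset.single_le_sum (f := fun i : Fin (K.card + K'.card - 2 + 1) =>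
      ∑ q, w p q * ∑ X : Finset α × Finset α with X.1 ∪ X.2 = K ∪ K',
        treeSum w i p X.1 * treeSum w (K.card + K'.card - 2 - i) q X.2)
      (fun i _ => Finset.sum_nonneg fun q _ => mul_nonneg (hw _ _)
        (Finset.sum_nonneg fun X _ => mul_nonneg (t0 _ _ _) (t0 _ _ _))) (Finset.mem_univ i))
    refine le_trans ?_ (Finset.single_le_sum (f := fun q =>
      w p q * ∑ X : Finset α × Finset α with X.1 ∪ X.2 = K ∪ K',
        treeSum w i p X.1 * treeSum w (K.card + K'.card - 2 - i) q X.2)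
      (fun q _ => mul_nonneg (hw _ _)
        (Finset.sum_nonneg fun X _ => mul_nonneg (t0 _ _ _) (t0 _ _ _))) (Finset.mem_univ q))
    refine mul_le_mul_of_nonneg_left ?_ (hw _ _)
    refine le_trans ?_ (Finset.single_le_sum (f := fun X : Finset α × Finset α =>
        treeSum w i p X.1 * treeSum w (K.card + K'.card - 2 - i) q X.2)
      (fun X _ => mul_nonneg (t0 _ _ _) (t0 _ _ _))
      (Finset.mem_filter.2 ⟨Finset.mem_univ (K, K'), rfl⟩))
    simp only [hi]
    exact mul_le_mul ih ih' (h'.nonneg hw) (t0 _ _ _)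

lemma attach (h : JoinTree w K p v) (hr : r ∈ K) (h' : JoinTree w K' q v')
    (hd : Disjoint K K') : JoinTree w (K ∪ K') p (w r q * (v * v')) := by
  induction h with
  | single p =>
    rw [Finset.mem_singleton.1 hr]
    exact (single p).join h' hd
  | @join L L' a b u u' hL hL' hLd ih ih' =>
    rw [Finset.disjoint_union_left] at hd
    rcases Finset.mem_union.1 hr with hr | hr
    · have := (ih hr hd.1).join hL' (Finset.disjoint_union_left.2 ⟨hLd, hd.2.symm⟩)
      rw [Finset.union_right_comm] at this
      convert this using 1
      ring
    · have := hL.join (ih' hr hd.2) (Finset.disjoint_union_right.2 ⟨hLd, hd.1⟩)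
      rw [← Finset.union_assoc] at this
      convert this using 1
      ring

end JoinTree

/-- Every element of `K` is the root of a joining tree on `K` of weight at least `v`. -/
def TreeBound (w : α → α → ℝ) (K : Finset α) (v : ℝ) : Prop :=
  ∀ p ∈ K, ∃ v' ≥ v, JoinTree w K p v'

lemma TreeBound.union (hw : ∀ p q, 0 ≤ w p q) (hs : ∀ p q, w p q = w q p) (hv : 0 ≤ v)
    (hv' : 0 ≤ v') (h : TreeBound w K v) (h' : TreeBound w K' v') (hd : Disjoint K K')
    (hr : r ∈ K) (hq : q ∈ K') : TreeBound w (K ∪ K') (w r q * (v * v')) := by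
  have key : ∀ {K K' : Finset α} {r q : α} {v v' : ℝ}, 0 ≤ v → 0 ≤ v' → TreeBound w K v →
      TreeBound w K' v' → Disjoint K K' → r ∈ K → q ∈ K' → ∀ p ∈ K,
      ∃ x ≥ w r q * (v * v'), JoinTree w (K ∪ K') p x := by
    intro K K' r q v v' hv hv' h h' hd hr hq p hp
    obtain ⟨x, hx, hx'⟩ := h p hp
    obtain ⟨y, hy, hy'⟩ := h' q hq
    exact ⟨_, mul_le_mul_of_nonneg_left (mul_le_mul hx hy hv' (hv.trans hx)) (hw _ _),
      hx'.attach hr hy' hd⟩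
  intro p hp
  rcases Finset.mem_union.1 hp with hp | hp
  · exact key hv hv' h h' hd hr hq p hp
  · rw [Finset.union_comm, hs, mul_comm v]
    exact key hv' hv h' h hd.symm hq hr p hp

/-- A property of finite sets that holds for singletons, and that passes from a set `A` to its
union with some larger set meeting it at a point it selects, holds for all nonempty sets. -/
lemma merge_induction {Good : Finset α → Prop} (hK : K.Nonempty) (h1 : ∀ p ∈ K, Good {p})
    (hm : ∀ A ⊆ K, A.Nonempty → A ≠ K → Good A → ∃ q ∈ K \ A, ∀ A' ⊆ K, q ∈ A' →
      Disjoint A A' → A.card ≤ A'.card → Good A' → Good (A ∪ A')) : Good K := by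
  suffices H : ∀ n : ℕ, ∀ c : α → α, (∀ l ∈ K.image c, Good (K.filter fun x => c x = l)) →
      (K.image c).card = n → Good K by
    refine H _ id (fun l hl => ?_) rfl
    rw [Finset.image_id] at hl
    have : K.filter (fun x => id x = l) = {l} := by
      ext x
      simp only [id_eq, Finset.mem_filter, Finset.mem_singleton, and_iff_right_iff_imp]
      rintro rfl
      exact hl
    rw [this]
    exact h1 l hl
  intro n
  induction n using Nat.strong_induction_on with
  | _ n ih =>
    intro c hc hn
    obtain ⟨l, hl, hmin⟩ := Finset.exists_min_image (K.image c)
      (fun l => (K.filter fun x => c x = l).card) (hK.image c)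
    by_cases hA : (K.filter fun x => c x = l) = K
    · rw [← hA]
      exact hc l hl
    have hne : (K.filter fun x => c x = l).Nonempty := by
      obtain ⟨x, hx, rfl⟩ := Finset.mem_image.1 hl
      exact ⟨x, Finset.mem_filter.2 ⟨hx, rfl⟩⟩
    obtain ⟨q, hq, H⟩ := hm _ (Finset.filter_subset _ _) hne hA (hc l hl)
    rw [Finset.mem_sdiff, Finset.mem_filter, not_and] at hq
    obtain ⟨hqK, hql⟩ := hq
    have hql := hql hqK
    have hqi := Finset.mem_image_of_mem c hqK
    have hgood := H (K.filter fun x => c x = c q) (Finset.filter_subset _ _)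
      (Finset.mem_filter.2 ⟨hqK, rfl⟩)
      (Finset.disjoint_filter.2 fun x _ h h' => hql (h'.symm.trans h)) (hmin _ hqi) (hc _ hqi)
    have himg : ∀ m ∈ K.image (fun x => if c x = l then c q else c x), m ∈ K.image c ∧ m ≠ l := by
      intro m hm
      obtain ⟨x, hx, rfl⟩ := Finset.mem_image.1 hm
      split_ifs with h
      · exact ⟨hqi, hql⟩
      · exact ⟨Finset.mem_image_of_mem c hx, h⟩
    refine ih _ ?_ (fun x => if c x = l then c q else c x) (fun m hm => ?_) rfl
    · rw [← hn]
      refine Finset.card_lt_card (Finset.ssubset_iff_subset_ne.2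
        ⟨fun m hm => (himg m hm).1, fun h => ?_⟩)
      exact (himg l (h ▸ hl)).2 rfl
    · obtain ⟨hm1, hm2⟩ := himg m hm
      by_cases hmq : m = c q
      · convert hgood using 1
        ext x
        simp only [Finset.mem_filter, Finset.mem_union, hmq]
        split_ifs with h <;> simp +contextual [h]
      · convert hc m hm1 using 1
        ext x
        simp only [Finset.mem_filter]
        split_ifs with h
        · simp [h, Ne.symm hm2, Ne.symm hmq]
        · rfl

end JoinTree

section Near

variable {Λ : Box} {x₀ : VSite Λ} {G : Type*} [Group G] {χ : G → ℂ} {β : ℝ}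
  {ℓb : ∀ x : VSite Λ, (latticeGraph Λ).Walk x₀ x} {A K : Set (Plaq Λ)} {B B₁ B₂ : Rect Λ}
  {lo hi : Site} {p q : Plaq Λ} {n : ℤ}

/-- The largest coordinates of the corners of a plaquette. -/
def Plaq.top (p : Plaq Λ) (i : Fin 4) : ℤ :=
  p.1.1 i + if i = p.1.2.1 ∨ i = p.1.2.2 then 1 else 0

lemma Plaq.base_le_top (p : Plaq Λ) (i : Fin 4) : p.1.1 i ≤ p.top i := by
  unfold Plaq.top
  split_ifs <;> omega

lemma Plaq.top_le (p : Plaq Λ) (i : Fin 4) : p.top i ≤ p.1.1 i + 1 := by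
  unfold Plaq.top
  split_ifs <;> omega

lemma Plaq.c2_eq_top (p : Plaq Λ) : (p.c2 : Site) = p.top := by
  funext i
  have h := p.2.1.ne
  simp only [Plaq.c2, Pi.add_apply, unit, Plaq.top]
  by_cases h1 : i = p.1.2.1
  · have h2 : i ≠ p.1.2.2 := h1 ▸ h
    simp [h1, h]
  · by_cases h2 : i = p.1.2.2 <;> simp [h1, h2, h.symm]

lemma plaqInBox_iff : PlaqInBox lo hi p ↔ ∀ i, lo i ≤ p.1.1 i ∧ p.top i ≤ hi i := by
  constructor
  · rintro ⟨h0, -, h2, -⟩ i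
    rw [Plaq.c2_eq_top] at h2
    exact ⟨icc_lo h0 i, icc_hi h2 i⟩
  · intro h
    have key : ∀ x : Site, p.1.1 ≤ x → x ≤ p.top → x ∈ Set.Icc lo hi := fun x h1 h2 =>
      ⟨fun i => (h i).1.trans (h1 i), fun i => (h2 i).trans (h i).2⟩
    have n1 : ∀ i j, 0 ≤ unit i j := unit_apply_nonneg
    have e2 := p.c2_eq_top
    refine ⟨key _ le_rfl p.base_le_top, key _ (fun i => ?_) (e2 ▸ fun i => ?_),
      key _ (e2 ▸ p.base_le_top) e2.le, key _ (fun i => ?_) (e2 ▸ fun i => ?_)⟩ <;>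
    simp only [Plaq.c1, Plaq.c2, Plaq.c3, Pi.add_apply] <;>
    linarith [n1 p.1.2.1 i, n1 p.1.2.2 i]

lemma mem_S2_iff : p ∈ S2 B ↔ ∀ i, B.lo i ≤ p.1.1 i ∧ p.top i ≤ B.hi i := by
  rw [← plaqInBox_iff]
  exact and_congr forall_and (and_congr forall_and (and_congr forall_and forall_and))

lemma Plaq.a_le (p : Plaq Λ) (i : Fin 4) : Λ.a i ≤ p.1.1 i := (p.2.2.1 i).1

lemma Plaq.top_le_b (p : Plaq Λ) (i : Fin 4) : p.top i ≤ Λ.b i := by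
  rw [← p.c2_eq_top]
  exact (p.c2.2 i).2

lemma not_plaqInShell (h : ∀ i, (Λ.a i < lo i → lo i < p.1.1 i) ∧
    (hi i < Λ.b i → p.top i < hi i)) : ¬ PlaqInShell lo hi p := by
  rintro ⟨⟨-, i, ⟨h1, h2⟩ | ⟨h1, h2⟩⟩, -⟩
  · exact absurd ((h i).1 h2) (not_lt.2 h1.le)
  · have := (h i).2 h2
    have h3 := p.base_le_top i
    change p.1.1 i = hi i at h1
    omega

/-- The second plaquette exceeds the first by at most one in every direction. -/
def Near (p q : Plaq Λ) : Prop := ∀ i, p.1.1 i - 1 ≤ q.1.1 i ∧ q.top i ≤ p.top i + 1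

lemma exists_plaq_base (hp : p ∈ S2 B) {x : Site} (h1 : ∀ i, B.lo i ≤ x i)
    (h2 : ∀ i, x i ≤ p.1.1 i) : ∃ q ∈ S2 B, q.1 = (x, p.1.2) := by
  rw [mem_S2_iff] at hp
  have h3 : ∀ i, x i + unit p.1.2.1 i + unit p.1.2.2 i ≤ B.hi i := fun i => by
    have := (hp i).2
    rw [← p.c2_eq_top] at this
    simp only [Plaq.c2, Pi.add_apply] at this
    linarith [h2 i]
  have n1 := unit_apply_nonneg p.1.2.1
  have n2 := unit_apply_nonneg p.1.2.2
  have hm : ∀ y : Site, (∀ i, x i ≤ y i) → (∀ i, y i ≤ x i + unit p.1.2.1 i + unit p.1.2.2 i) →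
      Λ.mem y := fun y h4 h5 i =>
    ⟨(B.a_le_lo i).trans ((h1 i).trans (h4 i)), (h5 i).trans ((h3 i).trans (B.hi_le_b i))⟩
  let q : Plaq Λ := ⟨(x, p.1.2), p.2.1,
    hm _ (fun i => le_rfl) (fun i => by linarith [n1 i, n2 i]),
    hm _ (fun i => by simp only [Pi.add_apply]; linarith [n1 i])
      (fun i => by simp only [Pi.add_apply]; linarith [n2 i]),
    hm _ (fun i => by simp only [Pi.add_apply]; linarith [n1 i, n2 i]) (fun i => le_rfl),
    hm _ (fun i => by simp only [Pi.add_apply]; linarith [n2 i])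
      (fun i => by simp only [Pi.add_apply]; linarith [n1 i])⟩
  refine ⟨q, mem_S2_iff.2 fun i => ⟨h1 i, ?_⟩, rfl⟩
  rw [← q.c2_eq_top]
  exact h3 i

lemma near_of_dirs_eq (h : p.1.2 = q.1.2) (h1 : ∀ i, p.1.1 i - 1 ≤ q.1.1 i)
    (h2 : ∀ i, q.1.1 i ≤ p.1.1 i + 1) : Near p q := by
  refine fun i => ⟨h1 i, ?_⟩
  have := h2 i
  unfold Plaq.top
  rw [h]
  omega

lemma exists_near_of_rect (hp : p ∈ A) (hpB : p ∈ S2 B) (hq : q ∉ A) (hqB : q ∈ S2 B) :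
    ∃ p ∈ A, ∃ q ∈ S2 B, q ∉ A ∧ Near p q := by
  by_contra! hcon
  have hclosed : ∀ p q, q ∈ S2 B → Near p q → p ∈ A → q ∈ A := fun p q hq hn hp => by
    by_contra h
    exact hcon p hp q hq h hn
  have hbase : ∀ m : ℕ, ∀ p ∈ S2 B, (∑ i, (p.1.1 i - B.lo i)) = m →
      ∃ p₀ ∈ S2 B, p₀.1 = (B.lo, p.1.2) ∧ (p ∈ A ↔ p₀ ∈ A) := by
    intro m
    induction m with
    | zero =>
      intro p hp hm
      have h0 := (Finset.sum_eq_zero_iff_of_nonneg fun i _ =>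
        sub_nonneg.2 (mem_S2_iff.1 hp i).1).1 (by exact_mod_cast hm)
      refine ⟨p, hp, Prod.ext (funext fun i => ?_) rfl, Iff.rfl⟩
      exact sub_eq_zero.1 (h0 i (Finset.mem_univ i))
    | succ m ih =>
      intro p hp hm
      obtain ⟨i, -, hi⟩ : ∃ i ∈ Finset.univ, 0 < p.1.1 i - B.lo i := by
        refine Finset.exists_lt_of_sum_lt (f := fun _ => (0 : ℤ)) ?_
        rw [hm]
        simp
      obtain ⟨q, hq, hqe⟩ := exists_plaq_base hp (x := p.1.1 - unit i)
        (fun j => by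
          have := (mem_S2_iff.1 hp j).1
          simp only [Pi.sub_apply, unit]
          split_ifs with h
          · subst h; omega
          · omega)
        (fun j => by
          have := unit_apply_nonneg i j
          simp only [Pi.sub_apply]
          omega)
      have h1 : q.1.1 = p.1.1 - unit i := congrArg Prod.fst hqe
      have h2 : q.1.2 = p.1.2 := by rw [hqe]
      have hu : ∀ j, q.1.1 j ≤ p.1.1 j ∧ p.1.1 j ≤ q.1.1 j + 1 := fun j => by
        rw [h1]
        simp only [Pi.sub_apply, unit]
        split_ifs <;> omega
      obtain ⟨p₀, a, b, c⟩ := ih q hq (by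
        rw [h1]
        have e : ∑ j, unit i j = 1 := by simp [unit]
        simp only [Pi.sub_apply, Finset.sum_sub_distrib, e] at hm ⊢
        push_cast at hm
        linarith)
      refine ⟨p₀, a, by rw [b, h2], Iff.trans ⟨?_, ?_⟩ c⟩
      · exact hclosed p q hq (near_of_dirs_eq h2.symm (fun j => by have := hu j; omega)
          fun j => by have := hu j; omega)
      · exact hclosed q p hp (near_of_dirs_eq h2 (fun j => by have := hu j; omega)
          fun j => by have := hu j; omega)
  have hb : ∀ p ∈ S2 B, ∃ p₀ ∈ S2 B, p₀.1 = (B.lo, p.1.2) ∧ (p ∈ A ↔ p₀ ∈ A) := fun p hp =>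
    hbase (∑ i, (p.1.1 i - B.lo i)).toNat p hp (Int.toNat_of_nonneg
      (Finset.sum_nonneg fun i _ => sub_nonneg.2 (mem_S2_iff.1 hp i).1)).symm
  obtain ⟨p₀, a, b, c⟩ := hb p hpB
  obtain ⟨q₀, a', b', c'⟩ := hb q hqB
  refine hq (c'.2 (hclosed p₀ q₀ a' (fun i => ?_) (c.1 hp)))
  have e1 : p₀.1.1 i = B.lo i := by rw [b]
  have e2 : q₀.1.1 i = B.lo i := by rw [b']
  have h1 := p₀.base_le_top i
  have h2 := q₀.top_le i
  omega

lemma Tangled.divides (hχ : ∀ a b : G, IsConj a b → χ a = χ b)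
    (hB₁ : (S2 B₁).Nonempty) (hB₂ : (S2 B₂).Nonempty)
    (hT : Tangled χ β ℓb B₁ B₂ (S2 B₁ ∪ S2 B₂) K) (hK : S2 B₁ ∪ S2 B₂ ⊆ K)
    (hA : A ⊆ K) (hne : A.Nonempty) (hne' : (K \ A).Nonempty) (hs : Sep G A (K \ A)) :
    ∃ B : Rect Λ, S2 B ⊆ K ∧ ∃ p ∈ A, p ∈ S2 B ∧ ∃ q ∉ A, q ∈ S2 B := by
  by_contra! hcon
  have hd : ∀ B : Rect Λ, S2 B ⊆ K → S2 B ⊆ A ∨ S2 B ⊆ K \ A := fun B hB => by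
    by_cases h : ∃ p ∈ A, p ∈ S2 B
    · obtain ⟨p, h1, h2⟩ := h
      exact Or.inl fun q hq => by_contra fun h => hcon B hB p h1 h2 q h hq
    · push Not at h
      exact Or.inr fun q hq => ⟨hB hq, fun h' => h q h' hq⟩
  have e : A ∪ K \ A = K := Set.union_sdiff_cancel hA
  have e' : K \ A ∪ A = K := Set.sdiff_union_of_subset hA
  rcases hd B₁ (Set.subset_union_left.trans hK) with h1 | h1 <;>
    rcases hd B₂ (Set.subset_union_right.trans hK) with h2 | h2
  · exact hT.2 A (K \ A) e hne' (Set.union_subset h1 h2) hs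
  · obtain ⟨S⟩ := hs.splitting ℓb
    exact hT.1 (e ▸ S.swappable hχ hB₁ hB₂ h1 h2)
  · obtain ⟨S⟩ := hs.symm.splitting ℓb
    exact hT.1 (e' ▸ S.swappable hχ hB₁ hB₂ h1 h2)
  · exact hT.2 (K \ A) A e' hne (Set.union_subset h1 h2) hs.symm

lemma Tangled.exists_near (hχ : ∀ a b : G, IsConj a b → χ a = χ b)
    (hB₁ : (S2 B₁).Nonempty) (hB₂ : (S2 B₂).Nonempty)
    (hT : Tangled χ β ℓb B₁ B₂ (S2 B₁ ∪ S2 B₂) K) (hK : S2 B₁ ∪ S2 B₂ ⊆ K)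
    (hA : A ⊆ K) (hne : A.Nonempty) (hne' : (K \ A).Nonempty)
    (hn : 1 ≤ n) (hspan : ∀ p ∈ A, ∀ q ∈ A, ∀ i, q.top i - p.1.1 i ≤ 2 * n - 1) :
    ∃ p ∈ A, ∃ q ∈ K \ A, (∀ i, 1 + |p.1.1 i - q.1.1 i| ≤ 4 * n) ∧
      ((∀ i, (∃ r ∈ A, r.1.1 i - 1 ≤ q.1.1 i) ∧ ∃ r ∈ A, q.top i ≤ r.top i + 1) ∨
        ∀ i, Λ.b i - Λ.a i ≤ 2 * n + 1) := by
  have hmin : ∀ i, ∃ p ∈ A, ∀ q ∈ A, p.1.1 i ≤ q.1.1 i := fun i =>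
    Set.exists_min_image A (fun p => p.1.1 i) (Set.toFinite A) hne
  have hmax : ∀ i, ∃ p ∈ A, ∀ q ∈ A, q.top i ≤ p.top i := fun i =>
    Set.exists_max_image A (fun p => p.top i) (Set.toFinite A) hne
  choose l hlA hl using hmin
  choose u huA hu using hmax
  obtain ⟨p, hp⟩ := hne
  by_cases hface : ∀ i, Λ.a i < (l i).1.1 i - 1 ∨ (u i).top i + 1 < Λ.b i
  swap
  · push Not at hface
    obtain ⟨i, h1, h2⟩ := hface
    have hN : ∀ j, Λ.b j - Λ.a j ≤ 2 * n + 1 := fun j => by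
      have := Λ.side_eq i j
      have := hspan _ (hlA i) _ (huA i) i
      omega
    obtain ⟨q, hq⟩ := hne'
    refine ⟨p, hp, q, hq, fun j => ?_, Or.inr hN⟩
    have := hN j
    have := p.a_le j
    have := p.base_le_top j
    have := p.top_le_b j
    have := q.a_le j
    have := q.base_le_top j
    have := q.top_le_b j
    have : |p.1.1 j - q.1.1 j| ≤ 2 * n + 1 := abs_le.2 ⟨by omega, by omega⟩
    omega
  set lo : Site := fun i => max ((l i).1.1 i - 1) (Λ.a i) with hlo
  set hi : Site := fun i => min ((u i).top i + 1) (Λ.b i) with hhi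
  have hlu : ∀ i, (l i).1.1 i ≤ (u i).top i := fun i => (hl i _ (huA i)).trans ((u i).base_le_top i)
  have hgood : GoodBox G Λ lo hi := by
    refine goodBox_of_faces G (fun i => le_max_right _ _) (fun i => min_le_right _ _)
      (fun i => ?_) (fun i => ?_) (fun i => ?_)
    · have := hlu i
      have := (l i).a_le i
      have := (u i).top_le_b i
      have := (l i).base_le_top i
      have := (l i).top_le_b i
      have := (u i).a_le i
      have := (u i).base_le_top i
      change lo i ≤ hi i
      simp only [hlo, hhi]
      omega
    · have := hface i
      simp only [hlo, hhi]
      omega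
    · have := hlu i
      simp only [hlo, hhi]
      omega
  have hAin : ∀ p ∈ A, PlaqInBox lo hi p ∧ ¬ PlaqInShell lo hi p := by
    intro p hp
    refine ⟨plaqInBox_iff.2 fun i => ?_, not_plaqInShell fun i => ?_⟩
    · have := hl i p hp
      have := hu i p hp
      have := p.a_le i
      have := p.top_le_b i
      simp only [hlo, hhi]
      omega
    · have := hl i p hp
      have := hu i p hp
      simp only [hlo, hhi]
      omega
  by_cases hq : ∃ q ∈ K \ A, PlaqInBox lo hi q
  · obtain ⟨q, hq, hqb⟩ := hq
    rw [plaqInBox_iff] at hqb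
    refine ⟨p, hp, q, hq, fun i => ?_, Or.inl fun i => ⟨⟨_, hlA i, ?_⟩, _, huA i, ?_⟩⟩
    · have h1 := hqb i
      simp only [hlo, hhi] at h1
      have := q.base_le_top i
      have := p.base_le_top i
      have := hspan _ (hlA i) _ (huA i) i
      have := hl i p hp
      have := hu i p hp
      have : |p.1.1 i - q.1.1 i| ≤ 2 * n := abs_le.2 ⟨by omega, by omega⟩
      omega
    · have h1 := hqb i
      simp only [hlo, hhi] at h1
      omega
    · have h1 := hqb i
      simp only [hlo, hhi] at h1
      omega
  · push Not at hq
    obtain ⟨B, hB, p, hp, hpB, q, hq, hqB⟩ := hT.divides hχ hB₁ hB₂ hK hA ⟨p, hp⟩ hne'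
      (Or.inl ⟨lo, hi, hgood, hAin, hq⟩)
    obtain ⟨p, hp, q, hqB, hq, hpq⟩ := exists_near_of_rect hp hpB hq hqB
    refine ⟨p, hp, q, ⟨hB hqB, hq⟩, fun i => ?_, Or.inl fun i =>
      ⟨⟨p, hp, (hpq i).1⟩, p, hp, (hpq i).2⟩⟩
    have := hpq i
    have := p.top_le i
    have := q.base_le_top i
    have : |p.1.1 i - q.1.1 i| ≤ 2 := abs_le.2 ⟨by omega, by omega⟩
    omega

end Near

section Kernel

variable {Λ : Box} {x₀ : VSite Λ} {G : Type*} [Group G] {χ : G → ℂ} {β : ℝ}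
  {ℓb : ∀ x : VSite Λ, (latticeGraph Λ).Walk x₀ x} {K : Set (Plaq Λ)} {B₁ B₂ : Rect Λ}
  {p q : Plaq Λ}

lemma sum_Icc_inv_sq_le (x : ℤ) (n : ℕ) :
    ∑ z ∈ Finset.Icc (x - n) (x + n), (1 + |(x : ℝ) - z|)⁻¹ ^ 2 ≤ 3 - 2 / (n + 1) := by
  induction n with
  | zero => norm_num
  | succ n ih =>
    have e : Finset.Icc (x - (n + 1 : ℕ)) (x + (n + 1 : ℕ)) =
        insert (x - (n + 1)) (insert (x + (n + 1)) (Finset.Icc (x - n) (x + n))) := by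
      ext z
      simp only [Finset.mem_insert, Finset.mem_Icc]
      push_cast
      omega
    rw [e, Finset.sum_insert, Finset.sum_insert]
    · have h1 : |(x : ℝ) - ((x - (n + 1) : ℤ) : ℝ)| = n + 1 := by
        push_cast
        rw [sub_sub_cancel]
        exact abs_of_nonneg (by positivity)
      have h2 : |(x : ℝ) - ((x + (n + 1) : ℤ) : ℝ)| = n + 1 := by
        push_cast
        rw [sub_add_cancel_left, abs_neg]
        exact abs_of_nonneg (by positivity)
      rw [h1, h2]
      have h3 : (1 + ((n : ℝ) + 1))⁻¹ ^ 2 ≤ 1 / (n + 1) - 1 / (n + 2) := by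
        rw [div_sub_div _ _ (by positivity) (by positivity), inv_pow, inv_eq_one_div,
          div_le_div_iff₀ (by positivity) (by positivity)]
        nlinarith
      have h4 : (2 : ℝ) / (n + 1) = 2 * (1 / (n + 1)) := by ring
      have h5 : (2 : ℝ) / ((n + 1 : ℕ) + 1) = 2 * (1 / (n + 2)) := by
        push_cast
        ring
      rw [h5]
      rw [h4] at ih
      linarith
    · simp
    · simp only [Finset.mem_insert, Finset.mem_Icc]
      omega

lemma sum_inv_sq_le (x : ℤ) (s : Finset ℤ) : ∑ z ∈ s, (1 + |(x : ℝ) - z|)⁻¹ ^ 2 ≤ 3 := by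
  obtain ⟨n, hn⟩ : ∃ n : ℕ, ∀ z ∈ s, |x - z| ≤ n := by
    refine ⟨∑ z ∈ s, (x - z).natAbs, fun z hz => ?_⟩
    have := Finset.single_le_sum (f := fun z => (x - z).natAbs) (fun _ _ => Nat.zero_le _) hz
    rw [Int.abs_eq_natAbs]
    exact_mod_cast this
  have h : s ⊆ Finset.Icc (x - n) (x + n) := fun z hz => by
    have := abs_le.1 (hn z hz)
    rw [Finset.mem_Icc]
    omega
  have h1 := Finset.sum_le_sum_of_subset_of_nonneg (f := fun z : ℤ => (1 + |(x : ℝ) - z|)⁻¹ ^ 2) h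
    fun _ _ _ => by positivity
  have h2 := sum_Icc_inv_sq_le x n
  have : (0 : ℝ) ≤ 2 / (n + 1) := by positivity
  linarith

/-- A summable kernel on plaquettes, decaying with the distance. -/
def kern (p q : Plaq Λ) : ℝ := ∏ i, (1 + |(p.1.1 i : ℝ) - q.1.1 i|)⁻¹ ^ 2

lemma kern_nonneg (p q : Plaq Λ) : 0 ≤ kern p q := Finset.prod_nonneg fun _ _ => by positivity

lemma kern_symm (p q : Plaq Λ) : kern p q = kern q p := by
  unfold kern
  simp only [abs_sub_comm]

lemma le_kern {n : ℤ} (h : ∀ i, 1 + |p.1.1 i - q.1.1 i| ≤ 4 * n) :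
    ((4 * (n : ℝ)) ^ 8)⁻¹ ≤ kern p q := by
  have hn : (0 : ℝ) < 4 * n := by
    have := h 0
    have := abs_nonneg (p.1.1 0 - q.1.1 0)
    exact_mod_cast (by omega : 0 < 4 * n)
  calc ((4 * (n : ℝ)) ^ 8)⁻¹ = ∏ _i : Fin 4, (4 * (n : ℝ))⁻¹ ^ 2 := by
        rw [Finset.prod_const, Finset.card_univ, Fintype.card_fin, ← pow_mul, inv_pow]
    _ ≤ kern p q := by
        refine Finset.prod_le_prod (fun _ _ => by positivity) fun i _ => ?_
        refine pow_le_pow_left₀ (by positivity) (inv_anti₀ (by positivity) ?_) 2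
        exact_mod_cast h i

lemma sum_kern_le [Fintype (Plaq Λ)] (p : Plaq Λ) : ∑ q, kern p q ≤ 1296 := by
  set f : Site × Fin 4 × Fin 4 → ℝ := fun y => ∏ i, (1 + |(p.1.1 i : ℝ) - y.1 i|)⁻¹ ^ 2 with hf
  set S : Finset Site := Fintype.piFinset fun i => Finset.Icc (Λ.a i) (Λ.b i) with hS
  have h1 : ∑ q, kern p q ≤ ∑ y ∈ S ×ˢ (Finset.univ : Finset (Fin 4 × Fin 4)), f y := by
    have : ∑ q, kern p q =
        ∑ y ∈ (Finset.univ : Finset (Plaq Λ)).map (Function.Embedding.subtype _), f y := by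
      rw [Finset.sum_map]
      rfl
    rw [this]
    refine Finset.sum_le_sum_of_subset_of_nonneg (fun y hy => ?_)
      fun y _ _ => Finset.prod_nonneg fun _ _ => by positivity
    obtain ⟨q, -, rfl⟩ := Finset.mem_map.1 hy
    refine Finset.mem_product.2 ⟨Fintype.mem_piFinset.2 fun i => Finset.mem_Icc.2 ?_,
      Finset.mem_univ _⟩
    exact q.2.2.1 i
  refine h1.trans ?_
  rw [Finset.sum_product]
  have h2 : ∑ y ∈ S, ∏ i, (1 + |(p.1.1 i : ℝ) - y i|)⁻¹ ^ 2 ≤ 3 ^ 4 := by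
    rw [hS, ← Finset.prod_univ_sum (fun i => Finset.Icc (Λ.a i) (Λ.b i))
      fun i z => (1 + |(p.1.1 i : ℝ) - z|)⁻¹ ^ 2]
    calc _ ≤ ∏ _i : Fin 4, (3 : ℝ) := Finset.prod_le_prod
          (fun _ _ => Finset.sum_nonneg fun _ _ => by positivity) fun i _ => sum_inv_sq_le _ _
      _ = 3 ^ 4 := by simp
  have h3 : ∑ y ∈ S, ∑ z : Fin 4 × Fin 4, f (y, z)
      = 16 * ∑ y ∈ S, ∏ i, (1 + |(p.1.1 i : ℝ) - y i|)⁻¹ ^ 2 := by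
    rw [Finset.mul_sum]
    refine Finset.sum_congr rfl fun y _ => ?_
    simp [hf]
  rw [h3]
  linarith

/-- The lower bound for the joining trees on a tangled set of `n` plaquettes. -/
def treeRate (n : ℕ) : ℝ := 2 ^ 24 * (n : ℝ) ^ 8 / (2 ^ 24) ^ n

lemma treeRate_nonneg (n : ℕ) : 0 ≤ treeRate n := by
  unfold treeRate
  positivity

lemma treeRate_add_le {a b : ℕ} (ha : 0 < a) (hab : a ≤ b) :
    treeRate (a + b) ≤ ((4 * (a : ℝ)) ^ 8)⁻¹ * (treeRate a * treeRate b) := by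
  have ha' : (0 : ℝ) < a := by exact_mod_cast ha
  have hab' : (a : ℝ) ≤ b := by exact_mod_cast hab
  have e : ((4 * (a : ℝ)) ^ 8)⁻¹ * (treeRate a * treeRate b) =
      2 ^ 24 * (2 * (b : ℝ)) ^ 8 / (2 ^ 24) ^ (a + b) := by
    unfold treeRate
    rw [pow_add]
    field_simp
    norm_num
  rw [e]
  unfold treeRate
  push_cast
  gcongr
  linarith

lemma Tangled.treeBound [Fintype K] (hχ : ∀ a b : G, IsConj a b → χ a = χ b)
    (hB₁ : (S2 B₁).Nonempty) (hB₂ : (S2 B₂).Nonempty)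
    (hT : Tangled χ β ℓb B₁ B₂ (S2 B₁ ∪ S2 B₂) K) (hK : S2 B₁ ∪ S2 B₂ ⊆ K) :
    TreeBound kern K.toFinset (treeRate K.toFinset.card) := by
  have hKne : K.toFinset.Nonempty := by
    rw [Set.toFinset_nonempty]
    exact (hB₁.mono Set.subset_union_left).mono hK
  refine (merge_induction (Good := fun A : Finset (Plaq Λ) =>
      (∀ p ∈ A, ∀ q ∈ A, ∀ i, q.top i - p.1.1 i ≤ 2 * (A.card : ℤ) - 1) ∧
        TreeBound kern A (treeRate A.card)) hKne (fun p _ => ⟨?_, ?_⟩) ?_).2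
  · intro p₁ h₁ p₂ h₂ i
    rw [Finset.mem_singleton.1 h₁, Finset.mem_singleton.1 h₂, Finset.card_singleton]
    have := p.top_le i
    push_cast
    omega
  · intro q hq
    rw [Finset.mem_singleton.1 hq, Finset.card_singleton]
    exact ⟨1, by norm_num [treeRate], JoinTree.single p⟩
  · rintro A hA hne hAK ⟨hspan, htree⟩
    have hA' : (A : Set (Plaq Λ)) ⊆ K := fun p hp => Set.mem_toFinset.1 (hA hp)
    have hcard : 0 < A.card := Finset.card_pos.2 hne
    obtain ⟨p, hp, q, hq, hpq, hnear⟩ := hT.exists_near (n := A.card) hχ hB₁ hB₂ hK hA' hne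
      (by
        obtain ⟨q, hq, hqA⟩ := Finset.exists_of_ssubset (hA.ssubset_of_ne hAK)
        exact ⟨q, Set.mem_toFinset.1 hq, hqA⟩)
      (by exact_mod_cast hcard) hspan
    refine ⟨q, Finset.mem_sdiff.2 ⟨Set.mem_toFinset.2 hq.1, hq.2⟩, ?_⟩
    rintro A' hA'K hqA' hd hle ⟨hspan', htree'⟩
    rw [Finset.card_union_of_disjoint hd]
    refine ⟨?_, ?_⟩
    · push_cast
      rcases hnear with hnear | hN
      · have cross : ∀ r ∈ A, ∀ s ∈ A', ∀ i,
            s.top i - r.1.1 i ≤ 2 * ((A.card : ℤ) + A'.card) - 1 ∧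
            r.top i - s.1.1 i ≤ 2 * ((A.card : ℤ) + A'.card) - 1 := by
          intro r hr s hs i
          obtain ⟨⟨p₁, hp₁, h₁⟩, p₂, hp₂, h₂⟩ := hnear i
          have := hspan p₁ hp₁ r hr i
          have := hspan r hr p₂ hp₂ i
          have := hspan' q hqA' s hs i
          have := hspan' s hs q hqA' i
          have := q.base_le_top i
          omega
        intro r hr s hs i
        rcases Finset.mem_union.1 hr with hr | hr <;> rcases Finset.mem_union.1 hs with hs | hs
        · have := hspan r hr s hs i
          omega
        · exact (cross r hr s hs i).1
        · exact (cross s hs r hr i).2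
        · have := hspan' r hr s hs i
          omega
      · intro r _ s _ i
        have := hN i
        have := r.a_le i
        have := s.top_le_b i
        omega
    · intro r hr
      obtain ⟨v, hv, ht⟩ := TreeBound.union kern_nonneg kern_symm (treeRate_nonneg _)
        (treeRate_nonneg _) htree htree' hd hp hqA' r hr
      refine ⟨v, le_trans ?_ hv, ht⟩
      refine (treeRate_add_le hcard hle).trans
        (mul_le_mul_of_nonneg_right ?_ (mul_nonneg (treeRate_nonneg _) (treeRate_nonneg _)))
      have := le_kern hpq
      push_cast at this
      exact this

lemma card_le_of_treeBound [Fintype (Plaq Λ)] {p : Plaq Λ} {m : ℕ} (hm : 0 < m)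
    (S : Finset (Finset (Plaq Λ)))
    (hS : ∀ K ∈ S, p ∈ K ∧ K.card = m ∧ TreeBound kern K (treeRate K.card)) :
    (S.card : ℝ) ≤ (10 ^ 11) ^ m := by
  have h1 : (S.card : ℝ) * ((2 ^ 24) ^ m)⁻¹ ≤ 1296 ^ (m - 1) * catalan (m - 1) := by
    refine le_trans ?_ (sum_treeSum_le kern_nonneg sum_kern_le (m - 1) p)
    calc (S.card : ℝ) * ((2 ^ 24) ^ m)⁻¹ = ∑ _K ∈ S, ((2 ^ 24 : ℝ) ^ m)⁻¹ := by
          rw [Finset.sum_const, nsmul_eq_mul]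
      _ ≤ ∑ K ∈ S, treeSum kern (m - 1) p K := by
          refine Finset.sum_le_sum fun K hK => ?_
          obtain ⟨hp, hc, ht⟩ := hS K hK
          obtain ⟨v, hv, hj⟩ := ht p hp
          have := hj.le_treeSum kern_nonneg
          rw [hc] at hv this
          refine le_trans ?_ (le_trans hv this)
          unfold treeRate
          rw [inv_eq_one_div]
          gcongr
          have : (1 : ℝ) ≤ (m : ℝ) ^ 8 := one_le_pow₀ (by exact_mod_cast hm)
          linarith
      _ ≤ ∑ K, treeSum kern (m - 1) p K :=
          Finset.sum_le_sum_of_subset_of_nonneg (Finset.subset_univ _)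
            fun _ _ _ => treeSum_nonneg kern_nonneg _ _ _
  have h2 : (1296 : ℝ) ^ (m - 1) * catalan (m - 1) ≤ 5184 ^ m := by
    have : (catalan (m - 1) : ℝ) ≤ 4 ^ (m - 1) := by exact_mod_cast catalan_le_four_pow _
    calc (1296 : ℝ) ^ (m - 1) * catalan (m - 1) ≤ 1296 ^ (m - 1) * 4 ^ (m - 1) := by gcongr
      _ = 5184 ^ (m - 1) := by rw [← mul_pow]; norm_num
      _ ≤ 5184 ^ m := pow_le_pow_right₀ (by norm_num) (Nat.sub_le _ _)
  have h3 := h1.trans h2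
  rw [← div_eq_mul_inv, div_le_iff₀ (by positivity), ← mul_pow] at h3
  exact h3.trans (pow_le_pow_left₀ (by norm_num) (by norm_num) m)

end Kernel

section Gap

variable {Λ : Box} {G : Type*} [Group G] {B₁ B₂ : Rect Λ} {K : Set (Plaq Λ)} {L : ℕ}

lemma exists_gap (hL : 1 ≤ L)
    (hdist : ∀ x y : Site, B₁.memV x → B₂.memV y → ∃ i, (L : ℤ) ≤ |x i - y i|) :
    ∃ i, B₁.hi i + L ≤ B₂.lo i ∨ B₂.hi i + L ≤ B₁.lo i := by
  by_contra! h
  have hc : ∀ i, ∃ a b : ℤ, (B₁.lo i ≤ a ∧ a ≤ B₁.hi i) ∧ (B₂.lo i ≤ b ∧ b ≤ B₂.hi i) ∧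
      |a - b| < L := by
    intro i
    obtain ⟨h1, h2⟩ := h i
    have h3 := B₁.lo_le_hi i
    have h4 := B₂.lo_le_hi i
    rcases lt_or_ge (B₁.hi i) (B₂.lo i) with h5 | h5
    · exact ⟨B₁.hi i, B₂.lo i, ⟨h3, le_rfl⟩, ⟨le_rfl, h4⟩, abs_lt.2 ⟨by omega, by omega⟩⟩
    rcases lt_or_ge (B₂.hi i) (B₁.lo i) with h6 | h6
    · exact ⟨B₁.lo i, B₂.hi i, ⟨le_rfl, h3⟩, ⟨h4, le_rfl⟩, abs_lt.2 ⟨by omega, by omega⟩⟩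
    · refine ⟨max (B₁.lo i) (B₂.lo i), max (B₁.lo i) (B₂.lo i), ⟨le_max_left _ _, max_le h3 h5⟩,
        ⟨le_max_right _ _, max_le h6 h4⟩, ?_⟩
      rw [sub_self, abs_zero]
      omega
  choose x y hx hy hxy using hc
  obtain ⟨i, hi⟩ := hdist x y hx hy
  exact absurd (hxy i) (not_lt.2 hi)

lemma boxSep_of_top_ne {i : Fin 4} {s : ℤ} (hab : Λ.a ≤ Λ.b) (h1 : Λ.a i ≤ s) (h2 : s < Λ.b i)
    (hs : ∀ p ∈ K, p.top i ≠ s) :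
    BoxSep G {p ∈ K | p.top i < s} (K \ {p ∈ K | p.top i < s}) := by
  refine ⟨Λ.a, Function.update Λ.b i s, goodBox_halfspace G i hab h1 h2, ?_, ?_⟩
  · rintro p ⟨-, hp⟩
    refine ⟨plaqInBox_iff.2 fun j => ⟨p.a_le j, ?_⟩, not_plaqInShell fun j =>
      ⟨fun h => absurd h (lt_irrefl _), fun h => ?_⟩⟩
    · by_cases hj : j = i
      · subst hj; simpa using hp.le
      · simpa [hj] using p.top_le_b j
    · by_cases hj : j = i
      · subst hj; simpa using hp
      · simp [hj] at h
  · rintro p ⟨hp, hn⟩ hin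
    have h3 := (plaqInBox_iff.1 hin i).2
    rw [Function.update_self] at h3
    exact hn ⟨hp, lt_of_le_of_ne h3 (hs p hp)⟩

lemma le_ncard_of_gap (hK : S2 B₁ ∪ S2 B₂ ⊆ K) {i : Fin 4} (hgap : B₁.hi i + L ≤ B₂.lo i)
    (H : ∀ A ⊆ K, S2 B₁ ⊆ A → S2 B₂ ⊆ K \ A → ¬ Sep G A (K \ A)) :
    L ≤ (K \ (S2 B₁ ∪ S2 B₂)).ncard + 1 := by
  have hab : Λ.a ≤ Λ.b := fun j => (B₁.a_le_lo j).trans ((B₁.lo_le_hi j).trans (B₁.hi_le_b j))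
  have hsub : Set.Ioo (B₁.hi i) (B₂.lo i) ⊆
      (fun p : Plaq Λ => p.top i) '' (K \ (S2 B₁ ∪ S2 B₂)) := by
    rintro s ⟨h1, h2⟩
    by_contra hs
    have hs1 : ∀ p ∈ S2 B₁, p.top i < s := fun p hp => (mem_S2_iff.1 hp i).2.trans_lt h1
    have hs2 : ∀ p ∈ S2 B₂, s < p.top i := fun p hp =>
      h2.trans_le ((mem_S2_iff.1 hp i).1.trans (p.base_le_top i))
    refine H {p ∈ K | p.top i < s} (fun p hp => hp.1)
      (fun p hp => ⟨hK (Or.inl hp), hs1 p hp⟩)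
      (fun p hp => ⟨hK (Or.inr hp), fun h => (hs2 p hp).not_gt h.2⟩)
      (Or.inl (boxSep_of_top_ne hab ?_ ?_ ?_))
    · exact ((B₁.a_le_lo i).trans (B₁.lo_le_hi i)).trans h1.le
    · exact h2.trans_le ((B₂.lo_le_hi i).trans (B₂.hi_le_b i))
    · intro p hp he
      refine hs ⟨p, ⟨hp, ?_⟩, he⟩
      rintro (h | h)
      · exact (hs1 p h).ne he
      · exact (hs2 p h).ne' he
  have h1 := (Set.ncard_le_ncard hsub (Set.toFinite _)).trans (Set.ncard_image_le (Set.toFinite _))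
  rw [← Finset.coe_Ioo, Set.ncard_coe_finset, Int.card_Ioo] at h1
  omega

lemma Tangled.le_ncard {x₀ : VSite Λ} {χ : G → ℂ} {β : ℝ}
    {ℓb : ∀ x : VSite Λ, (latticeGraph Λ).Walk x₀ x}
    (hχ : ∀ a b : G, IsConj a b → χ a = χ b)
    (hB₁ : (S2 B₁).Nonempty) (hB₂ : (S2 B₂).Nonempty)
    (hT : Tangled χ β ℓb B₁ B₂ (S2 B₁ ∪ S2 B₂) K) (hK : S2 B₁ ∪ S2 B₂ ⊆ K) (hL : 1 ≤ L)
    (hdist : ∀ x y : Site, B₁.memV x → B₂.memV y → ∃ i, (L : ℤ) ≤ |x i - y i|) :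
    L ≤ (K \ (S2 B₁ ∪ S2 B₂)).ncard + 1 := by
  obtain ⟨i, hi | hi⟩ := exists_gap hL hdist
  · refine le_ncard_of_gap (G := G) hK hi fun A hA h1 h2 hs => hT.1 ?_
    obtain ⟨S⟩ := hs.splitting ℓb
    have := S.swappable (χ := χ) (β := β) (P₀ := S2 B₁ ∪ S2 B₂) hχ hB₁ hB₂ h1 h2
    rwa [Set.union_sdiff_cancel hA] at this
  · rw [Set.union_comm]
    refine le_ncard_of_gap (G := G) (by rwa [Set.union_comm]) hi fun A hA h1 h2 hs => hT.1 ?_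
    obtain ⟨S⟩ := hs.symm.splitting ℓb
    have := S.swappable (χ := χ) (β := β) (P₀ := S2 B₁ ∪ S2 B₂) hχ hB₁ hB₂ h2 h1
    rwa [Set.sdiff_union_of_subset hA] at this

end Gap

section Sum

variable {Λ : Box} {x₀ : VSite Λ} {G : Type*} [Group G] {χ : G → ℂ} {β Δ : ℝ}
  {ℓb : ∀ x : VSite Λ, (latticeGraph Λ).Walk x₀ x} {B₁ B₂ : Rect Λ} {L : ℕ}

lemma card_tangled_le [Fintype (Plaq Λ)] (hχ : ∀ a b : G, IsConj a b → χ a = χ b)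
    (hB₁ : (S2 B₁).Nonempty) (hB₂ : (S2 B₂).Nonempty) {m : ℕ} (hm : 0 < m)
    (N : Finset (Set (Plaq Λ)))
    (hN : ∀ K ∈ N, S2 B₁ ∪ S2 B₂ ⊆ K ∧ Tangled χ β ℓb B₁ B₂ (S2 B₁ ∪ S2 B₂) K ∧ K.ncard = m) :
    (N.card : ℝ) ≤ (10 ^ 11) ^ m := by
  obtain ⟨p, hp⟩ := hB₁
  have hinj : Function.Injective (fun K : Set (Plaq Λ) => K.toFinset) :=
    fun _ _ h => Set.toFinset_inj.1 h
  rw [← Finset.card_image_of_injective N hinj]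
  refine card_le_of_treeBound (p := p) hm _ fun F hF => ?_
  obtain ⟨K, hK, rfl⟩ := Finset.mem_image.1 hF
  obtain ⟨h1, h2, h3⟩ := hN K hK
  exact ⟨Set.mem_toFinset.2 (h1 (Or.inl hp)), by rw [← Set.ncard_eq_toFinset_card', h3],
    h2.treeBound hχ ⟨p, hp⟩ hB₂ h1⟩

lemma sum_pairM_tangled_le [Finite G] [Fintype (Set (Plaq Λ))]
    (hχ : ∀ a b : G, IsConj a b → χ a = χ b)
    (hB₁ : (S2 B₁).Nonempty) (hB₂ : (S2 B₂).Nonempty)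
    (hβ : 0 ≤ β) (h0 : ∀ g : G, 0 ≤ (χ 1 - χ g).re) (hΔ0 : 0 ≤ Δ)
    (hΔ : ∀ g : G, g ≠ 1 → Δ ≤ (χ 1 - χ g).re)
    (hy : 10 ^ 11 * (Nat.card G : ℝ) ^ 2 * Real.exp (-(β / 2 * Δ)) ≤ 1 / 2) (hL : 1 ≤ L)
    (hdist : ∀ x y : Site, B₁.memV x → B₂.memV y → ∃ i, (L : ℤ) ≤ |x i - y i|) :
    ∑ K : Set (Plaq Λ) with S2 B₁ ∪ S2 B₂ ⊆ K ∧ Tangled χ β ℓb B₁ B₂ (S2 B₁ ∪ S2 B₂) K,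
        pairM G χ β ℓb (S2 B₁ ∪ S2 B₂) K ≤
      2 * (10 ^ 11 * (Nat.card G : ℝ) ^ 2) ^ (B₁.plaqCard + B₂.plaqCard) *
        Real.exp (-(β / 2 * Δ)) ^ (L - 1) := by
  let _ := Fintype.ofFinite (Plaq Λ)
  set P₀ := S2 B₁ ∪ S2 B₂ with hP₀
  set D : ℝ := 10 ^ 11 * (Nat.card G : ℝ) ^ 2 with hD
  set y := Real.exp (-(β / 2 * Δ)) with hydef
  set N : Finset (Set (Plaq Λ)) :=
    {K | P₀ ⊆ K ∧ Tangled χ β ℓb B₁ B₂ P₀ K} with hN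
  have hy0 : 0 ≤ y := (Real.exp_pos _).le
  have hy1 : y ≤ 1 := Real.exp_le_one_iff.2 (neg_nonpos.2 (by positivity))
  have hg1 : (1 : ℝ) ≤ Nat.card G := by exact_mod_cast Nat.card_pos (α := G)
  have hD1 : 1 ≤ D := by
    have : (1 : ℝ) ≤ (Nat.card G : ℝ) ^ 2 := one_le_pow₀ hg1
    rw [hD]; linarith
  have hyy : Real.exp (-(β * Δ)) = y * y := by
    rw [hydef, ← Real.exp_add]; ring_nf
  have hc : P₀.ncard ≤ B₁.plaqCard + B₂.plaqCard := Set.ncard_union_le _ _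
  have hcpos : 0 < P₀.ncard := (Set.ncard_pos (Set.toFinite _)).2 (hB₁.mono Set.subset_union_left)
  have hmaps : ∀ K ∈ N, (K \ P₀).ncard ∈ Finset.range (Fintype.card (Plaq Λ) + 1) := fun K _ => by
    rw [Finset.mem_range, Nat.lt_succ_iff, ← Nat.card_eq_fintype_card, ← Set.ncard_univ]
    exact Set.ncard_le_ncard (Set.subset_univ _) (Set.toFinite _)
  rw [← Finset.sum_fiberwise_of_maps_to hmaps]
  have hfib : ∀ n, ∑ K ∈ N with (K \ P₀).ncard = n, pairM G χ β ℓb P₀ K ≤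
      D ^ (B₁.plaqCard + B₂.plaqCard) * y ^ (L - 1) * (1 / 2) ^ n := by
    intro n
    have hK : ∀ K ∈ N.filter (fun K => (K \ P₀).ncard = n),
        P₀ ⊆ K ∧ Tangled χ β ℓb B₁ B₂ P₀ K ∧ K.ncard = n + P₀.ncard := by
      intro K hK
      simp only [hN, Finset.mem_filter, Finset.mem_univ, true_and] at hK
      obtain ⟨⟨h1, h2⟩, h3⟩ := hK
      refine ⟨h1, h2, ?_⟩
      rw [← h3]
      exact (Set.ncard_sdiff_add_ncard_of_subset h1 (Set.toFinite _)).symm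
    rcases (N.filter (fun K => (K \ P₀).ncard = n)).eq_empty_or_nonempty with he | ⟨K₁, hK₁⟩
    · rw [he, Finset.sum_empty]; positivity
    have hLn : L - 1 ≤ n := by
      have h1 := Tangled.le_ncard hχ hB₁ hB₂ (hK K₁ hK₁).2.1 (hK K₁ hK₁).1 hL hdist
      rw [← hP₀, (Finset.mem_filter.1 hK₁).2] at h1
      omega
    calc ∑ K ∈ N with (K \ P₀).ncard = n, pairM G χ β ℓb P₀ K
        ≤ ∑ K ∈ N with (K \ P₀).ncard = n,
            ((Nat.card G : ℝ) ^ 2) ^ (n + P₀.ncard) * (y * y) ^ n := by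
          refine Finset.sum_le_sum fun K hK' => (pairM_le hβ h0 hΔ).trans_eq ?_
          rw [(hK K hK').2.2, (Finset.mem_filter.1 hK').2, hyy]
      _ = (N.filter (fun K => (K \ P₀).ncard = n)).card *
            (((Nat.card G : ℝ) ^ 2) ^ (n + P₀.ncard) * (y * y) ^ n) := by
          rw [Finset.sum_const, nsmul_eq_mul]
      _ ≤ (10 ^ 11) ^ (n + P₀.ncard) *
            (((Nat.card G : ℝ) ^ 2) ^ (n + P₀.ncard) * (y * y) ^ n) :=
          mul_le_mul_of_nonneg_right
            (card_tangled_le hχ hB₁ hB₂ (by omega) _ hK) (by positivity)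
      _ = D ^ P₀.ncard * y ^ n * (D * y) ^ n := by
          rw [hD]; simp only [mul_pow, pow_add]; ring
      _ ≤ D ^ (B₁.plaqCard + B₂.plaqCard) * y ^ (L - 1) * (1 / 2) ^ n := by
          have e1 := pow_le_pow_right₀ hD1 hc
          have e2 := pow_le_pow_of_le_one hy0 hy1 hLn
          gcongr
  refine (Finset.sum_le_sum fun n _ => hfib n).trans ?_
  rw [← Finset.mul_sum]
  have := sum_geometric_two_le (Fintype.card (Plaq Λ) + 1)
  calc _ ≤ D ^ (B₁.plaqCard + B₂.plaqCard) * y ^ (L - 1) * 2 :=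
        mul_le_mul_of_nonneg_left this (by positivity)
    _ = _ := by ring

end Sum

section Numeric

lemma mul_exp_le_half {g t : ℝ} (hg : 1 ≤ g) (ht : 57 + 2 * Real.log g ≤ t) :
    10 ^ 11 * g ^ 2 * Real.exp (-t) ≤ 1 / 2 := by
  have hg0 : 0 < g := by linarith
  have h1 : Real.exp (57 + 2 * Real.log g) = Real.exp 1 ^ 57 * g ^ 2 := by
    rw [Real.exp_add, ← Real.exp_nat_mul, two_mul, Real.exp_add, Real.exp_log hg0, sq]
    norm_num
  have h2 : (2 : ℝ) ^ 57 ≤ Real.exp 1 ^ 57 := by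
    refine pow_le_pow_left₀ (by norm_num) ?_ 57
    have := Real.add_one_le_exp (1 : ℝ)
    linarith
  have h3 : Real.exp 1 ^ 57 * g ^ 2 ≤ Real.exp t := h1 ▸ Real.exp_le_exp.2 ht
  rw [Real.exp_neg, ← div_eq_mul_inv, div_le_iff₀ (Real.exp_pos _)]
  have h4 : (2 : ℝ) ^ 57 * g ^ 2 ≤ Real.exp 1 ^ 57 * g ^ 2 :=
    mul_le_mul_of_nonneg_right h2 (by positivity)
  have h5 : (0 : ℝ) ≤ g ^ 2 := by positivity
  have h6 : (2 : ℝ) ^ 57 * g ^ 2 = 144115188075855872 * g ^ 2 := by norm_num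
  linarith

end Numeric

section Trivial

variable {Λ : Box} {x₀ : VSite Λ} {G : Type*} [Group G] {B : Rect Λ}

lemma WalkInRect.hol_eq {σ : EdgeConf Λ G} {g : Site → G}
    (hg : ∀ x k, x ∈ Set.Icc B.lo B.hi → x + unit k ∈ Set.Icc B.lo B.hi →
      siteField σ x k = (g x)⁻¹ * g (x + unit k))
    {u v : VSite Λ} (γ : (latticeGraph Λ).Walk u v) (hγ : WalkInRect B γ) :
    hol σ γ = (g u)⁻¹ * g v := by
  induction γ with
  | nil => simp
  | @cons u w v h q ih =>
    have hu : (u : Site) ∈ Set.Icc B.lo B.hi := by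
      have := hγ u (by simp)
      exact ⟨fun i => (this i).1, fun i => (this i).2⟩
    have hw : (w : Site) ∈ Set.Icc B.lo B.hi := by
      have := hγ w (by simp)
      exact ⟨fun i => (this i).1, fun i => (this i).2⟩
    rw [hol_cons, ih fun x hx => hγ x (by simp [hx])]
    obtain ⟨i, hi | hi⟩ := h
    · rw [oval_pos σ hi, hg _ _ hu (hi ▸ hw), hi]; group
    · rw [oval_neg σ hi, hg _ _ hw (hi ▸ hu), hi]; group

lemma evalLoop_eq_one_of_S2_eq_empty (hB : S2 B = ∅) (ψ : Hom Λ x₀ G)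
    (ℓb : ∀ x : VSite Λ, (latticeGraph Λ).Walk x₀ x) {u : VSite Λ}
    (γ : (latticeGraph Λ).Walk u u) (hγ : WalkInRect B γ) : evalLoop ψ ℓb γ = 1 := by
  obtain ⟨σ, rfl⟩ := psi_surjective ℓb ψ
  have hm : ∀ {x : Site}, x ∈ Set.Icc B.lo B.hi → B.memV x := fun h i => ⟨h.1 i, h.2 i⟩
  obtain ⟨g, hg⟩ := flatTrivial_Icc G B.lo B.hi (siteField σ) fun x k l hkl h0 h1 h2 h3 => by
    obtain ⟨p, hp, -⟩ := exists_plaq_of_square hkl (hm h0) (hm h1) (hm h3) (hm h2)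
    rw [hB] at hp
    exact hp.elim
  rw [isConj_eq_one_iff (isConj_evalLoop_psi σ ℓb γ), hγ.hol_eq hg γ, inv_mul_cancel]

end Trivial

section Character

variable {G : Type*} [Group G] {d : ℕ} (ρ : G →* Matrix.unitaryGroup (Fin d) ℂ)

lemma chi_conj {a b : G} (h : IsConj a b) : chi ρ a = chi ρ b := by
  obtain ⟨c, rfl⟩ := isConj_iff.1 h
  unfold chi
  rw [map_mul, map_mul, Submonoid.coe_mul, Submonoid.coe_mul, Matrix.trace_mul_cycle,
    ← Submonoid.coe_mul, ← map_mul, inv_mul_cancel, map_one, OneMemClass.coe_one, one_mul]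

lemma chi_re_nonneg (g : G) : 0 ≤ (chi ρ 1 - chi ρ g).re := by
  have h1 : chi ρ 1 = d := by simp [chi]
  have h2 : (chi ρ g).re ≤ d := by
    unfold chi Matrix.trace
    rw [Complex.re_sum]
    refine (Finset.sum_le_card_nsmul _ _ 1 fun i _ => ?_).trans (by simp)
    exact (Complex.re_le_norm _).trans (entry_norm_bound_of_unitary (ρ g).2 i i)
  rw [h1, Complex.sub_re, Complex.natCast_re]
  linarith

lemma deltaG_nonneg : 0 ≤ DeltaG G (chi ρ) := by
  refine Real.sInf_nonneg ?_
  rintro _ ⟨g, -, rfl⟩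
  exact chi_re_nonneg ρ g

lemma deltaG_le [Finite G] (χ : G → ℂ) {g : G} (hg : g ≠ 1) : DeltaG G χ ≤ (χ 1 - χ g).re :=
  csInf_le ((Set.toFinite _).bddBelow) ⟨g, hg, rfl⟩

lemma ConjInvariant.eq_of_isConj {k : ℕ} {f : (Fin k → G) → ℂ} (hf : ConjInvariant f)
    {a b : Fin k → G} (h : ∀ i, IsConj (a i) (b i)) : f a = f b := by
  choose c hc using fun i => isConj_iff.1 (h i)
  rw [← hf a fun i => (c i)⁻¹]
  congr 1
  funext i
  rw [inv_inv, hc]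

end Character

section Global

variable {Λ : Box} {x₀ : VSite Λ} {G : Type*} [Group G] {χ : G → ℂ} {β : ℝ}
  {ℓb : ∀ x : VSite Λ, (latticeGraph Λ).Walk x₀ x} {B₁ B₂ : Rect Λ} {P₀ : Set (Plaq Λ)}

/-- The pairs of homomorphisms whose joint support can be swapped. -/
def swapSet (χ : G → ℂ) (β : ℝ) (ℓb : ∀ x : VSite Λ, (latticeGraph Λ).Walk x₀ x)
    (B₁ B₂ : Rect Λ) (P₀ : Set (Plaq Λ)) : Set (Hom Λ x₀ G × Hom Λ x₀ G) :=
  {Ψ | Swappable χ β ℓb B₁ B₂ P₀ (supp2 Λ x₀ ℓb P₀ Ψ.1 Ψ.2)}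

lemma exists_bijOn_swapSet :
    ∃ T : Hom Λ x₀ G × Hom Λ x₀ G → Hom Λ x₀ G × Hom Λ x₀ G,
      Set.BijOn T (swapSet χ β ℓb B₁ B₂ P₀) (swapSet χ β ℓb B₁ B₂ P₀) ∧
        ∀ Ψ ∈ swapSet χ β ℓb B₁ B₂ P₀, IsSwap χ β ℓb B₁ B₂ Ψ (T Ψ) := by
  have hE : ∀ P, ∃ e : Equiv.Perm (PairSupp G ℓb P₀ P), Swappable χ β ℓb B₁ B₂ P₀ P →
      ∀ Ψ, IsSwap χ β ℓb B₁ B₂ Ψ.1 (e Ψ).1 := fun P => by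
    by_cases h : Swappable χ β ℓb B₁ B₂ P₀ P
    · exact ⟨h.choose, fun _ => h.choose_spec⟩
    · exact ⟨1, fun h' => absurd h' h⟩
  choose e he using hE
  let s : Hom Λ x₀ G × Hom Λ x₀ G → Set (Plaq Λ) := fun Ψ => supp2 Λ x₀ ℓb P₀ Ψ.1 Ψ.2
  let T : Hom Λ x₀ G × Hom Λ x₀ G → Hom Λ x₀ G × Hom Λ x₀ G := fun Ψ => (e (s Ψ) ⟨Ψ, rfl⟩).1
  have hs : ∀ Ψ, s (T Ψ) = s Ψ := fun Ψ => (e (s Ψ) ⟨Ψ, rfl⟩).2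
  have hT : ∀ P Ψ (h : s Ψ = P), T Ψ = (e P ⟨Ψ, h⟩).1 := by rintro _ Ψ rfl; rfl
  refine ⟨T, ⟨fun Ψ hΨ => ?_, fun Ψ _ Φ _ h => ?_, fun Ψ hΨ => ?_⟩, fun Ψ hΨ => he _ hΨ _⟩
  · change Swappable χ β ℓb B₁ B₂ P₀ (s (T Ψ))
    rw [hs]
    exact hΨ
  · have h1 : s Φ = s Ψ := by rw [← hs Φ, ← hs Ψ, h]
    rw [hT _ Ψ rfl, hT _ Φ h1] at h
    exact congrArg Subtype.val ((e (s Ψ)).injective (Subtype.ext h))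
  · have h1 : s ((e (s Ψ)).symm ⟨Ψ, rfl⟩).1 = s Ψ := ((e (s Ψ)).symm ⟨Ψ, rfl⟩).2
    refine ⟨((e (s Ψ)).symm ⟨Ψ, rfl⟩).1, ?_, ?_⟩
    · change Swappable χ β ℓb B₁ B₂ P₀ (s _)
      rw [h1]
      exact hΨ
    · rw [hT _ _ h1]
      simp

lemma IsSwap.nuP_mul {Ψ Φ : Hom Λ x₀ G × Hom Λ x₀ G} (h : IsSwap χ β ℓb B₁ B₂ Ψ Φ) :
    nuP Λ x₀ χ β ℓb Φ.1 * nuP Λ x₀ χ β ℓb Φ.2 = nuP Λ x₀ χ β ℓb Ψ.1 * nuP Λ x₀ χ β ℓb Ψ.2 := by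
  unfold nuP
  rw [div_mul_div_comm, div_mul_div_comm]
  exact congrArg (· / _) h.1

lemma isSwap_self (h : S2 B₂ = ∅) (Ψ : Hom Λ x₀ G × Hom Λ x₀ G) :
    IsSwap χ β ℓb B₁ B₂ Ψ Ψ :=
  ⟨rfl, fun _ _ _ => IsConj.refl _, fun _ γ hγ => by
    rw [evalLoop_eq_one_of_S2_eq_empty h _ ℓb γ hγ, evalLoop_eq_one_of_S2_eq_empty h _ ℓb γ hγ]⟩

lemma isSwap_swap (h : S2 B₁ = ∅) (Ψ : Hom Λ x₀ G × Hom Λ x₀ G) :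
    IsSwap χ β ℓb B₁ B₂ Ψ Ψ.swap :=
  ⟨mul_comm _ _, fun _ γ hγ => by
    rw [evalLoop_eq_one_of_S2_eq_empty h _ ℓb γ hγ, evalLoop_eq_one_of_S2_eq_empty h _ ℓb γ hγ],
    fun _ _ _ => IsConj.refl _⟩

lemma nuP2_empty : nuP2 Λ x₀ χ β ℓb ∅ = 0 := finsum_mem_empty

lemma exists_isSwap [Finite G] {d : ℕ} (ρ : G →* Matrix.unitaryGroup (Fin d) ℂ)
    (hβ : (1 / DeltaG G (chi ρ)) * (114 + 4 * Real.log (Nat.card G)) ≤ β) (L : ℕ)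
    (hdist : ∀ x y : Site, B₁.memV x → B₂.memV y → ∃ i, (L : ℤ) ≤ |x i - y i|) :
    ∃ E : Set (Hom Λ x₀ G × Hom Λ x₀ G),
      nuP2 Λ x₀ (chi ρ) β ℓb Eᶜ ≤
        2 * (4 * 10 ^ 24 * (Nat.card G : ℝ) ^ 2) ^ (B₁.plaqCard + B₂.plaqCard) *
          Real.exp (-(β / 2) * DeltaG G (chi ρ) * ((L : ℝ) - 1)) ∧
      ∃ T : Hom Λ x₀ G × Hom Λ x₀ G → Hom Λ x₀ G × Hom Λ x₀ G,
        Set.BijOn T E E ∧ ∀ Ψ ∈ E, IsSwap (chi ρ) β ℓb B₁ B₂ Ψ (T Ψ) := by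
  set Δ := DeltaG G (chi ρ) with hΔdef
  have hg1 : (1 : ℝ) ≤ Nat.card G := by exact_mod_cast Nat.card_pos (α := G)
  have hlog : 0 ≤ Real.log (Nat.card G) := Real.log_nonneg hg1
  have hΔ0 : 0 ≤ Δ := deltaG_nonneg ρ
  have hβ0 : 0 ≤ β := le_trans (by positivity) hβ
  have hC : (1 : ℝ) ≤ 4 * 10 ^ 24 * (Nat.card G : ℝ) ^ 2 := by
    have : (1 : ℝ) ≤ (Nat.card G : ℝ) ^ 2 := one_le_pow₀ hg1
    linarith
  by_cases htriv : Δ = 0 ∨ L = 0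
  · refine ⟨∅, (nuP2_le_one _).trans ?_, id, Set.bijOn_id _, by simp⟩
    have h1 : (1 : ℝ) ≤ Real.exp (-(β / 2) * Δ * ((L : ℝ) - 1)) := by
      refine Real.one_le_exp ?_
      rcases htriv with h | h
      · simp [h]
      · rw [h, Nat.cast_zero]
        have : 0 ≤ β / 2 * Δ := by positivity
        linarith
    have h2 := one_le_pow₀ hC (n := B₁.plaqCard + B₂.plaqCard)
    nlinarith [mul_le_mul h2 h1 zero_le_one (zero_le_one.trans h2)]
  push Not at htriv
  obtain ⟨hΔne, hLne⟩ := htriv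
  have hΔpos : 0 < Δ := lt_of_le_of_ne hΔ0 hΔne.symm
  have hL : 1 ≤ L := Nat.one_le_iff_ne_zero.2 hLne
  rcases (S2 B₂).eq_empty_or_nonempty with h2 | hB₂
  · refine ⟨Set.univ, ?_, id, Set.bijOn_id _, fun Ψ _ => isSwap_self h2 Ψ⟩
    rw [Set.compl_univ, nuP2_empty]
    positivity
  rcases (S2 B₁).eq_empty_or_nonempty with h1 | hB₁
  · refine ⟨Set.univ, ?_, Prod.swap, Set.bijOn_univ.2 Prod.swap_bijective,
      fun Ψ _ => isSwap_swap h1 Ψ⟩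
    rw [Set.compl_univ, nuP2_empty]
    positivity
  refine ⟨swapSet (chi ρ) β ℓb B₁ B₂ (S2 B₁ ∪ S2 B₂), ?_, exists_bijOn_swapSet⟩
  let _ := Fintype.ofFinite (Set (Plaq Λ))
  have hχ : ∀ a b : G, IsConj a b → chi ρ a = chi ρ b := fun _ _ => chi_conj ρ
  have hy := mul_exp_le_half hg1 (t := β / 2 * Δ) (by
    rw [one_div, inv_mul_le_iff₀ hΔpos] at hβ
    linarith)
  have hsum := (nuP2_not_swappable_le (ℓb := ℓb) (β := β) hχ hB₁ hB₂ Set.subset_union_left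
    Set.subset_union_right).trans (sum_pairM_tangled_le hχ hB₁ hB₂ hβ0 (chi_re_nonneg ρ) hΔ0
      (fun g hg => deltaG_le (chi ρ) hg) hy hL hdist)
  refine hsum.trans ?_
  have hexp : Real.exp (-(β / 2 * Δ)) ^ (L - 1) = Real.exp (-(β / 2) * Δ * ((L : ℝ) - 1)) := by
    rw [← Real.exp_nat_mul, Nat.cast_sub hL, Nat.cast_one]
    ring_nf
  rw [hexp]
  gcongr
  norm_num

end Global

/-- Proposition 3.3: existence of an event `E(B₁,B₂) ⊆ Ω²` of large
probability together with a bijection `T : E(B₁,B₂) → E(B₁,B₂)` which is a swapping map with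
respect to `(E(B₁,B₂), h₁, h₂, ν_{Λ,β})` for every pair of conjugacy-invariant Wilson-type
functions `h₁, h₂` supported in `B₁, B₂`. -/
theorem exists_swapping_map
    (Λ : Box) (x₀ : VSite Λ) (G : Type*) [Group G] [Fintype G] [Nontrivial G]
    {d : ℕ} (ρ : G →* Matrix.unitaryGroup (Fin d) ℂ)
    (β : ℝ) (hβ : (1 / DeltaG G (chi ρ)) * (114 + 4 * Real.log (Nat.card G)) ≤ β)
    (L : ℕ) (B₁ B₂ : Rect Λ)
    (hdist : ∀ x y : Site, B₁.memV x → B₂.memV y → ∃ i, (L : ℤ) ≤ |x i - y i|)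
    (ℓb : ∀ x : VSite Λ, (latticeGraph Λ).Walk x₀ x) :
    ∃ E : Set (Hom Λ x₀ G × Hom Λ x₀ G),
      nuP2 Λ x₀ (chi ρ) β ℓb Eᶜ ≤
        2 * (4 * 10 ^ 24 * (Nat.card G : ℝ) ^ 2) ^ (B₁.plaqCard + B₂.plaqCard) *
          Real.exp (-(β / 2) * DeltaG G (chi ρ) * ((L : ℝ) - 1)) ∧
      ∃ T : Hom Λ x₀ G × Hom Λ x₀ G → Hom Λ x₀ G × Hom Λ x₀ G,
        Set.BijOn T E E ∧
        (∀ pr ∈ E,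
          nuP Λ x₀ (chi ρ) β ℓb (T pr).1 * nuP Λ x₀ (chi ρ) β ℓb (T pr).2
            = nuP Λ x₀ (chi ρ) β ℓb pr.1 * nuP Λ x₀ (chi ρ) β ℓb pr.2) ∧
        (∀ (k₁ k₂ : ℕ), 1 ≤ k₁ → 1 ≤ k₂ →
          ∀ (f₁ : (Fin k₁ → G) → ℂ) (f₂ : (Fin k₂ → G) → ℂ),
            ConjInvariant f₁ → ConjInvariant f₂ →
          ∀ (γ₁ : Fin k₁ → Σ u : VSite Λ, (latticeGraph Λ).Walk u u)
            (γ₂ : Fin k₂ → Σ u : VSite Λ, (latticeGraph Λ).Walk u u),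
            (∀ j, WalkInRect B₁ (γ₁ j).2) → (∀ j, WalkInRect B₂ (γ₂ j).2) →
          ∀ pr ∈ E,
            f₁ (fun j => evalLoop pr.1 ℓb (γ₁ j).2) *
                f₂ (fun j => evalLoop pr.2 ℓb (γ₂ j).2)
              = f₁ (fun j => evalLoop (T pr).1 ℓb (γ₁ j).2) *
                f₂ (fun j => evalLoop (T pr).1 ℓb (γ₂ j).2)) := by
  obtain ⟨E, hE, T, hT, hsw⟩ := exists_isSwap (ℓb := ℓb) ρ hβ L hdist
  refine ⟨E, hE, T, hT, fun pr hpr => (hsw pr hpr).nuP_mul, ?_⟩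
  intro k₁ k₂ _ _ f₁ f₂ hf₁ hf₂ γ₁ γ₂ hγ₁ hγ₂ pr hpr
  obtain ⟨-, h₁, h₂⟩ := hsw pr hpr
  rw [hf₁.eq_of_isConj fun j => h₁ _ _ (hγ₁ j), hf₂.eq_of_isConj fun j => h₂ _ _ (hγ₂ j)]

end LGT
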